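/- Let p : ℕ → (0,1] satisfy n·p(n) → ∞, let (G_n) be a sequence of graphs with |G_n| = n whose density is bounded by some constant, and let κ be a kernel bounded by some constant. Then the following are equivalent: (a) for every k ≥ 2, the Hausdorff distance, with respect to the ℓ∞ metric on k×k real matrices, between M_k(G_n) and M_k(κ) tends to 0 as n → ∞; (b) δ_□(G_n,κ) → 0 as n → ∞. -/

import Mathlib

open MeasureTheory Set Filter
open scoped ENNReal Classical

noncomputable section

/-- The (0-based) index of the subinterval `((i)/n, (i+1)/n]` of `[0,1]` containing `x`. -/
def idx (n : ℕ) (x : ℝ) : ℕ := ⌈x * n⌉₊ - 1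

/-- The subset of `[0,1]` corresponding to a set of vertices of a graph on `Fin n`:
the union of the intervals `(i/n, (i+1)/n]` for `i ∈ X` (vertices `0`-indexed). -/
def vtxSet (n : ℕ) (X : Finset (Fin n)) : Set ℝ :=
  ⋃ i ∈ X, Ioc ((i : ℝ) / n) (((i : ℝ) + 1) / n)

/-- The kernel associated to a graph `G` on `{1,…,n}` and normalizing constant `p`:
it takes the value `1/p` on `((i−1)/n, i/n] × ((j−1)/n, j/n]` whenever `ij ∈ E(G)`,
and `0` elsewhere. -/
def graphKernel {n : ℕ} (p : ℝ) (G : SimpleGraph (Fin n)) : ℝ → ℝ → ℝ := fun x y =>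
  if h : x ∈ Ioc (0:ℝ) 1 ∧ y ∈ Ioc (0:ℝ) 1 ∧ idx n x < n ∧ idx n y < n then
    (if G.Adj ⟨idx n x, h.2.2.1⟩ ⟨idx n y, h.2.2.2⟩ then 1 / p else 0)
  else 0

/-- The cut norm of `W : [0,1]² → ℝ`. -/
def cutNorm (W : ℝ → ℝ → ℝ) : ℝ :=
  sSup {r | ∃ S T : Set ℝ, MeasurableSet S ∧ MeasurableSet T ∧
    S ⊆ Icc 0 1 ∧ T ⊆ Icc 0 1 ∧ r = |∫ q in S ×ˢ T, W q.1 q.2|}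

/-- `τ` is a Lebesgue-measure-preserving bijection of `[0,1]`. -/
def MPBij (τ : ℝ → ℝ) : Prop :=
  MeasurePreserving τ (volume.restrict (Icc 0 1)) (volume.restrict (Icc 0 1)) ∧
    BijOn τ (Icc 0 1) (Icc 0 1)

/-- The cut distance between two kernels. -/
def cutDist (κ₁ κ₂ : ℝ → ℝ → ℝ) : ℝ :=
  sInf {r | ∃ τ : ℝ → ℝ, MPBij τ ∧ r = cutNorm (fun x y => κ₁ x y - κ₂ (τ x) (τ y))}

/-- The number of homomorphisms from `F` to `G`. -/
def homCount {α β : Type*} (F : SimpleGraph α) (G : SimpleGraph β) : ℕ :=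
  Nat.card (F →g G)

/-- The number of injective homomorphisms (embeddings) from `F` to `G`. -/
def embCount {α β : Type*} (F : SimpleGraph α) (G : SimpleGraph β) : ℕ :=
  Nat.card {φ : F →g G // Function.Injective φ}

/-- The number of edges of a graph. -/
def edgeCount {α : Type*} (F : SimpleGraph α) : ℕ := Nat.card F.edgeSet

/-- The normalized homomorphism count `t_p(F,G)`. -/
def tDen {α β : Type*} [Fintype α] [Fintype β] (p : ℝ) (F : SimpleGraph α)
    (G : SimpleGraph β) : ℝ :=
  homCount F G / (p ^ edgeCount F * (Fintype.card β : ℝ) ^ Fintype.card α)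

/-- The normalized embedding count `s_p(F,G)`. -/
def sDen {α β : Type*} [Fintype α] [Fintype β] (p : ℝ) (F : SimpleGraph α)
    (G : SimpleGraph β) : ℝ :=
  embCount F G / (p ^ edgeCount F * ((Fintype.card β).descFactorial (Fintype.card α) : ℝ))

/-- The homomorphism density `s(F,κ)` of a finite graph in a kernel. -/
def homDensity {α : Type*} [Fintype α] (F : SimpleGraph α) (κ : ℝ → ℝ → ℝ) : ℝ :=
  ∫ x in Set.univ.pi (fun _ : α => Icc (0:ℝ) 1),
    ∏ e ∈ F.edgeFinset,
      Sym2.lift ⟨fun i j => (κ (x i) (x j) + κ (x j) (x i)) / 2,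
        fun i j => by dsimp only; rw [add_comm (κ (x i) (x j)) (κ (x j) (x i))]⟩ e

/-- The homomorphism density as a lower integral (for possibly unbounded kernels). -/
def homDensityL {α : Type*} [Fintype α] (F : SimpleGraph α) (κ : ℝ → ℝ → ℝ) : ℝ≥0∞ :=
  ∫⁻ x in Set.univ.pi (fun _ : α => Icc (0:ℝ) 1),
    ∏ e ∈ F.edgeFinset,
      Sym2.lift ⟨fun i j => ENNReal.ofReal ((κ (x i) (x j) + κ (x j) (x i)) / 2),
        fun i j => by dsimp only; rw [add_comm (κ (x i) (x j)) (κ (x j) (x i))]⟩ e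

/-- A kernel: a symmetric measurable function `[0,1]² → [0,∞)`. -/
def IsKernel (κ : ℝ → ℝ → ℝ) : Prop :=
  Measurable (Function.uncurry κ) ∧ (∀ x y, κ x y = κ y x) ∧ ∀ x y, 0 ≤ κ x y

/-- A kernel taking values in `[0,C]`. -/
def IsKernelBdd (κ : ℝ → ℝ → ℝ) (C : ℝ) : Prop :=
  Measurable (Function.uncurry κ) ∧ (∀ x y, κ x y = κ y x) ∧ ∀ x y, κ x y ∈ Icc 0 C

/-- A standard kernel: a symmetric measurable function `[0,1]² → [0,1]`. -/
def IsStdKernel (κ : ℝ → ℝ → ℝ) : Prop := IsKernelBdd κ 1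

/-- A doubly stochastic measure: a Borel measure on `[0,1]²` both of whose marginals
are Lebesgue measure on `[0,1]`. -/
def IsDoublyStochastic (μ : Measure (ℝ × ℝ)) : Prop :=
  μ.map Prod.fst = volume.restrict (Icc 0 1) ∧ μ.map Prod.snd = volume.restrict (Icc 0 1)

/-- The quantity `d_μ(κ₁,κ₂)`. -/
def dMu (μ : Measure (ℝ × ℝ)) (κ₁ κ₂ : ℝ → ℝ → ℝ) : ℝ :=
  sSup {r | ∃ S T : Set (ℝ × ℝ), MeasurableSet S ∧ MeasurableSet T ∧
    S ⊆ Icc 0 1 ×ˢ Icc 0 1 ∧ T ⊆ Icc 0 1 ×ˢ Icc 0 1 ∧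
    r = |∫ w in S ×ˢ T, (κ₁ w.1.1 w.2.1 - κ₂ w.1.2 w.2.2) ∂(μ.prod μ)|}

/-- Equivalence of kernels via a coupling. -/
def KernelEquiv (κ₁ κ₂ : ℝ → ℝ → ℝ) : Prop :=
  ∃ μ : Measure (ℝ × ℝ), IsDoublyStochastic μ ∧
    ∀ᵐ w ∂(μ.prod μ), κ₁ w.1.1 w.2.1 = κ₂ w.1.2 w.2.2

/-- `e_G(A,B)`: the number of ordered pairs `(i,j) ∈ A × B` with `ij ∈ E(G)`. -/
def ePairs {n : ℕ} (G : SimpleGraph (Fin n)) (A B : Finset (Fin n)) : ℕ :=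
  ((A ×ˢ B).filter fun q => G.Adj q.1 q.2).card

/-- The normalized density `d_p(A,B)`. -/
def dDens {n : ℕ} (p : ℝ) (G : SimpleGraph (Fin n)) (A B : Finset (Fin n)) : ℝ :=
  ePairs G A B / (p * A.card * B.card)

/-- A sequence of graphs has density bounded by `C`. -/
def DensityBoundedBy (p : ℕ → ℝ) (G : ∀ n, SimpleGraph (Fin n)) (C : ℝ) : Prop :=
  ∀ ε > (0:ℝ), ∀ δ > (0:ℝ), ∀ᶠ n in atTop, ∀ A B : Finset (Fin n),
    ε * n ≤ A.card → ε * n ≤ B.card → dDens (p n) (G n) A B ≤ C + δ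

/-- The parts of a partition of `Fin n` indexed by `Fin k`, given as a colouring. -/
def fiber {n k : ℕ} (c : Fin n → Fin k) (a : Fin k) : Finset (Fin n) :=
  Finset.univ.filter fun v => c v = a

/-- The finite-type kernel `G/Π` associated to a partition of the vertex set of `G`. -/
def partKernel {n k : ℕ} (p : ℝ) (G : SimpleGraph (Fin n)) (c : Fin n → Fin k) :
    ℝ → ℝ → ℝ := fun x y =>
  if h : x ∈ Ioc (0:ℝ) 1 ∧ y ∈ Ioc (0:ℝ) 1 ∧ idx n x < n ∧ idx n y < n then
    dDens p G (fiber c (c ⟨idx n x, h.2.2.1⟩)) (fiber c (c ⟨idx n y, h.2.2.2⟩))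
  else 0

/-- A partition is weakly `(ε,p)`-regular for `G`. -/
def WeaklyRegular {n k : ℕ} (p ε : ℝ) (G : SimpleGraph (Fin n)) (c : Fin n → Fin k) : Prop :=
  cutNorm (fun x y => graphKernel p G x y - partKernel p G c x y) ≤ ε

/-- `(A,B)` is an `(ε,p)`-regular pair for `G`. -/
def RegPair {n : ℕ} (p ε : ℝ) (G : SimpleGraph (Fin n)) (A B : Finset (Fin n)) : Prop :=
  ∀ A' ⊆ A, ∀ B' ⊆ B, ε * A.card ≤ A'.card → ε * B.card ≤ B'.card →
    |dDens p G A' B' - dDens p G A B| ≤ ε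

/-- An `(ε,p)`-regular partition of `G` into `k` parts. -/
def RegPartition {n k : ℕ} (p ε : ℝ) (G : SimpleGraph (Fin n)) (c : Fin n → Fin k) : Prop :=
  (∀ a : Fin k, (fiber c a).card = n / k ∨ (fiber c a).card = n / k + 1) ∧
  ((Finset.univ.filter (fun q : Fin k × Fin k =>
      q.1 < q.2 ∧ ¬ RegPair p ε G (fiber c q.1) (fiber c q.2))).card : ℝ)
    ≤ ε * ((k : ℝ) * ((k : ℝ) - 1) / 2)

/-- The number of walks `v₀v₁⋯v_ℓ` in `G` with `v_i ∈ X_i` for each `i`. -/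
def walkCount {n ℓ : ℕ} (G : SimpleGraph (Fin n)) (X : Fin (ℓ+1) → Finset (Fin n)) : ℕ :=
  Nat.card {v : Fin (ℓ+1) → Fin n //
    (∀ i, v i ∈ X i) ∧ ∀ i : Fin ℓ, G.Adj (v i.castSucc) (v i.succ)}

/-- `κ(X₀,X₁,…,X_ℓ)`: the kernel analogue of the walk count. -/
def kernelWalk {ℓ : ℕ} (κ : ℝ → ℝ → ℝ) (X : Fin (ℓ+1) → Set ℝ) : ℝ :=
  ∫ x in Set.univ.pi X, ∏ i : Fin ℓ, κ (x i.castSucc) (x i.succ)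

/-- `p_t(u,v)`: the number of paths of length `t` in `G` from `u` to `v`. -/
def pathCount {n : ℕ} (G : SimpleGraph (Fin n)) (t : ℕ) (u v : Fin n) : ℕ :=
  Nat.card {w : Fin (t+1) → Fin n // w 0 = u ∧ w (Fin.last t) = v ∧
    Function.Injective w ∧ ∀ i : Fin t, G.Adj (w i.castSucc) (w i.succ)}

/-- The `i`-th vertex on the `r`-th subdivided edge (from `u r` to `v r`, `ℓ` steps). -/
def pv (ℓ : ℕ) {k m : ℕ} (u v : Fin m → Fin k) (r : Fin m) (i : ℕ) :
    Fin k ⊕ (Fin m × Fin (ℓ - 1)) :=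
  if h0 : i = 0 then Sum.inl (u r)
  else if h : i < ℓ then Sum.inr (r, ⟨i - 1, by omega⟩)
  else Sum.inl (v r)

/-- The `(ℓ−1)`-fold subdivision of the loopless multigraph with `k` vertices and
edges `u r — v r` for `r < m`. -/
def multiSubdiv (ℓ : ℕ) {k m : ℕ} (u v : Fin m → Fin k) :
    SimpleGraph (Fin k ⊕ (Fin m × Fin (ℓ - 1))) :=
  SimpleGraph.fromRel fun a b =>
    ∃ r : Fin m, ∃ i : ℕ, i < ℓ ∧ a = pv ℓ u v r i ∧ b = pv ℓ u v r (i + 1)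

/-- Membership in the family `F_ℓ` of `(ℓ−1)`-fold subdivisions of finite loopless
multigraphs. -/
def InFamilyF (ℓ : ℕ) {N : ℕ} (F : SimpleGraph (Fin N)) : Prop :=
  ∃ (k m : ℕ) (u v : Fin m → Fin k), 1 ≤ k ∧ (∀ r, u r ≠ v r) ∧
    Nonempty (F ≃g multiSubdiv ℓ u v)

/-- The edges of a simple graph on `Fin k`, as ordered pairs `(i,j)` with `i < j`. -/
abbrev edgeIdx {k : ℕ} (F : SimpleGraph (Fin k)) : Type :=
  {q : Fin k × Fin k // q.1 < q.2 ∧ F.Adj q.1 q.2}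

/-- The `i`-th vertex on the subdivision of the edge `e` (`t` steps). -/
def spv (t : ℕ) {k : ℕ} {F : SimpleGraph (Fin k)} (e : edgeIdx F) (i : ℕ) :
    Fin k ⊕ (edgeIdx F × Fin (t - 1)) :=
  if h0 : i = 0 then Sum.inl e.1.1
  else if h : i < t then Sum.inr (e, ⟨i - 1, by omega⟩)
  else Sum.inl e.1.2

/-- The `t`-subdivision `Sub_t(F)` of a simple graph `F`: each edge is replaced by a
path of length `t` through `t−1` new internal vertices. -/
def subdiv (t : ℕ) {k : ℕ} (F : SimpleGraph (Fin k)) :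
    SimpleGraph (Fin k ⊕ (edgeIdx F × Fin (t - 1))) :=
  SimpleGraph.fromRel fun a b =>
    ∃ e : edgeIdx F, ∃ i : ℕ, i < t ∧ a = spv t e i ∧ b = spv t e (i + 1)

/-- The `t`-th power kernel `κ^t`. -/
def kpow (κ : ℝ → ℝ → ℝ) : ℕ → ℝ → ℝ → ℝ
  | 0 => fun _ _ => 0
  | 1 => κ
  | (n + 2) => fun x y => ∫ z in Icc (0:ℝ) 1, kpow κ (n + 1) x z * κ z y

/-- `φ : Fin ℓ → Fin n` is a homomorphism from `F` to `G`. -/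
def IsHom {α β : Type*} (F : SimpleGraph α) (G : SimpleGraph β) (φ : α → β) : Prop :=
  ∀ i j, F.Adj i j → G.Adj (φ i) (φ j)

/-- `F` is flat over its induced subgraph `F'` on the first `ℓ` vertices, for the
sequence `(G_n)` with normalizing function `p`. -/
def FlatOver (p : ℕ → ℝ) (G : ∀ n, SimpleGraph (Fin n)) {k ℓ : ℕ} (h : ℓ ≤ k)
    (F : SimpleGraph (Fin k)) : Prop :=
  ∀ ε > (0:ℝ), ∀ᶠ n in atTop,
    ((Finset.univ.filter (fun φ : Fin ℓ → Fin n =>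
        IsHom (F.comap (Fin.castLE h)) (G n) φ ∧
        ε * ((n:ℝ) ^ (k - ℓ) * p n ^ (edgeCount F - edgeCount (F.comap (Fin.castLE h)))) <
          |((Finset.univ.filter (fun ψ : Fin k → Fin n =>
              IsHom F (G n) ψ ∧ ψ ∘ Fin.castLE h = φ)).card : ℝ) -
            (n:ℝ) ^ (k - ℓ) * p n ^ (edgeCount F - edgeCount (F.comap (Fin.castLE h)))|)).card
      : ℝ)
      ≤ ε * ((Finset.univ.filter (fun φ : Fin ℓ → Fin n =>
          IsHom (F.comap (Fin.castLE h)) (G n) φ)).card : ℝ)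

/-- The set of density matrices of balanced partitions of `V(G)` into `k` nonempty
parts. -/
def MsetG (k : ℕ) {n : ℕ} (p : ℝ) (G : SimpleGraph (Fin n)) : Set (Fin k → Fin k → ℝ) :=
  {M | ∃ c : Fin n → Fin k, Function.Surjective c ∧
    (∀ a b, (fiber c a).card ≤ (fiber c b).card + 1) ∧
    M = fun a b => dDens p G (fiber c a) (fiber c b)}

/-- The closed set of density matrices of partitions of `[0,1]` into `k` parts of
measure `1/k`, for a kernel `κ`. -/
def MsetK (k : ℕ) (κ : ℝ → ℝ → ℝ) : Set (Fin k → Fin k → ℝ) :=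
  closure {M | ∃ Q : Fin k → Set ℝ, (∀ a, MeasurableSet (Q a)) ∧
    (Pairwise fun a b => Disjoint (Q a) (Q b)) ∧ (⋃ a, Q a) = Icc 0 1 ∧
    (∀ a, volume (Q a) = 1 / (k : ℝ≥0∞)) ∧
    M = fun a b => (k : ℝ)^2 * ∫ q in (Q a) ×ˢ (Q b), κ q.1 q.2}

end

/-- A bilinear form whose values at all pairs of indicator vectors are at most `ε` in absolute
value is bounded by `ε` on the whole unit cube. -/
theorem abs_bilin_le_of_finset {ι : Type*} [Fintype ι] (B : ι → ι → ℝ) (ε : ℝ)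
    (h : ∀ S T : Finset ι, |∑ u ∈ S, ∑ v ∈ T, B u v| ≤ ε) (s t : ι → ℝ)
    (hs : ∀ u, s u ∈ Icc (0:ℝ) 1) (ht : ∀ u, t u ∈ Icc (0:ℝ) 1) :
    |∑ u, ∑ v, B u v * (s u * t v)| ≤ ε := by
  have lin : ∀ (r w : ι → ℝ), (∀ u, w u ∈ Icc (0:ℝ) 1) → (∀ S : Finset ι, |∑ u ∈ S, r u| ≤ ε) →
      |∑ u, r u * w u| ≤ ε := by
    intro r w hw hr
    rw [abs_le]
    constructor
    · have h1 := (abs_le.1 (hr (Finset.univ.filter fun u => r u < 0))).1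
      refine h1.trans ?_
      rw [Finset.sum_filter]
      refine Finset.sum_le_sum fun u _ => ?_
      have := hw u
      split_ifs with hu
      · nlinarith [this.1, this.2]
      · exact mul_nonneg (not_lt.1 hu) this.1
    · have h1 := (abs_le.1 (hr (Finset.univ.filter fun u => 0 < r u))).2
      refine le_trans ?_ h1
      rw [Finset.sum_filter]
      refine Finset.sum_le_sum fun u _ => ?_
      have := hw u
      split_ifs with hu
      · nlinarith [this.1, this.2]
      · nlinarith [this.1, this.2, not_lt.1 hu]
  have h1 : ∀ S : Finset ι, |∑ v, (∑ u ∈ S, B u v) * t v| ≤ ε := fun S =>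
    lin _ t ht fun T => by rw [Finset.sum_comm]; exact h S T
  have h2 := lin (fun u => ∑ v, B u v * t v) s hs fun S => by
    have := h1 S
    simp only [Finset.sum_mul] at this
    rwa [Finset.sum_comm] at this
  convert h2 using 2
  refine Finset.sum_congr rfl fun u _ => ?_
  rw [Finset.sum_mul]
  exact Finset.sum_congr rfl fun v _ => by ring

/-- `D` is the matrix of averages of `A` over the classes of the colouring `c`. -/
def IsBlockAverage {V K : Type*} [Fintype V] (A : V → V → ℝ) (c : V → K) (D : K → K → ℝ) : Prop :=
  ∀ a b, ∑ u with c u = a, ∑ v with c v = b, A u v =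
    D a b * ((Finset.univ.filter fun u => c u = a).card * (Finset.univ.filter fun v => c v = b).card)

theorem sum_sum_fiberwise {V K : Type*} [Fintype V] [Fintype K] (c : V → K) (F : V → V → ℝ) :
    ∑ u, ∑ v, F u v = ∑ a, ∑ b, ∑ u with c u = a, ∑ v with c v = b, F u v := by
  rw [← Finset.sum_fiberwise Finset.univ c fun u => ∑ v, F u v]
  refine Finset.sum_congr rfl fun a _ => ?_
  conv_rhs => rw [Finset.sum_comm]
  refine Finset.sum_congr rfl fun u _ => ?_
  rw [← Finset.sum_fiberwise Finset.univ c fun v => F u v]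

theorem IsBlockAverage.sum_mul {V K : Type*} [Fintype V] [Fintype K] {A : V → V → ℝ} {c : V → K}
    {D : K → K → ℝ} (h : IsBlockAverage A c D) (f : K → K → ℝ) :
    ∑ u, ∑ v, A u v * f (c u) (c v) = ∑ u, ∑ v, D (c u) (c v) * f (c u) (c v) := by
  rw [sum_sum_fiberwise c, sum_sum_fiberwise c]
  refine Finset.sum_congr rfl fun a _ => Finset.sum_congr rfl fun b _ => ?_
  have e1 : ∑ u with c u = a, ∑ v with c v = b, A u v * f (c u) (c v) =
      (∑ u with c u = a, ∑ v with c v = b, A u v) * f a b := by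
    rw [Finset.sum_mul]
    refine Finset.sum_congr rfl fun u hu => ?_
    rw [Finset.sum_mul]
    refine Finset.sum_congr rfl fun v hv => ?_
    rw [(Finset.mem_filter.1 hu).2, (Finset.mem_filter.1 hv).2]
  have e2 : ∑ u with c u = a, ∑ v with c v = b, D (c u) (c v) * f (c u) (c v) =
      ∑ u with c u = a, ∑ v with c v = b, D a b * f a b := by
    refine Finset.sum_congr rfl fun u hu => Finset.sum_congr rfl fun v hv => ?_
    rw [(Finset.mem_filter.1 hu).2, (Finset.mem_filter.1 hv).2]
  rw [e1, e2, h a b]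
  simp only [Finset.sum_const, nsmul_eq_mul]
  ring

/-- Testing `A` against a function of `r` is nearly the same as testing its block averages, if the
blocks refine `r` outside a few bad blocks. -/
theorem IsBlockAverage.abs_sum_sub_le {V K R : Type*} [Fintype V] [Fintype K]
    {A : V → V → ℝ} (hA : ∀ u v, 0 ≤ A u v) {c : V → K} {Y : K → K → ℝ}
    (hY : IsBlockAverage A c Y) {B : ℝ} (hY0 : ∀ a b, 0 ≤ Y a b) (hYB : ∀ a b, Y a b ≤ B)
    (r : V → R) (s : K → R) (bad : Finset K) (hs : ∀ v, c v ∉ bad → s (c v) = r v)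
    (h : R → R → ℝ) {F : ℝ} (h0 : ∀ a b, 0 ≤ h a b) (hF : ∀ a b, h a b ≤ F) :
    |∑ u, ∑ v, (A u v - Y (c u) (c v)) * h (r u) (r v)| ≤
      4 * F * B * ((Finset.univ.filter fun v => c v ∈ bad).card * Fintype.card V) := by
  rcases isEmpty_or_nonempty V with hV | ⟨⟨v₀⟩⟩
  · simp
  have hF0 : 0 ≤ F := (h0 _ _).trans (hF (r v₀) (r v₀))
  set z : K → ℝ := fun a => if a ∈ bad then 1 else 0 with hz
  have hz0 : ∀ a, 0 ≤ z a := fun a => by simp only [hz]; split_ifs <;> norm_num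
  have e0 := hY.sum_mul fun a b => h (s a) (s b)
  have ez := hY.sum_mul fun a b => z a + z b
  have e1 : ∑ u, ∑ v, (A u v - Y (c u) (c v)) * h (r u) (r v) =
      ∑ u, ∑ v, (A u v - Y (c u) (c v)) * (h (r u) (r v) - h (s (c u)) (s (c v))) := by
    simp only [mul_sub, sub_mul, Finset.sum_sub_distrib, e0]
    ring
  have key : ∀ u v, |(A u v - Y (c u) (c v)) * (h (r u) (r v) - h (s (c u)) (s (c v)))| ≤
      F * (A u v * (z (c u) + z (c v)) + Y (c u) (c v) * (z (c u) + z (c v))) := by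
    intro u v
    have hd : |h (r u) (r v) - h (s (c u)) (s (c v))| ≤ F * (z (c u) + z (c v)) := by
      have hle : |h (r u) (r v) - h (s (c u)) (s (c v))| ≤ F := by
        rw [abs_le]
        constructor <;> linarith [h0 (r u) (r v), hF (r u) (r v), h0 (s (c u)) (s (c v)),
          hF (s (c u)) (s (c v))]
      by_cases hu : c u ∈ bad
      · refine hle.trans ?_
        have : z (c u) = 1 := by simp [hz, hu]
        nlinarith [hz0 (c v)]
      · by_cases hv : c v ∈ bad
        · refine hle.trans ?_
          have : z (c v) = 1 := by simp [hz, hv]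
          nlinarith [hz0 (c u)]
        · rw [hs u hu, hs v hv, sub_self, abs_zero]
          exact mul_nonneg hF0 (add_nonneg (hz0 _) (hz0 _))
    rw [abs_mul]
    have ha : |A u v - Y (c u) (c v)| ≤ A u v + Y (c u) (c v) := by
      rw [abs_le]
      constructor <;> linarith [hA u v, hY0 (c u) (c v)]
    calc _ ≤ (A u v + Y (c u) (c v)) * (F * (z (c u) + z (c v))) :=
          mul_le_mul ha hd (abs_nonneg _) (add_nonneg (hA _ _) (hY0 _ _))
      _ = _ := by ring
  have hzs : ∑ u, z (c u) = (Finset.univ.filter fun v => c v ∈ bad).card := by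
    simp [hz]
  calc _ = _ := congrArg _ e1
    _ ≤ ∑ u, ∑ v, F * (A u v * (z (c u) + z (c v)) + Y (c u) (c v) * (z (c u) + z (c v))) := by
        refine (Finset.abs_sum_le_sum_abs _ _).trans (Finset.sum_le_sum fun u _ => ?_)
        exact (Finset.abs_sum_le_sum_abs _ _).trans (Finset.sum_le_sum fun v _ => key u v)
    _ = 2 * F * ∑ u, ∑ v, Y (c u) (c v) * (z (c u) + z (c v)) := by
        simp only [← Finset.mul_sum, Finset.sum_add_distrib]
        rw [ez]
        ring
    _ ≤ 2 * F * ∑ u, ∑ v, B * (z (c u) + z (c v)) := by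
        refine mul_le_mul_of_nonneg_left ?_ (by positivity)
        exact Finset.sum_le_sum fun u _ => Finset.sum_le_sum fun v _ =>
          mul_le_mul_of_nonneg_right (hYB _ _) (add_nonneg (hz0 _) (hz0 _))
    _ = _ := by
        simp only [← Finset.mul_sum, Finset.sum_add_distrib, hzs, Finset.sum_const,
          nsmul_eq_mul, Finset.card_univ]
        ring

/-- **Energy increment.** If `A` deviates from its block averages `X` on `S × T`, then the block
averages `Y` over a partition nearly refining the given one, `S` and `T` have larger energy. -/
theorem energy_increment {V K K' R : Type*} [Fintype V] [Fintype K] [Fintype K'] [Nonempty V]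
    {A : V → V → ℝ} (hA : ∀ u v, 0 ≤ A u v) {c : V → K} {X : K → K → ℝ}
    (hX : IsBlockAverage A c X) {B : ℝ} (hX0 : ∀ a b, 0 ≤ X a b) (hXB : ∀ a b, X a b ≤ B)
    {c' : V → K'} {Y : K' → K' → ℝ} (hY : IsBlockAverage A c' Y)
    (hY0 : ∀ a b, 0 ≤ Y a b) (hYB : ∀ a b, Y a b ≤ B)
    (r : V → R) (π : R → K) (hπ : ∀ v, π (r v) = c v) (s : K' → R) (bad : Finset K')
    (hs : ∀ v, c' v ∉ bad → s (c' v) = r v) (S T : R → Prop) {ζ : ℝ}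
    (hζ : ((Finset.univ.filter fun v => c' v ∈ bad).card : ℝ) ≤ ζ * Fintype.card V)
    {D : ℝ} (hD : D = |∑ u with S (r u), ∑ v with T (r v), (A u v - X (c u) (c v))| /
      (Fintype.card V : ℝ) ^ 2) (hD' : 4 * B * ζ ≤ D) :
    (D - 4 * B * ζ) ^ 2 ≤ (∑ u, ∑ v, Y (c' u) (c' v) ^ 2) / (Fintype.card V : ℝ) ^ 2 -
      (∑ u, ∑ v, X (c u) (c v) ^ 2) / (Fintype.card V : ℝ) ^ 2 + 8 * B ^ 2 * ζ := by
  set N : ℝ := (Fintype.card V : ℝ) with hN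
  have hN0 : 0 < N := by simp [hN, Fintype.card_pos]
  obtain ⟨v₀⟩ := ‹Nonempty V›
  have hB0 : 0 ≤ B := (hX0 _ _).trans (hXB (c v₀) (c v₀))
  set i : R → R → ℝ := fun a b => (if S a then 1 else 0) * (if T b then 1 else 0) with hi
  have hi0 : ∀ a b, 0 ≤ i a b := fun a b => by simp only [hi]; split_ifs <;> norm_num
  have hi1 : ∀ a b, i a b ≤ 1 := fun a b => by simp only [hi]; split_ifs <;> norm_num
  have t1 := hY.abs_sum_sub_le hA hY0 hYB r s bad hs (fun a b => X (π a) (π b))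
    (fun a b => hX0 _ _) (fun a b => hXB _ _)
  have t2 := hY.abs_sum_sub_le hA hY0 hYB r s bad hs i hi0 hi1
  simp only [hπ, ← hN] at t1 t2
  have eX := hX.sum_mul X
  have hzN : ((Finset.univ.filter fun v => c' v ∈ bad).card : ℝ) * N ≤ ζ * N ^ 2 := by nlinarith
  have hST : ∑ u with S (r u), ∑ v with T (r v), (A u v - X (c u) (c v)) =
      ∑ u, ∑ v, (A u v - X (c u) (c v)) * i (r u) (r v) := by
    simp only [Finset.sum_filter, hi]
    refine Finset.sum_congr rfl fun u _ => ?_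
    split_ifs <;> simp
  have cs : (∑ u, ∑ v, (Y (c' u) (c' v) - X (c u) (c v)) * i (r u) (r v)) ^ 2 ≤
      (∑ u, ∑ v, (Y (c' u) (c' v) - X (c u) (c v)) ^ 2) * N ^ 2 := by
    simp only [← Fintype.sum_prod_type'
      (f := fun u v => (Y (c' u) (c' v) - X (c u) (c v)) * i (r u) (r v)),
      ← Fintype.sum_prod_type' (f := fun u v => (Y (c' u) (c' v) - X (c u) (c v)) ^ 2)]
    refine (Finset.sum_mul_sq_le_sq_mul_sq _ _ _).trans ?_
    refine mul_le_mul_of_nonneg_left ?_ (Finset.sum_nonneg fun _ _ => sq_nonneg _)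
    calc _ ≤ ∑ _q : V × V, (1:ℝ) := Finset.sum_le_sum fun q _ => by
            nlinarith [hi0 (r q.1) (r q.2), hi1 (r q.1) (r q.2)]
      _ = N ^ 2 := by simp [hN, sq]
  have exp2 : ∑ u, ∑ v, (Y (c' u) (c' v) - X (c u) (c v)) ^ 2 =
      ∑ u, ∑ v, Y (c' u) (c' v) ^ 2 - ∑ u, ∑ v, X (c u) (c v) ^ 2 +
      2 * ∑ u, ∑ v, (A u v - Y (c' u) (c' v)) * X (c u) (c v) := by
    have : ∑ u, ∑ v, (A u v - Y (c' u) (c' v)) * X (c u) (c v) =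
        ∑ u, ∑ v, (X (c u) (c v) * X (c u) (c v) - Y (c' u) (c' v) * X (c u) (c v)) := by
      simp only [sub_mul, Finset.sum_sub_distrib, eX]
    rw [this]
    simp only [Finset.mul_sum, ← Finset.sum_add_distrib, ← Finset.sum_sub_distrib]
    exact Finset.sum_congr rfl fun u _ => Finset.sum_congr rfl fun v _ => by ring
  have split2 : ∑ u, ∑ v, (A u v - X (c u) (c v)) * i (r u) (r v) =
      ∑ u, ∑ v, (A u v - Y (c' u) (c' v)) * i (r u) (r v) +
      ∑ u, ∑ v, (Y (c' u) (c' v) - X (c u) (c v)) * i (r u) (r v) := by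
    simp only [← Finset.sum_add_distrib]
    exact Finset.sum_congr rfl fun u _ => Finset.sum_congr rfl fun v _ => by ring
  set P := ∑ u, ∑ v, (Y (c' u) (c' v) - X (c u) (c v)) * i (r u) (r v) with hP
  set Q := ∑ u, ∑ v, (A u v - Y (c' u) (c' v)) * i (r u) (r v) with hQ
  set EY := ∑ u, ∑ v, Y (c' u) (c' v) ^ 2
  set EX := ∑ u, ∑ v, X (c u) (c v) ^ 2
  set J := ∑ u, ∑ v, (A u v - Y (c' u) (c' v)) * X (c u) (c v)
  have b1 : J ≤ 4 * B * B * (ζ * N ^ 2) := (le_abs_self _).trans (t1.trans (by gcongr))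
  have b2 : |Q| ≤ 4 * 1 * B * (ζ * N ^ 2) := t2.trans (by gcongr)
  have b3 : (D - 4 * B * ζ) * N ^ 2 ≤ |P| := by
    have : D * N ^ 2 = |Q + P| := by
      rw [hD, hST, split2]; field_simp
    have h3 := abs_add_le Q P
    nlinarith
  have b4 : ((D - 4 * B * ζ) * N ^ 2) ^ 2 ≤ (EY - EX + 2 * J) * N ^ 2 := by
    calc _ ≤ |P| ^ 2 := pow_le_pow_left₀ (mul_nonneg (by linarith) (by positivity)) b3 2
      _ = P ^ 2 := sq_abs _
      _ ≤ _ := by rw [← exp2]; exact cs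
  have hN2 : 0 < N ^ 2 := by positivity
  have b5 : (D - 4 * B * ζ) ^ 2 * N ^ 2 ≤ EY - EX + 2 * J := by
    refine le_of_mul_le_mul_right ?_ hN2
    calc _ = ((D - 4 * B * ζ) * N ^ 2) ^ 2 := by ring
      _ ≤ _ := b4
  rw [← sub_div, ← sub_le_iff_le_add, le_div_iff₀ hN2]
  nlinarith

/-- The colouring of `Fin n` whose `k` classes are consecutive intervals of nearly equal size. -/
def intervalColouring (n k : ℕ) [NeZero k] (j : Fin n) : Fin k := Fin.ofNat k (j * k / n)

theorem intervalColouring_val {n k : ℕ} [NeZero k] (j : Fin n) :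
    (intervalColouring n k j : ℕ) = j * k / n := by
  have hk : 0 < k := Nat.pos_of_ne_zero (NeZero.ne k)
  have : (j : ℕ) * k / n < k := by
    rw [Nat.div_lt_iff_lt_mul (by have := j.2; omega), mul_comm k n]
    exact Nat.mul_lt_mul_of_pos_right j.2 hk
  simp [intervalColouring, Nat.mod_eq_of_lt this]

theorem intervalColouring_mono (n k : ℕ) [NeZero k] : Monotone (intervalColouring n k) := by
  intro i j hij
  rw [Fin.le_def, intervalColouring_val, intervalColouring_val]
  exact Nat.div_le_div_right (Nat.mul_le_mul_right _ hij)

theorem card_fiber_intervalColouring (n k : ℕ) [NeZero k] (a : Fin k) :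
    k * (fiber (intervalColouring n k) a).card < n + k ∧
      n < k * (fiber (intervalColouring n k) a).card + k := by
  have hk : 0 < k := Nat.pos_of_ne_zero (NeZero.ne k)
  rcases Nat.eq_zero_or_pos n with rfl | hn
  · simp [fiber, hk]
  set l := (a * n + (k - 1)) / k with hl
  set h := ((a + 1) * n + (k - 1)) / k with hh
  have hl1 : k * l ≤ a * n + (k - 1) := Nat.mul_div_le _ _
  have hl2 : a * n + (k - 1) < k * l + k := by
    have := Nat.div_add_mod (a * n + (k - 1)) k
    have := Nat.mod_lt (a * n + (k - 1)) hk
    rw [← hl] at *; omega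
  have hh1 : k * h ≤ (a + 1) * n + (k - 1) := Nat.mul_div_le _ _
  have hh2 : (a + 1) * n + (k - 1) < k * h + k := by
    have := Nat.div_add_mod ((a + 1) * n + (k - 1)) k
    have := Nat.mod_lt ((a + 1) * n + (k - 1)) hk
    rw [← hh] at *; omega
  have hle : l ≤ h := Nat.div_le_div_right (by
    have : (a:ℕ) * n ≤ (a + 1) * n := Nat.mul_le_mul_right _ (Nat.le_succ _)
    omega)
  have hn' : h ≤ n := by
    have : ((a:ℕ) + 1) * n ≤ k * n := Nat.mul_le_mul_right _ a.2
    by_contra hc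
    have : k * (n + 1) ≤ k * h := Nat.mul_le_mul_left _ (by omega)
    rw [mul_add] at this
    omega
  have hcard : (fiber (intervalColouring n k) a).card = h - l := by
    rw [← Nat.card_Ico]
    refine Finset.card_bij (fun j _ => (j : ℕ)) ?_ (fun _ _ _ _ h => Fin.ext h) ?_
    · intro j hj
      have hj := congrArg Fin.val (Finset.mem_filter.1 hj).2
      rw [intervalColouring_val, Nat.div_eq_iff (by omega)] at hj
      rw [Finset.mem_Ico]
      constructor
      · by_contra hc
        have : k * (j + 1) ≤ k * l := Nat.mul_le_mul_left _ (by omega)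
        rw [mul_add, mul_comm k] at this
        omega
      · by_contra hc
        have : k * h ≤ k * j := Nat.mul_le_mul_left _ (by omega)
        rw [mul_comm k j] at this
        rw [add_mul] at hh2
        omega
    · intro j hj
      rw [Finset.mem_Ico] at hj
      refine ⟨⟨j, by omega⟩, Finset.mem_filter.2 ⟨Finset.mem_univ _, Fin.ext ?_⟩, rfl⟩
      rw [intervalColouring_val, Nat.div_eq_iff (by omega)]
      have h1 : k * l ≤ k * j := Nat.mul_le_mul_left _ hj.1
      have h2 : k * (j + 1) ≤ k * h := Nat.mul_le_mul_left _ hj.2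
      rw [mul_comm k j] at h1
      rw [mul_add, mul_comm k j] at h2
      rw [add_mul] at hh1
      dsimp only
      omega
  rw [hcard, Nat.mul_sub]
  have : k * l ≤ k * h := Nat.mul_le_mul_left _ hle
  rw [add_mul] at hh1 hh2
  omega

/-- The classes of the colouring `c` are nonempty and have nearly equal sizes. -/
def IsBalanced {n k : ℕ} (c : Fin n → Fin k) : Prop :=
  Function.Surjective c ∧ ∀ a b, (fiber c a).card ≤ (fiber c b).card + 1

theorem card_fiber_comp_perm {n k : ℕ} (c : Fin n → Fin k) (σ : Equiv.Perm (Fin n)) (a : Fin k) :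
    (fiber (c ∘ σ) a).card = (fiber c a).card :=
  Finset.card_bij (fun v _ => σ v) (by simp [fiber]) (by simp) fun w hw =>
    ⟨σ.symm w, by simpa [fiber] using hw, by simp⟩

theorem isBalanced_intervalColouring_comp {n k : ℕ} [NeZero k] (hkn : k ≤ n)
    (σ : Equiv.Perm (Fin n)) : IsBalanced (intervalColouring n k ∘ σ) := by
  have hk : 0 < k := Nat.pos_of_ne_zero (NeZero.ne k)
  constructor
  · refine Function.Surjective.comp (fun a => ?_) σ.surjective
    have := (card_fiber_intervalColouring n k a).2
    have hpos : 0 < (fiber (intervalColouring n k) a).card := by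
      by_contra hc
      rw [Nat.eq_zero_of_not_pos hc] at this
      omega
    obtain ⟨v, hv⟩ := Finset.card_pos.1 hpos
    exact ⟨v, (Finset.mem_filter.1 hv).2⟩
  · intro a b
    rw [card_fiber_comp_perm, card_fiber_comp_perm]
    have h1 := (card_fiber_intervalColouring n k a).1
    have h2 := (card_fiber_intervalColouring n k b).2
    by_contra hc
    have : k * ((fiber (intervalColouring n k) b).card + 2) ≤
      k * (fiber (intervalColouring n k) a).card := Nat.mul_le_mul_left _ (by omega)
    rw [mul_add] at this
    omega

theorem sum_card_fiber {n k : ℕ} (c : Fin n → Fin k) : ∑ a, (fiber c a).card = n := by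
  have := Finset.card_eq_sum_card_fiberwise (f := c) (s := Finset.univ) (t := Finset.univ)
    (fun _ _ => Finset.mem_coe.2 (Finset.mem_univ _))
  rw [Finset.card_univ, Fintype.card_fin] at this
  exact this.symm

theorem IsBalanced.card_fiber {n k : ℕ} {c : Fin n → Fin k} (hc : IsBalanced c) (a : Fin k) :
    k * (fiber c a).card ≤ n + k ∧ n ≤ k * (fiber c a).card + k := by
  have hs := sum_card_fiber c
  have h1 : ∑ _b : Fin k, (fiber c a).card ≤ ∑ b, ((fiber c b).card + 1) :=
    Finset.sum_le_sum fun b _ => hc.2 a b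
  have h2 : ∑ b, (fiber c b).card ≤ ∑ _b : Fin k, ((fiber c a).card + 1) :=
    Finset.sum_le_sum fun b _ => hc.2 b a
  simp only [Finset.sum_add_distrib, Finset.sum_const, Finset.card_univ, Fintype.card_fin,
    smul_eq_mul, mul_one, hs] at h1 h2
  exact ⟨h1, h2⟩

theorem IsBalanced.abs_card_div_sub_le {n k : ℕ} [NeZero n] [NeZero k] {c : Fin n → Fin k}
    (hc : IsBalanced c) (a : Fin k) : |((fiber c a).card : ℝ) / n - 1 / k| ≤ 1 / n := by
  have hk : (0:ℝ) < k := by exact_mod_cast Nat.pos_of_ne_zero (NeZero.ne k)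
  have hn : (0:ℝ) < n := by exact_mod_cast Nat.pos_of_ne_zero (NeZero.ne n)
  have h1 : (k : ℝ) * (fiber c a).card ≤ n + k := by exact_mod_cast (hc.card_fiber a).1
  have h2 : (n : ℝ) ≤ k * (fiber c a).card + k := by exact_mod_cast (hc.card_fiber a).2
  rw [div_sub_div _ _ hn.ne' hk.ne', abs_div, abs_of_pos (mul_pos hn hk),
    div_le_div_iff₀ (mul_pos hn hk) hn, one_mul, mul_comm (n : ℝ) k]
  exact mul_le_mul_of_nonneg_right (abs_le.2 ⟨by linarith, by linarith⟩) hn.le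

/-- Two colourings with similar class sizes agree, up to a permutation, outside a small set. -/
theorem exists_perm_card_mismatch_le {n k : ℕ} (c c₀ : Fin n → Fin k) :
    ∃ σ : Equiv.Perm (Fin n), (Finset.univ.filter fun v => c₀ (σ v) ≠ c v).card ≤
      ∑ a, ((fiber c a).card - (fiber c₀ a).card) := by
  have hS : ∀ a, ∃ S ⊆ fiber c a, S.card = min (fiber c a).card (fiber c₀ a).card := fun a =>
    Finset.exists_subset_card_eq (min_le_left _ _)
  have hT : ∀ a, ∃ T ⊆ fiber c₀ a, T.card = min (fiber c a).card (fiber c₀ a).card := fun a =>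
    Finset.exists_subset_card_eq (min_le_right _ _)
  choose S hSs hSc using hS
  choose T hTs hTc using hT
  let e : ∀ a, S a ≃ T a := fun a => Finset.equivOfCardEq ((hSc a).trans (hTc a).symm)
  let g : Fin k → Fin n → Fin n := fun a v => if h : v ∈ S a then e a ⟨v, h⟩ else v
  have hgT : ∀ a v, v ∈ S a → g a v ∈ T a := fun a v h => by
    simp only [g, dif_pos h]; exact (e a ⟨v, h⟩).2
  have hgi : ∀ a v w, v ∈ S a → w ∈ S a → g a v = g a w → v = w := fun a v w hv hw h => by
    simp only [g, dif_pos hv, dif_pos hw] at h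
    exact congrArg Subtype.val ((e a).injective (Subtype.ext h))
  have hc0 : ∀ v, v ∈ S (c v) → c₀ (g (c v) v) = c v := fun v hv =>
    (Finset.mem_filter.1 (hTs _ (hgT _ _ hv))).2
  let P := Finset.univ.filter fun v => v ∈ S (c v)
  obtain ⟨σ, hσ⟩ := Finset.exists_equiv_extend_of_card_eq (t := (Finset.univ : Finset (Fin n)))
    (by simp) (s := P) (f := fun v => g (c v) v) (Finset.subset_univ _) (by
      intro v hv w hw h
      have hv : v ∈ S (c v) := by simpa [P] using hv
      have hw : w ∈ S (c w) := by simpa [P] using hw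
      have hcc : c v = c w := by
        rw [← hc0 v hv, ← hc0 w hw]; exact congrArg c₀ h
      refine hgi (c w) v w (hcc ▸ hv) hw ?_
      simpa only [hcc] using h)
  refine ⟨σ.trans (Equiv.subtypeUnivEquiv fun x => Finset.mem_univ x), ?_⟩
  have hsub : (Finset.univ.filter fun v =>
      c₀ ((σ.trans (Equiv.subtypeUnivEquiv fun x => Finset.mem_univ x)) v) ≠ c v) ⊆
      Finset.univ.biUnion fun a => fiber c a \ S a := by
    intro v hv
    have hv := (Finset.mem_filter.1 hv).2
    refine Finset.mem_biUnion.2 ⟨c v, Finset.mem_univ _, Finset.mem_sdiff.2 ⟨by simp [fiber], ?_⟩⟩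
    intro hvS
    refine hv ?_
    have := hσ v (by simpa [P] using hvS)
    simp only [Equiv.trans_apply, Equiv.subtypeUnivEquiv_apply]
    rw [this, hc0 v hvS]
  refine (Finset.card_le_card hsub).trans (Finset.card_biUnion_le.trans
    (Finset.sum_le_sum fun a _ => ?_))
  rw [Finset.card_sdiff_of_subset (hSs a), hSc a]
  omega

/-- Sorting the vertices by the value of `r` and cutting into `K` nearly equal intervals gives a
partition such that `r` is constant on all but few classes. -/
theorem exists_interval_refinement {n L : ℕ} [NeZero n] (r : Fin n → Fin L) (K : ℕ) [NeZero K] :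
    ∃ (σ : Equiv.Perm (Fin n)) (s : Fin K → Fin L) (bad : Finset (Fin K)), bad.card ≤ L ∧
      ∀ v, (intervalColouring n K ∘ σ) v ∉ bad → s ((intervalColouring n K ∘ σ) v) = r v := by
  set f := r ∘ Tuple.sort r with hf
  have hfm : Monotone f := Tuple.monotone_sort r
  set col := intervalColouring n K with hcol
  have hcm : Monotone col := intervalColouring_mono n K
  let bad := Finset.univ.filter fun a => ∃ i j, col i = a ∧ col j = a ∧ f i < f j
  have hL : Nonempty (Fin L) := ⟨r 0⟩
  refine ⟨(Tuple.sort r)⁻¹, fun a => if h : ∃ i, col i = a then f h.choose else r 0, bad, ?_, ?_⟩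
  · have hb : ∀ a : bad, ∃ i j, col i = a ∧ col j = a ∧ f i < f j := fun a =>
      (Finset.mem_filter.1 a.2).2
    choose i j hi hj hij using hb
    have hinj : Function.Injective fun a : bad => f (i a) := by
      have : StrictMono fun a : bad => f (i a) := by
        intro a b hab
        refine (hij a).trans_le (hfm ?_)
        by_contra hc
        have := hcm (not_le.1 hc).le
        rw [hi, hj] at this
        exact absurd hab (not_lt.2 this)
      exact this.injective
    simpa using Fintype.card_le_of_injective _ hinj
  · intro v hv
    set w := (Tuple.sort r)⁻¹ v with hw
    have hex : ∃ i, col i = (col ∘ ⇑(Tuple.sort r)⁻¹) v := ⟨w, rfl⟩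
    dsimp only
    rw [dif_pos hex]
    have hfw : f w = r v := by simp [hf, hw]
    rw [← hfw]
    have hch := hex.choose_spec
    by_contra hne
    refine hv (Finset.mem_filter.2 ⟨Finset.mem_univ _, ?_⟩)
    rcases lt_or_gt_of_ne hne with h | h
    · exact ⟨_, _, hch, rfl, h⟩
    · exact ⟨_, _, rfl, hch, h⟩

/-- Derandomized rounding in an inner product space. -/
theorem exists_choice_norm_sum_sq_le {E V K : Type*} [NormedAddCommGroup E]
    [InnerProductSpace ℝ E] [Fintype K] (w : V → K → E) (x : V → K → ℝ)
    (hx0 : ∀ v a, 0 ≤ x v a) (hx1 : ∀ v, ∑ a, x v a = 1) (hw : ∀ v, ∑ a, x v a • w v a = 0)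
    (R : V → ℝ) (hR : ∀ v a, ‖w v a‖ ^ 2 ≤ R v) (S : Finset V) :
    ∃ c : V → K, ‖∑ v ∈ S, w v (c v)‖ ^ 2 ≤ ∑ v ∈ S, R v := by
  induction S using Finset.induction_on with
  | empty =>
    have : ∀ v, Nonempty K := fun v => by
      by_contra h
      rw [not_nonempty_iff] at h
      simpa using hx1 v
    exact ⟨fun v => (this v).some, by simp⟩
  | insert v S hv ih =>
    obtain ⟨c, hc⟩ := ih
    set z := ∑ v ∈ S, w v (c v) with hz
    obtain ⟨a, ha⟩ : ∃ a, inner ℝ z (w v a) ≤ 0 := by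
      by_contra! hcon
      have h0 : ∑ a, x v a * inner ℝ z (w v a) = 0 := by
        have := congrArg (inner ℝ z) (hw v)
        simpa [inner_sum, inner_smul_right] using this
      have h1 := (Finset.sum_eq_zero_iff_of_nonneg
        (fun a _ => mul_nonneg (hx0 v a) (hcon a).le)).1 h0
      have h2 : ∀ a, x v a = 0 := fun a =>
        (mul_eq_zero.1 (h1 a (Finset.mem_univ _))).resolve_right (hcon a).ne'
      simpa [h2] using hx1 v
    refine ⟨Function.update c v a, ?_⟩
    rw [Finset.sum_insert hv, Finset.sum_insert hv, Function.update_self]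
    have : ∑ u ∈ S, w u (Function.update c v a u) = z := Finset.sum_congr rfl fun u hu => by
      rw [Function.update_of_ne (by rintro rfl; exact hv hu)]
    rw [this, add_comm (w v a), norm_add_sq_real]
    linarith [hR v a]

/-- Rounding a fractional colouring `x` to a colouring `c` for which class sizes and the values of
a bilinear form are nearly preserved. -/
theorem exists_rounding {V K : Type*} [Fintype V] [Fintype K] (A : V → V → ℝ) (x : V → K → ℝ)
    (hx0 : ∀ v a, 0 ≤ x v a) (hx1 : ∀ v, ∑ a, x v a = 1) (l : ℝ) :
    ∃ c : V → K, ∀ a, (l * ∑ v, ((if c v = a then 1 else 0) - x v a)) ^ 2 ≤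
        Fintype.card K * ∑ v, (l ^ 2 + ∑ w, A v w ^ 2) ∧
      ∀ t : V → ℝ, (∀ w, t w ∈ Icc (0:ℝ) 1) →
        (∑ v, ∑ w, A v w * (((if c v = a then 1 else 0) - x v a) * t w)) ^ 2 ≤
        Fintype.card V * (Fintype.card K * ∑ v, (l ^ 2 + ∑ w, A v w ^ 2)) := by
  let f : V → Option V → ℝ := fun v o => o.elim l (A v)
  let W : V → K → EuclideanSpace ℝ (K × Option V) := fun v a' =>
    WithLp.toLp 2 fun q => ((if a' = q.1 then 1 else 0) - x v q.1) * f v q.2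
  have hx1' : ∀ v a, x v a ≤ 1 := fun v a => by
    rw [← hx1 v]; exact Finset.single_le_sum (fun b _ => hx0 v b) (Finset.mem_univ a)
  have hf2 : ∀ v, ∑ o, f v o ^ 2 = l ^ 2 + ∑ w, A v w ^ 2 := fun v => by
    simp [Fintype.sum_option, f]
  obtain ⟨c, hc⟩ := exists_choice_norm_sum_sq_le W x hx0 hx1 (by
    intro v
    ext q
    simp only [W, WithLp.ofLp_sum, WithLp.ofLp_smul, Finset.sum_apply, Pi.smul_apply,
      smul_eq_mul, WithLp.ofLp_zero, Pi.zero_apply]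
    have : ∀ a, x v a * (((if a = q.1 then 1 else 0) - x v q.1) * f v q.2) =
        ((if a = q.1 then x v a else 0) - x v a * x v q.1) * f v q.2 := fun a => by
      split_ifs <;> ring
    simp only [this]
    rw [← Finset.sum_mul, Finset.sum_sub_distrib, ← Finset.sum_mul, hx1]
    simp)
    (fun v => Fintype.card K * (l ^ 2 + ∑ w, A v w ^ 2)) (by
    intro v a
    rw [EuclideanSpace.real_norm_sq_eq, Fintype.sum_prod_type]
    calc _ ≤ ∑ _b : K, ∑ o, f v o ^ 2 := by
          refine Finset.sum_le_sum fun b _ => Finset.sum_le_sum fun o _ => ?_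
          simp only [W]
          rw [mul_pow]
          refine mul_le_of_le_one_left (sq_nonneg _) ?_
          have h0 := hx0 v b
          have h1 := hx1' v b
          split_ifs <;> nlinarith
      _ = _ := by simp [hf2, mul_add]) Finset.univ
  rw [← Finset.mul_sum, EuclideanSpace.real_norm_sq_eq] at hc
  refine ⟨c, fun a => ?_⟩
  have hrow : ∑ o, (∑ v, ((if c v = a then 1 else 0) - x v a) * f v o) ^ 2 ≤
      Fintype.card K * ∑ v, (l ^ 2 + ∑ w, A v w ^ 2) := by
    refine le_trans ?_ hc
    rw [Fintype.sum_prod_type]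
    have := Finset.single_le_sum (f := fun b => ∑ o, (∑ v, W v (c v)).ofLp (b, o) ^ 2)
      (fun b _ => Finset.sum_nonneg fun o _ => sq_nonneg _) (Finset.mem_univ a)
    refine le_trans (le_of_eq ?_) this
    simp [W]
  rw [Fintype.sum_option] at hrow
  constructor
  · refine le_trans (le_of_eq ?_) ((le_add_of_nonneg_right
      (Finset.sum_nonneg fun _ _ => sq_nonneg _)).trans hrow)
    congr 1
    rw [Finset.mul_sum]
    exact Finset.sum_congr rfl fun v _ => by simp [f, mul_comm]
  · intro t ht
    have e : ∑ v, ∑ w, A v w * (((if c v = a then 1 else 0) - x v a) * t w) =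
        ∑ w, t w * ∑ v, ((if c v = a then 1 else 0) - x v a) * f v (some w) := by
      rw [Finset.sum_comm]
      refine Finset.sum_congr rfl fun w _ => ?_
      rw [Finset.mul_sum]
      exact Finset.sum_congr rfl fun v _ => by simp only [f, Option.elim]; ring
    rw [e]
    refine (Finset.sum_mul_sq_le_sq_mul_sq _ _ _).trans (mul_le_mul ?_
      ((le_add_of_nonneg_left (sq_nonneg _)).trans hrow) (Finset.sum_nonneg fun _ _ => sq_nonneg _)
      (Nat.cast_nonneg _))
    calc _ ≤ ∑ _w : V, (1:ℝ) := Finset.sum_le_sum fun w _ => by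
            have := ht w; nlinarith [this.1, this.2]
      _ = _ := by simp

/-- The index of the subinterval `(u/n, (u+1)/n]` containing `x ∈ (0,1]`, as an element of
`Fin n`. -/
noncomputable def block (n : ℕ) [NeZero n] (x : ℝ) : Fin n := Fin.ofNat n (idx n x)

theorem idx_lt {n : ℕ} [NeZero n] {x : ℝ} (hx : x ≤ 1) : idx n x < n := by
  have hn : 0 < n := Nat.pos_of_ne_zero (NeZero.ne n)
  have : ⌈x * n⌉₊ ≤ n := Nat.ceil_le.2 (by
    have : (0:ℝ) ≤ n := Nat.cast_nonneg n
    nlinarith)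
  unfold idx
  omega

theorem block_val {n : ℕ} [NeZero n] {x : ℝ} (hx : x ≤ 1) : (block n x : ℕ) = idx n x := by
  simp [block, Nat.mod_eq_of_lt (idx_lt hx)]

theorem block_eq_iff {n : ℕ} [NeZero n] {x : ℝ} (hx : x ∈ Ioc (0:ℝ) 1) (u : Fin n) :
    block n x = u ↔ x ∈ Ioc ((u : ℝ) / n) (((u : ℝ) + 1) / n) := by
  have hn : (0:ℝ) < n := by exact_mod_cast Nat.pos_of_ne_zero (NeZero.ne n)
  rw [Fin.ext_iff, block_val hx.2, idx, mem_Ioc, div_lt_iff₀ hn, le_div_iff₀ hn]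
  have hpos : 0 < ⌈x * n⌉₊ := Nat.ceil_pos.2 (mul_pos hx.1 hn)
  have : ⌈x * n⌉₊ - 1 = u ↔ ⌈x * n⌉₊ = u + 1 := by omega
  rw [this, Nat.ceil_eq_iff (by omega)]
  simp

theorem Ioc_block_subset {n : ℕ} [NeZero n] (u : Fin n) :
    Ioc ((u : ℝ) / n) (((u : ℝ) + 1) / n) ⊆ Ioc (0:ℝ) 1 := by
  have hn : (0:ℝ) < n := by exact_mod_cast Nat.pos_of_ne_zero (NeZero.ne n)
  refine Ioc_subset_Ioc (by positivity) ?_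
  rw [div_le_one hn]
  exact_mod_cast u.2

theorem measurable_block (n : ℕ) [NeZero n] : Measurable (block n) := by
  have h : Measurable fun x : ℝ => ⌈x * n⌉₊ := Nat.measurable_ceil.comp (by fun_prop)
  have h2 : Measurable fun m : ℕ => Fin.ofNat n (m - 1) := measurable_from_top
  exact h2.comp h

theorem volume_Ioc_inter_eq_sum (n : ℕ) [NeZero n] {t : Set ℝ} (ht : MeasurableSet t) :
    volume (Ioc (0:ℝ) 1 ∩ t) =
      ∑ u : Fin n, volume (Ioc ((u : ℝ) / n) (((u : ℝ) + 1) / n) ∩ t) := by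
  have : Ioc (0:ℝ) 1 ∩ t = ⋃ u : Fin n, Ioc ((u : ℝ) / n) (((u : ℝ) + 1) / n) ∩ t := by
    ext x
    simp only [mem_inter_iff, mem_iUnion]
    constructor
    · rintro ⟨hx, hxt⟩
      exact ⟨block n x, (block_eq_iff hx _).1 rfl, hxt⟩
    · rintro ⟨u, hx, hxt⟩
      exact ⟨Ioc_block_subset u hx, hxt⟩
  rw [this, measure_iUnion _ fun u => measurableSet_Ioc.inter ht, tsum_fintype]
  intro u v huv
  refine Set.disjoint_left.2 fun x hx hx' => huv ?_
  rw [← (block_eq_iff (Ioc_block_subset u hx.1) u).2 hx.1,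
    (block_eq_iff (Ioc_block_subset v hx'.1) v).2 hx'.1]

theorem Icc_inter_ae_eq_Ioc_inter (t : Set ℝ) :
    (Icc (0:ℝ) 1 ∩ t : Set ℝ) =ᵐ[volume] (Ioc (0:ℝ) 1 ∩ t : Set ℝ) :=
  Ioc_ae_eq_Icc.symm.inter (ae_eq_refl t)

theorem Ioc_inter_block_preimage (n : ℕ) [NeZero n] (u : Fin n) :
    Ioc (0:ℝ) 1 ∩ block n ⁻¹' {u} = Ioc ((u : ℝ) / n) (((u : ℝ) + 1) / n) := by
  ext x
  constructor
  · rintro ⟨hx, hxu⟩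
    exact (block_eq_iff hx u).1 hxu
  · intro hx
    exact ⟨Ioc_block_subset u hx, (block_eq_iff (Ioc_block_subset u hx) u).2 hx⟩

theorem volume_block (n : ℕ) [NeZero n] (u : Fin n) :
    volume (Icc (0:ℝ) 1 ∩ block n ⁻¹' {u}) = 1 / (n : ℝ≥0∞) := by
  have hn : (0:ℝ) < n := by exact_mod_cast Nat.pos_of_ne_zero (NeZero.ne n)
  rw [measure_congr (Icc_inter_ae_eq_Ioc_inter _), Ioc_inter_block_preimage, Real.volume_Ioc]
  have : ((u : ℝ) + 1) / n - u / n = 1 / n := by ring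
  rw [this, ENNReal.ofReal_div_of_pos hn]
  simp

theorem volume_real_block (n : ℕ) [NeZero n] (u : Fin n) :
    volume.real (Icc (0:ℝ) 1 ∩ block n ⁻¹' {u}) = 1 / n := by
  simp [measureReal_def, volume_block]

/-- The weighted adjacency matrix of a graph. -/
noncomputable def adjWeight {n : ℕ} (p : ℝ) (G : SimpleGraph (Fin n)) (u v : Fin n) : ℝ :=
  if G.Adj u v then 1 / p else 0

theorem graphKernel_eq {n : ℕ} [NeZero n] (p : ℝ) (G : SimpleGraph (Fin n)) {x y : ℝ}
    (hx : x ∈ Ioc (0:ℝ) 1) (hy : y ∈ Ioc (0:ℝ) 1) :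
    graphKernel p G x y = adjWeight p G (block n x) (block n y) := by
  have hx' : (⟨idx n x, idx_lt hx.2⟩ : Fin n) = block n x := Fin.ext (block_val hx.2).symm
  have hy' : (⟨idx n y, idx_lt hy.2⟩ : Fin n) = block n y := Fin.ext (block_val hy.2).symm
  rw [graphKernel, dif_pos ⟨hx, hy, idx_lt hx.2, idx_lt hy.2⟩, hx', hy', adjWeight]

theorem restrict_Icc_prod_Icc : (volume.restrict (Icc (0:ℝ) 1 ×ˢ Icc (0:ℝ) 1)) =
    (volume.restrict (Icc (0:ℝ) 1)).prod (volume.restrict (Icc (0:ℝ) 1)) := by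
  rw [Measure.prod_restrict, Measure.volume_eq_prod]

theorem ae_mem_Ioc_prod : ∀ᵐ q : ℝ × ℝ ∂(volume.restrict (Icc (0:ℝ) 1 ×ˢ Icc (0:ℝ) 1)),
    q.1 ∈ Ioc (0:ℝ) 1 ∧ q.2 ∈ Ioc (0:ℝ) 1 := by
  have h : (Ioc (0:ℝ) 1 ×ˢ Ioc (0:ℝ) 1 : Set (ℝ × ℝ)) =ᵐ[volume]
      (Icc (0:ℝ) 1 ×ˢ Icc (0:ℝ) 1 : Set (ℝ × ℝ)) :=
    Measure.set_prod_ae_eq Ioc_ae_eq_Icc Ioc_ae_eq_Icc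
  rw [← Measure.restrict_congr_set h]
  filter_upwards [ae_restrict_mem (measurableSet_Ioc.prod measurableSet_Ioc)] with q hq using hq

theorem graphKernel_ae_eq {n : ℕ} [NeZero n] (p : ℝ) (G : SimpleGraph (Fin n)) :
    ∀ᵐ q : ℝ × ℝ ∂(volume.restrict (Icc (0:ℝ) 1 ×ˢ Icc (0:ℝ) 1)),
      graphKernel p G q.1 q.2 = adjWeight p G (block n q.1) (block n q.2) := by
  filter_upwards [ae_mem_Ioc_prod] with q hq using graphKernel_eq p G hq.1 hq.2

theorem setIntegral_congr_of_ae_Icc {W W' : ℝ → ℝ → ℝ}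
    (h : ∀ᵐ q : ℝ × ℝ ∂(volume.restrict (Icc (0:ℝ) 1 ×ˢ Icc (0:ℝ) 1)), W q.1 q.2 = W' q.1 q.2)
    {S T : Set ℝ} (hS : S ⊆ Icc 0 1) (hT : T ⊆ Icc 0 1) :
    ∫ q in S ×ˢ T, W q.1 q.2 = ∫ q in S ×ˢ T, W' q.1 q.2 :=
  integral_congr_ae (ae_restrict_of_ae_restrict_of_subset (prod_mono hS hT) h)

/-- The integral of a kernel depending only on the classes of its arguments. -/
theorem setIntegral_comp_finite {ι : Type*} [Fintype ι] [MeasurableSpace ι]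
    [DiscreteMeasurableSpace ι] {f : ℝ → ι} (hf : Measurable f) (B : ι → ι → ℝ) {S T : Set ℝ}
    (hS : volume S ≠ ⊤) (hT : volume T ≠ ⊤) :
    ∫ q in S ×ˢ T, B (f q.1) (f q.2) = ∑ u, ∑ v, B u v *
      (volume.real (S ∩ f ⁻¹' {u}) * volume.real (T ∩ f ⁻¹' {v})) := by
  have hm : ∀ u, MeasurableSet (f ⁻¹' {u}) := fun u => hf (measurableSet_singleton u)
  have hpt : ∀ q : ℝ × ℝ, B (f q.1) (f q.2) = ∑ u, ∑ v, B u v *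
      ((f ⁻¹' {u}).indicator (fun _ => (1:ℝ)) q.1 * (f ⁻¹' {v}).indicator (fun _ => (1:ℝ)) q.2) := by
    intro q
    rw [Finset.sum_eq_single (f q.1), Finset.sum_eq_single (f q.2)]
    · simp
    · intro v _ hv
      rw [indicator_of_notMem (s := f ⁻¹' {v}) (fun h => hv h.symm)]
      simp
    · simp
    · intro u _ hu
      refine Finset.sum_eq_zero fun v _ => ?_
      rw [indicator_of_notMem (s := f ⁻¹' {u}) (fun h => hu h.symm)]
      simp
    · simp
  have hInt : ∀ {R : Set ℝ}, volume R ≠ ⊤ → ∀ u, IntegrableOn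
      ((f ⁻¹' {u}).indicator (fun _ => (1:ℝ))) R := fun hR u =>
    (integrableOn_const hR).indicator (hm u)
  have hint2 : ∀ u v, IntegrableOn (fun q : ℝ × ℝ => B u v *
      ((f ⁻¹' {u}).indicator (fun _ => (1:ℝ)) q.1 * (f ⁻¹' {v}).indicator (fun _ => (1:ℝ)) q.2))
      (S ×ˢ T) := by
    intro u v
    refine Integrable.const_mul ?_ _
    rw [Measure.volume_eq_prod, ← Measure.prod_restrict]
    exact (hInt hS u).mul_prod (hInt hT v)
  have hind : ∀ (R : Set ℝ) u, ∫ x in R, (f ⁻¹' {u}).indicator (fun _ => (1:ℝ)) x =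
      volume.real (R ∩ f ⁻¹' {u}) := fun R u => by
    rw [setIntegral_indicator (hm u)]; simp
  simp only [hpt]
  rw [integral_finsetSum _ fun u _ => integrable_finsetSum _ fun v _ => hint2 u v]
  refine Finset.sum_congr rfl fun u _ => ?_
  rw [integral_finsetSum _ fun v _ => hint2 u v]
  refine Finset.sum_congr rfl fun v _ => ?_
  rw [integral_const_mul, Measure.volume_eq_prod, setIntegral_prod_mul, hind, hind]

theorem volume_ne_top_of_subset_Icc {S : Set ℝ} (hS : S ⊆ Icc 0 1) : volume S ≠ ⊤ :=
  measure_ne_top_of_subset hS (by simp)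

/-- The interval exchange of `[0,1]` permuting the `n` blocks according to `σ`. -/
noncomputable def blockExchange {n : ℕ} [NeZero n] (σ : Equiv.Perm (Fin n)) (x : ℝ) : ℝ :=
  if x = 0 then 0 else x + ((σ (block n x) : ℝ) - (block n x : ℝ)) / n

theorem blockExchange_mem {n : ℕ} [NeZero n] (σ : Equiv.Perm (Fin n)) {x : ℝ}
    (hx : x ∈ Ioc (0:ℝ) 1) : blockExchange σ x ∈ Ioc (0:ℝ) 1 ∧
      block n (blockExchange σ x) = σ (block n x) := by
  have h := (block_eq_iff hx (block n x)).1 rfl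
  have h2 : blockExchange σ x ∈
      Ioc ((σ (block n x) : ℝ) / n) (((σ (block n x) : ℝ) + 1) / n) := by
    rw [blockExchange, if_neg hx.1.ne']
    rw [mem_Ioc] at h ⊢
    rw [add_div] at h ⊢
    rw [sub_div]
    constructor <;> linarith [h.1, h.2]
  exact ⟨Ioc_block_subset _ h2, (block_eq_iff (Ioc_block_subset _ h2) _).2 h2⟩

theorem blockExchange_symm_apply {n : ℕ} [NeZero n] (σ : Equiv.Perm (Fin n)) {x : ℝ}
    (hx : x ∈ Icc (0:ℝ) 1) : blockExchange σ.symm (blockExchange σ x) = x := by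
  rcases hx.1.eq_or_lt with rfl | h0
  · simp [blockExchange]
  · obtain ⟨h1, h2⟩ := blockExchange_mem σ ⟨h0, hx.2⟩
    rw [blockExchange, if_neg h1.1.ne', h2, blockExchange, if_neg h0.ne', Equiv.symm_apply_apply]
    ring

theorem mpBij_blockExchange {n : ℕ} [NeZero n] (σ : Equiv.Perm (Fin n)) :
    MPBij (blockExchange σ) := by
  have hmaps : ∀ ρ : Equiv.Perm (Fin n), MapsTo (blockExchange ρ) (Icc 0 1) (Icc 0 1) := by
    intro ρ x hx
    rcases hx.1.eq_or_lt with rfl | h0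
    · simp [blockExchange]
    · exact Ioc_subset_Icc_self (blockExchange_mem ρ ⟨h0, hx.2⟩).1
  have hmeas : Measurable (blockExchange σ) := by
    have h1 : Measurable fun x => ((σ (block n x) : ℝ) - (block n x : ℝ)) / n := by
      have : Measurable fun u : Fin n => ((σ u : ℝ) - (u : ℝ)) / n := measurable_of_finite _
      exact this.comp (measurable_block n)
    exact Measurable.ite (measurableSet_singleton 0) measurable_const (measurable_id.add h1)
  refine ⟨⟨hmeas, ?_⟩, InvOn.bijOn (f' := blockExchange σ.symm)
    ⟨fun x hx => blockExchange_symm_apply σ hx, fun x hx => ?_⟩ (hmaps σ) (hmaps _)⟩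
  · ext s hs
    rw [Measure.map_apply hmeas hs, Measure.restrict_apply (hmeas hs), Measure.restrict_apply hs,
      inter_comm, inter_comm s, measure_congr (Icc_inter_ae_eq_Ioc_inter _),
      measure_congr (Icc_inter_ae_eq_Ioc_inter _), volume_Ioc_inter_eq_sum n (hmeas hs),
      volume_Ioc_inter_eq_sum n hs,
      ← Equiv.sum_comp σ fun u => volume (Ioc ((u : ℝ) / n) (((u : ℝ) + 1) / n) ∩ s)]
    refine Finset.sum_congr rfl fun u _ => ?_
    rw [← measure_preimage_add_right volume (((σ u : ℝ) - u) / n)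
      (Ioc ((σ u : ℝ) / n) (((σ u : ℝ) + 1) / n) ∩ s)]
    congr 1
    ext x
    have key : x ∈ Ioc ((u : ℝ) / n) (((u : ℝ) + 1) / n) ↔
        x + ((σ u : ℝ) - u) / n ∈ Ioc ((σ u : ℝ) / n) (((σ u : ℝ) + 1) / n) := by
      rw [mem_Ioc, mem_Ioc, add_div, add_div, sub_div]
      constructor <;> intro h <;> constructor <;> linarith [h.1, h.2]
    rw [mem_inter_iff, mem_preimage, mem_preimage, mem_inter_iff, ← key]
    refine and_congr_right fun hx => ?_
    have hx' := Ioc_block_subset u hx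
    rw [blockExchange, if_neg hx'.1.ne', (block_eq_iff hx' u).2 hx]
  · have := blockExchange_symm_apply σ.symm hx
    rwa [Equiv.symm_symm] at this

theorem integrableOn_of_abs_le {W : ℝ → ℝ → ℝ} (hW : Measurable (Function.uncurry W)) {B : ℝ}
    (hB : ∀ x y, |W x y| ≤ B) :
    IntegrableOn (fun q : ℝ × ℝ => W q.1 q.2) (Icc (0:ℝ) 1 ×ˢ Icc (0:ℝ) 1) := by
  refine Measure.integrableOn_of_bounded (M := B) ?_ hW.aestronglyMeasurable
    (ae_of_all _ fun q => hB q.1 q.2)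
  rw [Measure.volume_eq_prod, Measure.prod_prod]
  simp

theorem abs_setIntegral_le_cutNorm {W : ℝ → ℝ → ℝ}
    (hW : IntegrableOn (fun q : ℝ × ℝ => W q.1 q.2) (Icc (0:ℝ) 1 ×ˢ Icc (0:ℝ) 1))
    {S T : Set ℝ} (hS : MeasurableSet S) (hT : MeasurableSet T) (hS1 : S ⊆ Icc 0 1)
    (hT1 : T ⊆ Icc 0 1) : |∫ q in S ×ˢ T, W q.1 q.2| ≤ cutNorm W := by
  refine le_csSup ⟨∫ q in Icc (0:ℝ) 1 ×ˢ Icc (0:ℝ) 1, |W q.1 q.2|, ?_⟩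
    ⟨S, T, hS, hT, hS1, hT1, rfl⟩
  rintro r ⟨S', T', hS', hT', hS1', hT1', rfl⟩
  refine (abs_integral_le_integral_abs).trans ?_
  exact setIntegral_mono_set hW.abs (ae_of_all _ fun q => abs_nonneg _)
    (prod_mono hS1' hT1').eventuallyLE

theorem cutNorm_le {W : ℝ → ℝ → ℝ} {ε : ℝ} (hε : 0 ≤ ε)
    (h : ∀ S T : Set ℝ, MeasurableSet S → MeasurableSet T → S ⊆ Icc 0 1 → T ⊆ Icc 0 1 →
      |∫ q in S ×ˢ T, W q.1 q.2| ≤ ε) : cutNorm W ≤ ε := by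
  refine Real.sSup_le ?_ hε
  rintro r ⟨S, T, hS, hT, hS1, hT1, rfl⟩
  exact h S T hS hT hS1 hT1

theorem cutNorm_nonneg (W : ℝ → ℝ → ℝ) : 0 ≤ cutNorm W := by
  refine Real.sSup_nonneg ?_
  rintro r ⟨S, T, -, -, -, -, rfl⟩
  exact abs_nonneg _

theorem cutDist_nonneg (κ₁ κ₂ : ℝ → ℝ → ℝ) : 0 ≤ cutDist κ₁ κ₂ := by
  refine Real.sInf_nonneg ?_
  rintro r ⟨τ, -, rfl⟩
  exact cutNorm_nonneg _

theorem cutDist_le (κ₁ κ₂ : ℝ → ℝ → ℝ) {τ : ℝ → ℝ} (hτ : MPBij τ) :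
    cutDist κ₁ κ₂ ≤ cutNorm (fun x y => κ₁ x y - κ₂ (τ x) (τ y)) := by
  refine csInf_le ⟨0, ?_⟩ ⟨τ, hτ, rfl⟩
  rintro r ⟨τ, -, rfl⟩
  exact cutNorm_nonneg _

theorem exists_cutNorm_lt_of_cutDist_lt {κ₁ κ₂ : ℝ → ℝ → ℝ} {δ : ℝ} (h : cutDist κ₁ κ₂ < δ) :
    ∃ τ, MPBij τ ∧ cutNorm (fun x y => κ₁ x y - κ₂ (τ x) (τ y)) < δ := by
  obtain ⟨r, ⟨τ, hτ, rfl⟩, hr⟩ := exists_lt_of_csInf_lt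
    (s := {r | ∃ τ : ℝ → ℝ, MPBij τ ∧ r = cutNorm (fun x y => κ₁ x y - κ₂ (τ x) (τ y))})
    ⟨_, id, ⟨MeasurePreserving.id _, bijOn_id _⟩, rfl⟩ h
  exact ⟨τ, hτ, hr⟩

/-- Changing the sides of a rectangle on a set `D` changes the integral of a bounded kernel
by at most `2 B |D|`. -/
theorem abs_setIntegral_sub_setIntegral_le {W : ℝ → ℝ → ℝ}
    (hW : Measurable (Function.uncurry W)) {B : ℝ} (hB : ∀ x y, |W x y| ≤ B)
    {S S' T T' D : Set ℝ} (hS : MeasurableSet S) (hS' : MeasurableSet S')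
    (hT : MeasurableSet T) (hT' : MeasurableSet T') (hD : MeasurableSet D)
    (hS1 : S ⊆ Icc 0 1) (hS1' : S' ⊆ Icc 0 1) (hT1 : T ⊆ Icc 0 1) (hT1' : T' ⊆ Icc 0 1)
    (hSD : ∀ x ∉ D, x ∈ S ↔ x ∈ S') (hTD : ∀ x ∉ D, x ∈ T ↔ x ∈ T') (hD1 : D ⊆ Icc 0 1) :
    |(∫ q in S ×ˢ T, W q.1 q.2) - ∫ q in S' ×ˢ T', W q.1 q.2| ≤ 2 * B * volume.real D := by
  have hB0 : 0 ≤ B := (abs_nonneg _).trans (hB 0 0)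
  have hInt := integrableOn_of_abs_le hW hB
  set I : Set (ℝ × ℝ) := Icc (0:ℝ) 1 ×ˢ Icc (0:ℝ) 1 with hI
  have hrw : ∀ {A A' : Set ℝ}, MeasurableSet A → MeasurableSet A' → A ⊆ Icc 0 1 → A' ⊆ Icc 0 1 →
      ∫ q in A ×ˢ A', W q.1 q.2 = ∫ q in I, (A ×ˢ A').indicator (fun q => W q.1 q.2) q := by
    intro A A' hA hA' hA1 hA1'
    rw [setIntegral_indicator (hA.prod hA'), inter_eq_self_of_subset_right (prod_mono hA1 hA1')]
  have hf1 : volume (D ×ˢ Icc (0:ℝ) 1) ≠ ⊤ := by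
    rw [Measure.volume_eq_prod, Measure.prod_prod]
    exact ENNReal.mul_ne_top (volume_ne_top_of_subset_Icc hD1) (by simp)
  have hf2 : volume (Icc (0:ℝ) 1 ×ˢ D) ≠ ⊤ := by
    rw [Measure.volume_eq_prod, Measure.prod_prod]
    exact ENNReal.mul_ne_top (by simp) (volume_ne_top_of_subset_Icc hD1)
  have i1 : Integrable ((D ×ˢ Icc (0:ℝ) 1).indicator fun _ : ℝ × ℝ => B) (volume.restrict I) :=
    ((integrable_indicator_iff (hD.prod measurableSet_Icc)).2 (integrableOn_const hf1)).integrableOn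
  have i2 : Integrable ((Icc (0:ℝ) 1 ×ˢ D).indicator fun _ : ℝ × ℝ => B) (volume.restrict I) :=
    ((integrable_indicator_iff (measurableSet_Icc.prod hD)).2 (integrableOn_const hf2)).integrableOn
  rw [hrw hS hT hS1 hT1, hrw hS' hT' hS1' hT1',
    ← integral_sub (hInt.indicator (hS.prod hT)) (hInt.indicator (hS'.prod hT'))]
  calc _ ≤ ∫ q in I, ((D ×ˢ Icc (0:ℝ) 1).indicator (fun _ : ℝ × ℝ => B) q +
        (Icc (0:ℝ) 1 ×ˢ D).indicator (fun _ : ℝ × ℝ => B) q) := by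
        rw [← Real.norm_eq_abs]
        refine norm_integral_le_of_norm_le (i1.add i2) ?_
        filter_upwards [ae_restrict_mem (measurableSet_Icc.prod measurableSet_Icc)] with q hq
        have hBq := hB q.1 q.2
        have hb := abs_le.1 hBq
        by_cases h1 : q.1 ∈ D
        · have e1 : (D ×ˢ Icc (0:ℝ) 1).indicator (fun _ : ℝ × ℝ => B) q = B :=
            indicator_of_mem (mk_mem_prod h1 hq.2) _
          rw [e1]
          have : 0 ≤ (Icc (0:ℝ) 1 ×ˢ D).indicator (fun _ : ℝ × ℝ => B) q :=
            indicator_nonneg (fun _ _ => hB0) q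
          refine le_trans ?_ (le_add_of_nonneg_right this)
          simp only [indicator_apply]
          rw [Real.norm_eq_abs]
          split_ifs <;> simp [abs_neg, hBq, hB0]
        · by_cases h2 : q.2 ∈ D
          · have e1 : (Icc (0:ℝ) 1 ×ˢ D).indicator (fun _ : ℝ × ℝ => B) q = B :=
              indicator_of_mem (mk_mem_prod hq.1 h2) _
            rw [e1]
            have : 0 ≤ (D ×ˢ Icc (0:ℝ) 1).indicator (fun _ : ℝ × ℝ => B) q :=
              indicator_nonneg (fun _ _ => hB0) q
            refine le_trans ?_ (le_add_of_nonneg_left this)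
            simp only [indicator_apply]
            rw [Real.norm_eq_abs]
            split_ifs <;> simp [abs_neg, hBq, hB0]
          · have : (S ×ˢ T).indicator (fun q : ℝ × ℝ => W q.1 q.2) q =
                (S' ×ˢ T').indicator (fun q : ℝ × ℝ => W q.1 q.2) q := by
              simp only [indicator_apply, mem_prod, hSD _ h1, hTD _ h2]
            rw [this, sub_self, norm_zero]
            exact add_nonneg (indicator_nonneg (fun _ _ => hB0) q)
              (indicator_nonneg (fun _ _ => hB0) q)
    _ = 2 * B * volume.real D := by
        rw [integral_add i1 i2, setIntegral_indicator (hD.prod measurableSet_Icc),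
          setIntegral_indicator (measurableSet_Icc.prod hD),
          inter_eq_self_of_subset_right (prod_mono hD1 subset_rfl),
          inter_eq_self_of_subset_right (prod_mono subset_rfl hD1), setIntegral_const,
          setIntegral_const, Measure.volume_eq_prod, measureReal_prod_prod, measureReal_prod_prod]
        simp
        ring

/-- Change of variables for a measure-preserving bijection applied to both coordinates. -/
theorem setIntegral_comp_mpBij {κ : ℝ → ℝ → ℝ} (hκ : Measurable (Function.uncurry κ))
    {τ : ℝ → ℝ} (hτ : MPBij τ) {Q R : Set ℝ} (hQ : MeasurableSet Q) (hR : MeasurableSet R)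
    (hQ1 : Q ⊆ Icc 0 1) (hR1 : R ⊆ Icc 0 1) :
    ∫ q in (Icc 0 1 ∩ τ ⁻¹' Q) ×ˢ (Icc 0 1 ∩ τ ⁻¹' R), κ (τ q.1) (τ q.2) =
      ∫ q in Q ×ˢ R, κ q.1 q.2 := by
  have hmp := hτ.1.prod hτ.1
  rw [← restrict_Icc_prod_Icc] at hmp
  have hind : Measurable ((Q ×ˢ R).indicator fun q : ℝ × ℝ => κ q.1 q.2) :=
    Measurable.indicator hκ (hQ.prod hR)
  have h1 : ∫ q in Q ×ˢ R, κ q.1 q.2 = ∫ q in Icc (0:ℝ) 1 ×ˢ Icc (0:ℝ) 1,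
      (Q ×ˢ R).indicator (fun q => κ q.1 q.2) q := by
    rw [setIntegral_indicator (hQ.prod hR), inter_eq_self_of_subset_right (prod_mono hQ1 hR1)]
  have h2 : ∫ q in (Icc 0 1 ∩ τ ⁻¹' Q) ×ˢ (Icc 0 1 ∩ τ ⁻¹' R), κ (τ q.1) (τ q.2) =
      ∫ q in Icc (0:ℝ) 1 ×ˢ Icc (0:ℝ) 1, ((τ ⁻¹' Q) ×ˢ (τ ⁻¹' R)).indicator
        (fun q => κ (τ q.1) (τ q.2)) q := by
    rw [setIntegral_indicator ((hτ.1.measurable hQ).prod (hτ.1.measurable hR)), prod_inter_prod]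
  rw [h1, h2]
  conv_rhs => rw [← hmp.map_eq]
  rw [integral_map hmp.measurable.aemeasurable hind.aestronglyMeasurable]
  rfl

theorem measurable_comp_mpBij {κ : ℝ → ℝ → ℝ} (hκ : Measurable (Function.uncurry κ))
    {τ : ℝ → ℝ} (hτ : MPBij τ) : Measurable (Function.uncurry fun x y => κ (τ x) (τ y)) :=
  hκ.comp ((hτ.1.measurable.comp measurable_fst).prodMk (hτ.1.measurable.comp measurable_snd))

theorem ae_comp_mpBij {P : ℝ → ℝ → Prop}
    (h : ∀ᵐ q : ℝ × ℝ ∂(volume.restrict (Icc (0:ℝ) 1 ×ˢ Icc (0:ℝ) 1)), P q.1 q.2)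
    {τ : ℝ → ℝ} (hτ : MPBij τ) :
    ∀ᵐ q : ℝ × ℝ ∂(volume.restrict (Icc (0:ℝ) 1 ×ˢ Icc (0:ℝ) 1)), P (τ q.1) (τ q.2) := by
  have hmp := hτ.1.prod hτ.1
  rw [← restrict_Icc_prod_Icc] at hmp
  exact hmp.quasiMeasurePreserving.ae h

theorem cutNorm_congr {W W' : ℝ → ℝ → ℝ}
    (h : ∀ᵐ q : ℝ × ℝ ∂(volume.restrict (Icc (0:ℝ) 1 ×ˢ Icc (0:ℝ) 1)),
      W q.1 q.2 = W' q.1 q.2) : cutNorm W = cutNorm W' := by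
  unfold cutNorm
  congr 1
  ext r
  refine exists_congr fun S => exists_congr fun T => ?_
  refine and_congr_right fun _ => and_congr_right fun _ => and_congr_right fun hS =>
    and_congr_right fun hT => ?_
  rw [setIntegral_congr_of_ae_Icc h hS hT]

theorem cutDist_congr_right (W : ℝ → ℝ → ℝ) {κ κ' : ℝ → ℝ → ℝ}
    (h : ∀ᵐ q : ℝ × ℝ ∂(volume.restrict (Icc (0:ℝ) 1 ×ˢ Icc (0:ℝ) 1)),
      κ q.1 q.2 = κ' q.1 q.2) : cutDist W κ = cutDist W κ' := by
  unfold cutDist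
  congr 1
  ext r
  refine exists_congr fun τ => and_congr_right fun hτ => ?_
  rw [cutNorm_congr]
  filter_upwards [ae_comp_mpBij (P := fun x y => κ x y = κ' x y) h hτ] with q hq
  rw [hq]

theorem MsetK_congr (k : ℕ) {κ κ' : ℝ → ℝ → ℝ}
    (h : ∀ᵐ q : ℝ × ℝ ∂(volume.restrict (Icc (0:ℝ) 1 ×ˢ Icc (0:ℝ) 1)),
      κ q.1 q.2 = κ' q.1 q.2) : MsetK k κ = MsetK k κ' := by
  unfold MsetK
  congr 1
  ext M
  refine exists_congr fun Q => and_congr_right fun _ => and_congr_right fun _ =>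
    and_congr_right fun hQ => and_congr_right fun _ => ?_
  have hQ1 : ∀ a, Q a ⊆ Icc 0 1 := fun a => hQ ▸ subset_iUnion Q a
  have : ∀ a b, ∫ q in (Q a) ×ˢ (Q b), κ q.1 q.2 = ∫ q in (Q a) ×ˢ (Q b), κ' q.1 q.2 :=
    fun a b => setIntegral_congr_of_ae_Icc h (hQ1 a) (hQ1 b)
  simp only [this]

/-- The class of colour `a` of a colouring of `[0,1]`. -/
def cell {ι : Type*} (f : ℝ → ι) (a : ι) : Set ℝ := Icc 0 1 ∩ f ⁻¹' {a}

/-- A measurable colouring of `[0,1]` with `k` colour classes of measure `1/k`. -/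
def IsExactColouring (k : ℕ) (f : ℝ → Fin k) : Prop :=
  Measurable f ∧ ∀ a, volume (cell f a) = 1 / (k : ℝ≥0∞)

/-- The matrix of densities of a kernel with respect to a colouring. -/
noncomputable def kernelMatrix {k : ℕ} (κ : ℝ → ℝ → ℝ) (f : ℝ → Fin k) (a b : Fin k) : ℝ :=
  (k : ℝ) ^ 2 * ∫ q in cell f a ×ˢ cell f b, κ q.1 q.2

theorem cell_subset {ι : Type*} (f : ℝ → ι) (a : ι) : cell f a ⊆ Icc 0 1 := inter_subset_left

theorem measurableSet_cell {ι : Type*} [MeasurableSpace ι] [MeasurableSingletonClass ι]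
    {f : ℝ → ι} (hf : Measurable f) (a : ι) : MeasurableSet (cell f a) :=
  measurableSet_Icc.inter (hf (measurableSet_singleton a))

theorem disjoint_cell {ι : Type*} (f : ℝ → ι) {a b : ι} (h : a ≠ b) :
    Disjoint (cell f a) (cell f b) :=
  Set.disjoint_left.2 fun _ ha hb => h (ha.2.symm.trans hb.2)

theorem IsExactColouring.volume_real {k : ℕ} {f : ℝ → Fin k} (hf : IsExactColouring k f)
    (a : Fin k) : volume.real (cell f a) = 1 / k := by
  simp [measureReal_def, hf.2 a]

theorem isExactColouring_block (k : ℕ) [NeZero k] : IsExactColouring k (block k) :=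
  ⟨measurable_block k, volume_block k⟩

theorem cell_comp {τ : ℝ → ℝ} (hτ : MapsTo τ (Icc 0 1) (Icc 0 1)) {ι : Type*} (f : ℝ → ι)
    (a : ι) : cell (f ∘ τ) a = Icc 0 1 ∩ τ ⁻¹' (cell f a) := by
  ext x
  simp only [cell, mem_inter_iff, mem_preimage, Function.comp]
  exact ⟨fun h => ⟨h.1, hτ h.1, h.2⟩, fun h => ⟨h.1, h.2.2⟩⟩

theorem IsExactColouring.comp {k : ℕ} {f : ℝ → Fin k} (hf : IsExactColouring k f) {τ : ℝ → ℝ}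
    (hτ : MPBij τ) : IsExactColouring k (f ∘ τ) := by
  refine ⟨hf.1.comp hτ.1.measurable, fun a => ?_⟩
  rw [cell_comp hτ.2.mapsTo, ← hf.2 a]
  have hm := measurableSet_cell hf.1 a
  have := hτ.1.measure_preimage hm.nullMeasurableSet
  rw [Measure.restrict_apply (hτ.1.measurable hm), Measure.restrict_apply hm,
    inter_eq_self_of_subset_left (cell_subset f a)] at this
  rw [inter_comm, this]

theorem setIntegral_cell_comp {κ : ℝ → ℝ → ℝ} (hκ : Measurable (Function.uncurry κ))
    {ι : Type*} [MeasurableSpace ι] [MeasurableSingletonClass ι] {f : ℝ → ι} (hf : Measurable f)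
    {τ : ℝ → ℝ} (hτ : MPBij τ) (a b : ι) :
    ∫ q in cell (f ∘ τ) a ×ˢ cell (f ∘ τ) b, κ (τ q.1) (τ q.2) =
      ∫ q in cell f a ×ˢ cell f b, κ q.1 q.2 := by
  rw [cell_comp hτ.2.mapsTo, cell_comp hτ.2.mapsTo]
  exact setIntegral_comp_mpBij hκ hτ (measurableSet_cell hf a) (measurableSet_cell hf b)
    (cell_subset f a) (cell_subset f b)

/-- A partition of `[0,1]` comes from a colouring. -/
theorem exists_colouring_of_partition {k : ℕ} (hk : 0 < k) {Q : Fin k → Set ℝ}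
    (hQm : ∀ a, MeasurableSet (Q a)) (hQd : Pairwise fun a b => Disjoint (Q a) (Q b))
    (hQu : (⋃ a, Q a) = Icc 0 1) : ∃ f : ℝ → Fin k, Measurable f ∧ ∀ a, cell f a = Q a := by
  have hsub : ∀ a, Q a ⊆ Icc 0 1 := fun a => hQu ▸ subset_iUnion Q a
  have hex : ∀ x, ∃ a, x ∈ Icc (0:ℝ) 1 → x ∈ Q a := fun x => by
    by_cases hx : x ∈ Icc (0:ℝ) 1
    · obtain ⟨a, ha⟩ := mem_iUnion.1 (hQu ▸ hx)
      exact ⟨a, fun _ => ha⟩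
    · exact ⟨⟨0, hk⟩, fun h => absurd h hx⟩
  choose g hg using hex
  let f : ℝ → Fin k := fun x => if x ∈ Icc (0:ℝ) 1 then g x else ⟨0, hk⟩
  have hcell : ∀ a, cell f a = Q a := by
    intro a
    ext x
    constructor
    · rintro ⟨hx, hxa⟩
      have : g x = a := (if_pos hx).symm.trans hxa
      exact this ▸ hg x hx
    · intro hx
      refine ⟨hsub a hx, ?_⟩
      have h1 := hg x (hsub a hx)
      change f x = a
      simp only [f, if_pos (hsub a hx)]
      by_contra hne
      exact Set.disjoint_left.1 (hQd hne) h1 hx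
  refine ⟨f, measurable_to_countable' fun a => ?_, hcell⟩
  have : f ⁻¹' {a} = Q a ∪ ((Icc (0:ℝ) 1)ᶜ ∩ {_x | (⟨0, hk⟩ : Fin k) = a}) := by
    rw [← hcell a]
    ext x
    by_cases hx : x ∈ Icc (0:ℝ) 1
    · simp only [cell, mem_union, mem_inter_iff, hx, true_and, mem_compl_iff, not_true,
        false_and, or_false]
    · simp only [cell, mem_union, mem_inter_iff, hx, false_and, mem_compl_iff, not_false_eq_true,
        true_and, false_or, mem_preimage, mem_singleton_iff, mem_ofPred_eq, f, if_false]
  rw [this]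
  exact (hQm a).union (measurableSet_Icc.compl.inter (MeasurableSet.const _))

theorem MsetK_eq_closure {k : ℕ} (hk : 0 < k) (κ : ℝ → ℝ → ℝ) :
    MsetK k κ = closure {M | ∃ f, IsExactColouring k f ∧ M = kernelMatrix κ f} := by
  unfold MsetK
  congr 1
  ext M
  constructor
  · rintro ⟨Q, hQm, hQd, hQu, hQv, rfl⟩
    obtain ⟨f, hf, hfQ⟩ := exists_colouring_of_partition hk hQm hQd hQu
    refine ⟨f, ⟨hf, fun a => by rw [hfQ, hQv]⟩, ?_⟩
    funext a b
    simp only [kernelMatrix, hfQ]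
  · rintro ⟨f, hf, rfl⟩
    refine ⟨cell f, measurableSet_cell hf.1, fun a b h => disjoint_cell f h, ?_, hf.2, rfl⟩
    ext x
    simp only [mem_iUnion]
    exact ⟨fun ⟨a, ha⟩ => ha.1, fun hx => ⟨f x, hx, rfl⟩⟩

/-- Colourings can be transported forward along measure-preserving bijections. -/
theorem IsExactColouring.exists_comp_eqOn {k : ℕ} (hk : 0 < k) {f : ℝ → Fin k}
    (hf : IsExactColouring k f) {τ : ℝ → ℝ} (hτ : MPBij τ) :
    ∃ g, IsExactColouring k g ∧ ∀ a, cell (g ∘ τ) a = cell f a := by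
  have hm : ∀ a, MeasurableSet (τ '' cell f a) := fun a =>
    (measurableSet_cell hf.1 a).image_of_measurable_injOn hτ.1.measurable
      (hτ.2.injOn.mono (cell_subset f a))
  have hsub : ∀ a, τ '' cell f a ⊆ Icc 0 1 := fun a => by
    rintro _ ⟨x, hx, rfl⟩
    exact hτ.2.mapsTo hx.1
  have hpre : ∀ a, Icc 0 1 ∩ τ ⁻¹' (τ '' cell f a) = cell f a := by
    intro a
    ext x
    constructor
    · rintro ⟨hx, y, hy, hxy⟩
      rwa [← hτ.2.injOn hy.1 hx hxy]
    · exact fun hx => ⟨hx.1, x, hx, rfl⟩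
  obtain ⟨g, hg, hgQ⟩ := exists_colouring_of_partition hk hm (fun a b hab => by
    refine Set.disjoint_left.2 ?_
    rintro _ ⟨x, hx, rfl⟩ ⟨y, hy, hxy⟩
    have := hτ.2.injOn hy.1 hx.1 hxy
    subst this
    exact hab (hx.2.symm.trans hy.2)) (by
    ext y
    simp only [mem_iUnion]
    constructor
    · rintro ⟨a, ha⟩
      exact hsub a ha
    · intro hy
      obtain ⟨x, hx, rfl⟩ := hτ.2.surjOn hy
      exact ⟨f x, x, ⟨hx, rfl⟩, rfl⟩)
  refine ⟨g, ⟨hg, fun a => ?_⟩, fun a => by rw [cell_comp hτ.2.mapsTo, hgQ, hpre]⟩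
  have := hτ.1.measure_preimage (hm a).nullMeasurableSet
  rw [Measure.restrict_apply (hτ.1.measurable (hm a)), Measure.restrict_apply (hm a),
    inter_eq_self_of_subset_left (hsub a), inter_comm, hpre, hf.2] at this
  rw [hgQ, ← this]

/-- The integral of a bounded kernel over a product of cells is stable under small changes of
the colouring. -/
theorem abs_setIntegral_cell_sub_le {W : ℝ → ℝ → ℝ}
    (hW : Measurable (Function.uncurry W)) {B : ℝ} (hB : ∀ x y, |W x y| ≤ B) {ι : Type*}
    [MeasurableSpace ι] [Countable ι] [MeasurableSingletonClass ι] {f g : ℝ → ι}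
    (hf : Measurable f) (hg : Measurable g) (a b : ι) :
    |(∫ q in cell f a ×ˢ cell f b, W q.1 q.2) - ∫ q in cell g a ×ˢ cell g b, W q.1 q.2| ≤
      2 * B * volume.real (Icc 0 1 ∩ {x | f x ≠ g x}) := by
  have key : ∀ c, ∀ x ∉ Icc 0 1 ∩ {x | f x ≠ g x}, x ∈ cell f c ↔ x ∈ cell g c := by
    intro c x hx
    simp only [mem_inter_iff, mem_ofPred_eq, not_and, not_not] at hx
    simp only [cell, mem_inter_iff, mem_preimage, mem_singleton_iff]
    exact and_congr_right fun h => by rw [hx h]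
  exact abs_setIntegral_sub_setIntegral_le hW hB (measurableSet_cell hf a)
    (measurableSet_cell hg a) (measurableSet_cell hf b) (measurableSet_cell hg b)
    (measurableSet_Icc.inter (measurableSet_eq_fun hf hg).compl)
    (cell_subset f a) (cell_subset g a) (cell_subset f b) (cell_subset g b)
    (key a) (key b) inter_subset_left

theorem setIntegral_eq_sum_cell {ι : Type*} [Fintype ι] [MeasurableSpace ι]
    [MeasurableSingletonClass ι] {f : ℝ → ι} (hf : Measurable f) {h : ℝ × ℝ → ℝ}
    (hh : IntegrableOn h (Icc (0:ℝ) 1 ×ˢ Icc (0:ℝ) 1)) :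
    ∫ q in Icc (0:ℝ) 1 ×ˢ Icc (0:ℝ) 1, h q = ∑ a, ∑ b, ∫ q in cell f a ×ˢ cell f b, h q := by
  have hu : (Icc (0:ℝ) 1 ×ˢ Icc (0:ℝ) 1 : Set (ℝ × ℝ)) =
      ⋃ i : ι × ι, cell f i.1 ×ˢ cell f i.2 := by
    ext q
    simp only [mem_iUnion, mem_prod]
    exact ⟨fun hq => ⟨(f q.1, f q.2), ⟨hq.1, rfl⟩, ⟨hq.2, rfl⟩⟩, fun ⟨i, hi⟩ => ⟨hi.1.1, hi.2.1⟩⟩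
  rw [← Fintype.sum_prod_type' (f := fun a b => ∫ q in cell f a ×ˢ cell f b, h q)]
  conv_lhs => rw [hu]
  refine integral_iUnion_fintype (fun i => (measurableSet_cell hf _).prod (measurableSet_cell hf _))
    (fun i j hij => ?_) fun i => hh.mono_set (prod_mono (cell_subset _ _) (cell_subset _ _))
  refine Set.disjoint_left.2 fun q hq hq' => hij (Prod.ext ?_ ?_)
  · exact hq.1.2.symm.trans hq'.1.2
  · exact hq.2.2.symm.trans hq'.2.2

/-- The squared `L²` distance of a kernel from a step kernel. -/
theorem setIntegral_sq_sub_step {κ : ℝ → ℝ → ℝ} (hκ : Measurable (Function.uncurry κ)) {B : ℝ}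
    (hB : ∀ x y, |κ x y| ≤ B) {k : ℕ} (hk : 0 < k) {f : ℝ → Fin k} (hf : IsExactColouring k f)
    (g : Fin k → Fin k → ℝ) :
    ∫ q in Icc (0:ℝ) 1 ×ˢ Icc (0:ℝ) 1, (κ q.1 q.2 - g (f q.1) (f q.2)) ^ 2 =
      (∫ q in Icc (0:ℝ) 1 ×ˢ Icc (0:ℝ) 1, κ q.1 q.2 ^ 2) +
        (∑ a, ∑ b, (g a b ^ 2 - 2 * (g a b * kernelMatrix κ f a b))) / k ^ 2 := by
  have hk0 : (k:ℝ) ≠ 0 := by exact_mod_cast hk.ne'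
  have hB0 : 0 ≤ B := (abs_nonneg _).trans (hB 0 0)
  have hgm : Measurable fun q : ℝ × ℝ => g (f q.1) (f q.2) :=
    (measurable_of_finite fun i : Fin k × Fin k => g i.1 i.2).comp
      ((hf.1.comp measurable_fst).prodMk (hf.1.comp measurable_snd))
  have hi1 := integrableOn_of_abs_le hκ hB
  have hi2 : IntegrableOn (fun q : ℝ × ℝ => κ q.1 q.2 ^ 2) (Icc (0:ℝ) 1 ×ˢ Icc (0:ℝ) 1) := by
    refine integrableOn_of_abs_le (W := fun x y => κ x y ^ 2) (hκ.pow_const 2) (B := B ^ 2) ?_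
    intro x y
    rw [abs_pow]
    exact pow_le_pow_left₀ (abs_nonneg _) (hB x y) 2
  have hi3 : IntegrableOn (fun q : ℝ × ℝ => (κ q.1 q.2 - g (f q.1) (f q.2)) ^ 2)
      (Icc (0:ℝ) 1 ×ˢ Icc (0:ℝ) 1) := by
    refine integrableOn_of_abs_le (W := fun x y => (κ x y - g (f x) (f y)) ^ 2)
      ((Measurable.sub hκ hgm).pow_const 2) (B := (B + ∑ a, ∑ b, |g a b|) ^ 2) ?_
    intro x y
    rw [abs_pow]
    refine pow_le_pow_left₀ (abs_nonneg _) ((abs_sub _ _).trans (add_le_add (hB x y) ?_)) 2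
    exact (Finset.single_le_sum (f := fun b => |g (f x) b|) (fun _ _ => abs_nonneg _)
      (Finset.mem_univ (f y))).trans (Finset.single_le_sum (f := fun a => ∑ b, |g a b|)
        (fun _ _ => Finset.sum_nonneg fun _ _ => abs_nonneg _) (Finset.mem_univ (f x)))
  rw [setIntegral_eq_sum_cell hf.1 hi3, setIntegral_eq_sum_cell hf.1 hi2, Finset.sum_div,
    ← Finset.sum_add_distrib]
  refine Finset.sum_congr rfl fun a _ => ?_
  rw [Finset.sum_div, ← Finset.sum_add_distrib]
  refine Finset.sum_congr rfl fun b _ => ?_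
  have hsub : cell f a ×ˢ cell f b ⊆ Icc (0:ℝ) 1 ×ˢ Icc (0:ℝ) 1 :=
    prod_mono (cell_subset _ _) (cell_subset _ _)
  have hms := (measurableSet_cell hf.1 a).prod (measurableSet_cell hf.1 b)
  have hv : volume.real (cell f a ×ˢ cell f b) = 1 / (k:ℝ) ^ 2 := by
    rw [Measure.volume_eq_prod, measureReal_prod_prod, hf.volume_real, hf.volume_real]
    field_simp
  have hfin : volume (cell f a ×ˢ cell f b) ≠ ⊤ := by
    rw [Measure.volume_eq_prod, Measure.prod_prod]
    exact ENNReal.mul_ne_top (volume_ne_top_of_subset_Icc (cell_subset f a))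
      (volume_ne_top_of_subset_Icc (cell_subset f b))
  have h1 : ∫ q in cell f a ×ˢ cell f b, (κ q.1 q.2 - g (f q.1) (f q.2)) ^ 2 =
      ∫ q in cell f a ×ˢ cell f b, ((κ q.1 q.2 ^ 2 - 2 * g a b * κ q.1 q.2) + g a b ^ 2) := by
    refine setIntegral_congr_fun hms fun q hq => ?_
    have e1 : f q.1 = a := hq.1.2
    have e2 : f q.2 = b := hq.2.2
    simp only [e1, e2]
    ring
  rw [h1, integral_add, integral_sub, integral_const_mul, setIntegral_const, hv, kernelMatrix]
  · simp only [smul_eq_mul]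
    field_simp
    ring
  · exact hi2.mono_set hsub
  · exact (hi1.mono_set hsub).const_mul _
  · exact (hi2.mono_set hsub).sub ((hi1.mono_set hsub).const_mul _)
  · exact integrableOn_const hfin

theorem setIntegral_sq_sub_kernelMatrix {κ : ℝ → ℝ → ℝ} (hκ : Measurable (Function.uncurry κ))
    {B : ℝ} (hB : ∀ x y, |κ x y| ≤ B) {k : ℕ} (hk : 0 < k) {f : ℝ → Fin k}
    (hf : IsExactColouring k f) :
    ∫ q in Icc (0:ℝ) 1 ×ˢ Icc (0:ℝ) 1, (κ q.1 q.2 - kernelMatrix κ f (f q.1) (f q.2)) ^ 2 =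
      (∫ q in Icc (0:ℝ) 1 ×ˢ Icc (0:ℝ) 1, κ q.1 q.2 ^ 2) -
        (∑ a, ∑ b, kernelMatrix κ f a b ^ 2) / k ^ 2 := by
  rw [setIntegral_sq_sub_step hκ hB hk hf, sub_eq_add_neg, ← neg_div, ← Finset.sum_neg_distrib]
  congr 2
  refine Finset.sum_congr rfl fun a _ => ?_
  rw [← Finset.sum_neg_distrib]
  exact Finset.sum_congr rfl fun b _ => by ring

theorem setIntegral_sq_sub_kernelMatrix_le {κ : ℝ → ℝ → ℝ} (hκ : Measurable (Function.uncurry κ))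
    {B : ℝ} (hB : ∀ x y, |κ x y| ≤ B) {k : ℕ} (hk : 0 < k) {f : ℝ → Fin k}
    (hf : IsExactColouring k f) (g : Fin k → Fin k → ℝ) :
    ∫ q in Icc (0:ℝ) 1 ×ˢ Icc (0:ℝ) 1, (κ q.1 q.2 - kernelMatrix κ f (f q.1) (f q.2)) ^ 2 ≤
      ∫ q in Icc (0:ℝ) 1 ×ˢ Icc (0:ℝ) 1, (κ q.1 q.2 - g (f q.1) (f q.2)) ^ 2 := by
  rw [setIntegral_sq_sub_step hκ hB hk hf, setIntegral_sq_sub_step hκ hB hk hf]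
  refine add_le_add le_rfl (div_le_div_of_nonneg_right (Finset.sum_le_sum fun a _ =>
    Finset.sum_le_sum fun b _ => ?_) (by positivity))
  nlinarith [sq_nonneg (g a b - kernelMatrix κ f a b)]

theorem kernelMatrix_mem_Icc {κ : ℝ → ℝ → ℝ} {B : ℝ} (hB : ∀ x y, κ x y ∈ Icc 0 B) {k : ℕ} (hk : 0 < k) {f : ℝ → Fin k}
    (hf : IsExactColouring k f) (a b : Fin k) : kernelMatrix κ f a b ∈ Icc 0 B := by
  have hk0 : (k:ℝ) ≠ 0 := by exact_mod_cast hk.ne'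
  refine ⟨mul_nonneg (by positivity) (integral_nonneg fun q => (hB _ _).1), ?_⟩
  have hv : volume.real (cell f a ×ˢ cell f b) = 1 / (k:ℝ) ^ 2 := by
    rw [Measure.volume_eq_prod, measureReal_prod_prod, hf.volume_real, hf.volume_real]
    field_simp
  have hfin : volume (cell f a ×ˢ cell f b) < ⊤ := by
    rw [Measure.volume_eq_prod, Measure.prod_prod]
    exact ENNReal.mul_lt_top (volume_ne_top_of_subset_Icc (cell_subset f a)).lt_top
      (volume_ne_top_of_subset_Icc (cell_subset f b)).lt_top
  have h := norm_setIntegral_le_of_norm_le_const (μ := volume) (f := fun q : ℝ × ℝ => κ q.1 q.2)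
    (C := B) hfin (fun q _ => by
      rw [Real.norm_eq_abs, abs_of_nonneg (hB _ _).1]
      exact (hB _ _).2)
  rw [hv] at h
  have h2 := (le_abs_self _).trans h
  calc kernelMatrix κ f a b ≤ (k:ℝ) ^ 2 * (B * (1 / (k:ℝ) ^ 2)) := by
        unfold kernelMatrix
        gcongr
    _ = B := by field_simp

/-- Averaging over small intervals approximates a bounded kernel in `L²`. -/
theorem exists_step_approx {κ : ℝ → ℝ → ℝ} (hκ : Measurable (Function.uncurry κ)) {B : ℝ}
    (hB : ∀ x y, |κ x y| ≤ B) {η : ℝ} (hη : 0 < η) : ∃ k : ℕ, 2 ≤ k ∧ ∀ [NeZero k],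
      ∫ q in Icc (0:ℝ) 1 ×ˢ Icc (0:ℝ) 1,
        (κ q.1 q.2 - kernelMatrix κ (block k) (block k q.1) (block k q.2)) ^ 2 ≤ η := by
  set I : Set (ℝ × ℝ) := Icc (0:ℝ) 1 ×ˢ Icc (0:ℝ) 1 with hI
  have hIm : MeasurableSet I := measurableSet_Icc.prod measurableSet_Icc
  have hIv : volume I = 1 := by rw [hI, Measure.volume_eq_prod, Measure.prod_prod]; simp
  have hmem : MemLp (I.indicator fun q => κ q.1 q.2) (ENNReal.ofReal 2) volume := by
    rw [memLp_indicator_iff_restrict hIm]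
    have : IsFiniteMeasure (volume.restrict I) := ⟨by simp [hIv]⟩
    exact MemLp.of_bound hκ.aestronglyMeasurable B (ae_of_all _ fun q => hB q.1 q.2)
  obtain ⟨g, hgc, hgε, hgcont, hgL⟩ :=
    hmem.exists_hasCompactSupport_integral_rpow_sub_le (by norm_num) (show 0 < η / 4 by positivity)
  have huc := hgc.uniformContinuous_of_continuous hgcont
  have hε : 0 < √(η / 4) := Real.sqrt_pos.2 (by positivity)
  obtain ⟨δ, hδ, hd⟩ := Metric.uniformContinuous_iff.1 huc _ hε
  obtain ⟨m, hm⟩ := exists_nat_gt (1 / δ)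
  refine ⟨max m 2, le_max_right _ _, ?_⟩
  intro _
  set k := max m 2 with hk
  have hk0 : 0 < k := by omega
  have hk0' : (0:ℝ) < k := by exact_mod_cast hk0
  have hkδ : 1 / (k:ℝ) < δ := by
    rw [div_lt_comm₀ hk0' hδ]
    exact hm.trans_le (by exact_mod_cast le_max_left m 2)
  let gm : Fin k → Fin k → ℝ := fun a b => g (((a:ℝ) + 1) / k, ((b:ℝ) + 1) / k)
  refine (setIntegral_sq_sub_kernelMatrix_le hκ hB hk0 (isExactColouring_block k) gm).trans ?_
  have hclose : ∀ {x : ℝ}, x ∈ Ioc (0:ℝ) 1 → dist x (((block k x : ℝ) + 1) / k) < δ := by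
    intro x hx
    have := (block_eq_iff hx (block k x)).1 rfl
    rw [mem_Ioc] at this
    rw [Real.dist_eq, abs_sub_comm, abs_of_nonneg (by linarith [this.2])]
    have e : ((block k x : ℝ) + 1) / k - (block k x : ℝ) / k = 1 / k := by ring
    linarith [this.1]
  have hInt : IntegrableOn (fun q : ℝ × ℝ => (κ q.1 q.2 - g q) ^ 2) I := by
    have h2 : MemLp (fun q : ℝ × ℝ => κ q.1 q.2 - g q) 2 (volume.restrict I) := by
      have e1 := (memLp_indicator_iff_restrict hIm).1 hmem
      have e2 := hgL.restrict I
      have e3 := e1.sub e2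
      rwa [ENNReal.ofReal_ofNat] at e3
    exact h2.integrable_sq
  have h1 : ∫ q in I, (κ q.1 q.2 - g q) ^ 2 ≤ η / 4 := by
    refine le_trans ?_ hgε
    have e : ∫ q in I, (κ q.1 q.2 - g q) ^ 2 =
        ∫ q in I, ‖I.indicator (fun q => κ q.1 q.2) q - g q‖ ^ (2:ℝ) := by
      refine setIntegral_congr_fun hIm fun q hq => ?_
      simp only [indicator_of_mem hq]
      norm_num
    rw [e]
    refine setIntegral_le_integral ?_ (ae_of_all _ fun q => by positivity)
    have := (hmem.sub hgL).integrable_norm_rpow (by norm_num) (by norm_num)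
    simpa using this
  calc ∫ q in I, (κ q.1 q.2 - gm (block k q.1) (block k q.2)) ^ 2
      ≤ ∫ q in I, (2 * (κ q.1 q.2 - g q) ^ 2 + η / 2) := by
        refine integral_mono_of_nonneg (ae_of_all _ fun q => by positivity)
          ((hInt.const_mul 2).add (integrableOn_const (by simp [hIv]))) ?_
        filter_upwards [ae_mem_Ioc_prod] with q hq
        have hdist := hd (a := q) (b := (((block k q.1 : ℝ) + 1) / k, ((block k q.2 : ℝ) + 1) / k))
          (max_lt (hclose hq.1) (hclose hq.2))
        have h3 : (g q - gm (block k q.1) (block k q.2)) ^ 2 ≤ η / 4 := by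
          rw [Real.dist_eq] at hdist
          have := pow_le_pow_left₀ (abs_nonneg _) hdist.le 2
          rwa [sq_abs, Real.sq_sqrt (by positivity)] at this
        nlinarith [sq_nonneg ((κ q.1 q.2 - g q) - (g q - gm (block k q.1) (block k q.2)))]
    _ = 2 * (∫ q in I, (κ q.1 q.2 - g q) ^ 2) + η / 2 := by
        rw [integral_add (hInt.const_mul 2) (integrableOn_const (by simp [hIv])),
          integral_const_mul, setIntegral_const, measureReal_def, hIv]
        simp
    _ ≤ η := by linarith

theorem sum_adjWeight {n : ℕ} (p : ℝ) (G : SimpleGraph (Fin n)) (A B : Finset (Fin n)) :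
    ∑ u ∈ A, ∑ v ∈ B, adjWeight p G u v = ePairs G A B / p := by
  rw [← Finset.sum_product' (f := fun u v => adjWeight p G u v)]
  simp only [adjWeight, ← Finset.sum_filter]
  rw [Finset.sum_const, ePairs, nsmul_eq_mul, mul_one_div]

theorem dDens_mul_card {n : ℕ} (p : ℝ) (G : SimpleGraph (Fin n)) (A B : Finset (Fin n)) :
    dDens p G A B * (A.card * B.card) = ePairs G A B / p := by
  by_cases hA : A.card = 0
  · simp [dDens, ePairs, Finset.card_eq_zero.1 hA]
  by_cases hB : B.card = 0
  · simp [dDens, ePairs, Finset.card_eq_zero.1 hB]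
  by_cases hp : p = 0
  · simp [dDens, hp]
  have hA' : (A.card : ℝ) ≠ 0 := by exact_mod_cast hA
  have hB' : (B.card : ℝ) ≠ 0 := by exact_mod_cast hB
  rw [dDens]
  field_simp

theorem dDens_nonneg {n : ℕ} {p : ℝ} (hp : 0 ≤ p) (G : SimpleGraph (Fin n))
    (A B : Finset (Fin n)) : 0 ≤ dDens p G A B := by
  unfold dDens
  positivity

theorem isBlockAverage_adjWeight {n k : ℕ} (p : ℝ) (G : SimpleGraph (Fin n)) (c : Fin n → Fin k) :
    IsBlockAverage (adjWeight p G) c fun a b => dDens p G (fiber c a) (fiber c b) := by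
  intro a b
  rw [sum_adjWeight]
  convert (dDens_mul_card p G (fiber c a) (fiber c b)).symm <;> (ext u; simp [fiber])

theorem setIntegral_graphKernel {n : ℕ} [NeZero n] (p : ℝ) (G : SimpleGraph (Fin n))
    {S T : Set ℝ} (hS : S ⊆ Icc 0 1) (hT : T ⊆ Icc 0 1) :
    ∫ q in S ×ˢ T, graphKernel p G q.1 q.2 = ∑ u, ∑ v, adjWeight p G u v *
      (volume.real (S ∩ block n ⁻¹' {u}) * volume.real (T ∩ block n ⁻¹' {v})) := by
  rw [setIntegral_congr_of_ae_Icc (W' := fun x y => adjWeight p G (block n x) (block n y))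
    (graphKernel_ae_eq p G) hS hT]
  exact setIntegral_comp_finite (measurable_block n) _ (volume_ne_top_of_subset_Icc hS)
    (volume_ne_top_of_subset_Icc hT)

theorem integrableOn_graphKernel {n : ℕ} [NeZero n] (p : ℝ) (G : SimpleGraph (Fin n)) :
    IntegrableOn (fun q : ℝ × ℝ => graphKernel p G q.1 q.2) (Icc (0:ℝ) 1 ×ˢ Icc (0:ℝ) 1) := by
  refine Integrable.congr ?_ ((graphKernel_ae_eq p G).mono fun q hq => hq.symm)
  refine integrableOn_of_abs_le (W := fun x y => adjWeight p G (block n x) (block n y))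
    (B := |1 / p|) ?_ ?_
  · exact (measurable_of_finite fun i : Fin n × Fin n => adjWeight p G i.1 i.2).comp
      (((measurable_block n).comp measurable_fst).prodMk
        ((measurable_block n).comp measurable_snd))
  · intro x y
    unfold adjWeight
    split_ifs
    · exact le_rfl
    · rw [abs_zero]; exact abs_nonneg _

theorem volume_real_cell_inter_block {n : ℕ} [NeZero n] {ι : Type*} [DecidableEq ι] (c : Fin n → ι) (a : ι)
    (u : Fin n) : volume.real (cell (c ∘ block n) a ∩ block n ⁻¹' {u}) =
      if c u = a then 1 / (n:ℝ) else 0 := by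
  split_ifs with h
  · rw [← volume_real_block n u]
    congr 1
    ext x
    simp only [cell, mem_inter_iff, mem_preimage, mem_singleton_iff, Function.comp]
    exact ⟨fun hx => ⟨hx.1.1, hx.2⟩, fun hx => ⟨⟨hx.1, hx.2 ▸ h⟩, hx.2⟩⟩
  · have : cell (c ∘ block n) a ∩ block n ⁻¹' {u} = ∅ := by
      ext x
      simp only [cell, mem_inter_iff, mem_preimage, mem_singleton_iff, Function.comp,
        mem_empty_iff_false, iff_false]
      rintro ⟨hx, rfl⟩
      exact h hx.2
    rw [this, measureReal_empty]

theorem setIntegral_cell_graphKernel {n k : ℕ} [NeZero n] (p : ℝ) (G : SimpleGraph (Fin n))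
    (c : Fin n → Fin k) (a b : Fin k) :
    ∫ q in cell (c ∘ block n) a ×ˢ cell (c ∘ block n) b, graphKernel p G q.1 q.2 =
      dDens p G (fiber c a) (fiber c b) *
        (((fiber c a).card / (n:ℝ)) * ((fiber c b).card / (n:ℝ))) := by
  rw [setIntegral_graphKernel p G (cell_subset _ _) (cell_subset _ _)]
  simp only [volume_real_cell_inter_block]
  have h : ∀ u v, adjWeight p G u v * ((if c u = a then 1 / (n:ℝ) else 0) *
      (if c v = b then 1 / (n:ℝ) else 0)) =
      if c u = a then (if c v = b then adjWeight p G u v / (n:ℝ) ^ 2 else 0) else 0 := by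
    intro u v
    split_ifs <;> ring
  simp only [h]
  have h2 : ∀ u, (∑ v, if c u = a then (if c v = b then adjWeight p G u v / (n:ℝ) ^ 2 else 0)
      else 0) = if c u = a then ∑ v ∈ fiber c b, adjWeight p G u v / (n:ℝ) ^ 2 else 0 := by
    intro u
    split_ifs
    · rw [fiber, Finset.sum_filter]
    · simp
  simp only [h2]
  rw [← Finset.sum_filter]
  simp only [← Finset.sum_div]
  rw [show (Finset.univ.filter fun u => c u = a) = fiber c a from rfl, sum_adjWeight,
    ← dDens_mul_card]
  ring

theorem volume_real_block_preimage {n : ℕ} [NeZero n] (P : Finset (Fin n)) :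
    volume.real (Icc 0 1 ∩ block n ⁻¹' (P : Set (Fin n))) = P.card / n := by
  have : Icc 0 1 ∩ block n ⁻¹' (P : Set (Fin n)) = ⋃ u ∈ P, cell (block n) u := by
    ext x
    simp [cell]
  rw [this, measureReal_biUnion_finset (fun u _ v _ huv => disjoint_cell _ huv)
    (fun u _ => measurableSet_cell (measurable_block n) u)
    (fun u _ => volume_ne_top_of_subset_Icc (cell_subset _ _))]
  have hcell : ∀ u, volume.real (cell (block n) u) = 1 / n := volume_real_block n
  simp only [hcell]
  simp [div_eq_mul_inv]

theorem volume_real_block_ne_intervalColouring_le (n k : ℕ) [NeZero n] [NeZero k] :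
    volume.real (Icc 0 1 ∩ {x | block k x ≠ intervalColouring n k (block n x)}) ≤ k / n := by
  have hn : (0:ℝ) < n := by exact_mod_cast Nat.pos_of_ne_zero (NeZero.ne n)
  have hn' : 0 < n := Nat.pos_of_ne_zero (NeZero.ne n)
  have hk : (0:ℝ) < k := by exact_mod_cast Nat.pos_of_ne_zero (NeZero.ne k)
  rw [measureReal_congr (Icc_inter_ae_eq_Ioc_inter _)]
  have hsub : Ioc 0 1 ∩ {x | block k x ≠ intervalColouring n k (block n x)} ⊆
      ⋃ a : Fin k, Ioc ((a:ℝ) / k) ((a:ℝ) / k + 1 / n) := by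
    rintro x ⟨hx, hne⟩
    have h1 := (block_eq_iff hx (block k x)).1 rfl
    have h2 := (block_eq_iff hx (block n x)).1 rfl
    rw [mem_Ioc, div_lt_iff₀ hk, le_div_iff₀ hk] at h1
    rw [mem_Ioc, div_lt_iff₀ hn, le_div_iff₀ hn] at h2
    refine mem_iUnion.2 ⟨block k x, by rw [div_lt_iff₀ hk]; exact h1.1, ?_⟩
    set u := block n x
    set a := block k x
    have hv := intervalColouring_val (k := k) u
    have hlt : (u:ℕ) * k < (a + 1) * n := by
      have : (u:ℝ) * k < (a + 1) * n := by nlinarith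
      exact_mod_cast this
    have hba : (u:ℕ) * k / n < a := by
      have : (u:ℕ) * k / n < a + 1 := (Nat.div_lt_iff_lt_mul hn').2 hlt
      have hne' : (u:ℕ) * k / n ≠ a := fun h => hne (Fin.ext (by rw [hv, h]))
      omega
    have h3 : (u:ℕ) * k < a * n := (Nat.div_lt_iff_lt_mul hn').1 hba
    have h3' : (u:ℝ) * k < a * n := by exact_mod_cast h3
    have h4 : (u:ℝ) / n < a / k := by rw [div_lt_div_iff₀ hn hk]; exact h3'
    have h5 : x ≤ ((u:ℝ) + 1) / n := by rw [le_div_iff₀ hn]; exact h2.2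
    rw [add_div] at h5
    linarith
  calc _ ≤ volume.real (⋃ a : Fin k, Ioc ((a:ℝ) / k) ((a:ℝ) / k + 1 / n)) :=
        measureReal_mono hsub (ne_of_lt ((measure_iUnion_le _).trans_lt (by
          rw [tsum_fintype]; exact ENNReal.sum_lt_top.2 fun a _ => by simp)))
    _ ≤ ∑ a : Fin k, volume.real (Ioc ((a:ℝ) / k) ((a:ℝ) / k + 1 / n)) :=
        measureReal_iUnion_fintype_le _
    _ = k / n := by simp [Real.volume_real_Ioc, hn.le, div_eq_mul_inv]

theorem volume_real_mismatch_le {n k : ℕ} [NeZero n] [NeZero k] (c : Fin n → Fin k)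
    (σ : Equiv.Perm (Fin n)) :
    volume.real (Icc 0 1 ∩ {x | block k (blockExchange σ x) ≠ c (block n x)}) ≤
      (k + (Finset.univ.filter fun v => intervalColouring n k (σ v) ≠ c v).card) / n := by
  set P := Finset.univ.filter fun v => intervalColouring n k (σ v) ≠ c v with hP
  set E := {x | block k x ≠ intervalColouring n k (block n x)} with hE
  have hEm : MeasurableSet E := (measurableSet_eq_fun (measurable_block k)
    ((measurable_of_finite (intervalColouring n k)).comp (measurable_block n))).compl
  have hmp := mpBij_blockExchange σ
  have h1 : volume.real (Icc 0 1 ∩ blockExchange σ ⁻¹' E) = volume.real (Icc 0 1 ∩ E) := by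
    have := hmp.1.measure_preimage hEm.nullMeasurableSet
    rw [Measure.restrict_apply (hmp.1.measurable hEm), Measure.restrict_apply hEm] at this
    rw [inter_comm, inter_comm _ E, measureReal_def, measureReal_def, this]
  rw [add_div, ← volume_real_block_preimage P]
  refine le_trans ?_ (add_le_add_left (volume_real_block_ne_intervalColouring_le n k) _)
  rw [← h1, measureReal_congr (Icc_inter_ae_eq_Ioc_inter _)]
  refine le_trans (measureReal_mono ?_ ?_) (measureReal_union_le _ _)
  · rintro x ⟨hx, hne⟩
    by_cases hxE : blockExchange σ x ∈ E
    · exact Or.inl ⟨Ioc_subset_Icc_self hx, hxE⟩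
    · refine Or.inr ⟨Ioc_subset_Icc_self hx, ?_⟩
      have h2 : block k (blockExchange σ x) =
          intervalColouring n k (block n (blockExchange σ x)) := not_not.1 hxE
      rw [(blockExchange_mem σ hx).2] at h2
      simp only [hP, Finset.coe_filter, Finset.mem_univ, true_and, mem_preimage]
      intro h3
      exact hne (h2.trans h3)
  · exact volume_ne_top_of_subset_Icc (union_subset inter_subset_left inter_subset_left)

theorem abs_apply_sub_apply_le_dist {k : ℕ} (M N : Fin k → Fin k → ℝ) (a b : Fin k) :
    |M a b - N a b| ≤ dist M N := by
  rw [← Real.dist_eq]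
  exact (dist_le_pi_dist (M a) (N a) b).trans (dist_le_pi_dist M N a)

theorem hausdorffEDist_MsetG_MsetK_ne_top {n k : ℕ} [NeZero k] (hkn : k ≤ n) (p : ℝ)
    (G : SimpleGraph (Fin n)) {κ : ℝ → ℝ → ℝ} {B : ℝ} (hB : ∀ x y, κ x y ∈ Icc 0 B) :
    Metric.hausdorffEDist (MsetG k p G) (MsetK k κ) ≠ ⊤ := by
  have hk : 0 < k := Nat.pos_of_ne_zero (NeZero.ne k)
  have hB0 : 0 ≤ B := (hB 0 0).1.trans (hB 0 0).2
  refine Metric.hausdorffEDist_ne_top_of_nonempty_of_bounded ?_ ?_ ?_ ?_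
  · have := isBalanced_intervalColouring_comp hkn (Equiv.refl (Fin n))
    exact ⟨_, _, this.1, this.2, rfl⟩
  · rw [MsetK_eq_closure hk]
    exact ⟨_, subset_closure ⟨block k, isExactColouring_block k, rfl⟩⟩
  · refine ((Set.finite_range fun c : Fin n → Fin k => fun a b =>
      dDens p G (fiber c a) (fiber c b)).subset ?_).isBounded
    rintro M ⟨c, -, -, rfl⟩
    exact ⟨c, rfl⟩
  · rw [MsetK_eq_closure hk]
    refine Bornology.IsBounded.closure ((Metric.isBounded_closedBall (x := 0) (r := B)).subset ?_)
    rintro M ⟨f, hf, rfl⟩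
    rw [Metric.mem_closedBall, dist_pi_le_iff hB0]
    intro a
    rw [dist_pi_le_iff hB0]
    intro b
    have := kernelMatrix_mem_Icc hB hk hf a b
    rw [Real.dist_eq, Pi.zero_apply, Pi.zero_apply, sub_zero, abs_of_nonneg this.1]
    exact this.2

theorem exists_colouring_near {n k : ℕ} [NeZero k] (hkn : k ≤ n) (p : ℝ)
    (G : SimpleGraph (Fin n)) {κ : ℝ → ℝ → ℝ} {B : ℝ} (hB : ∀ x y, κ x y ∈ Icc 0 B) {δ : ℝ}
    (h : Metric.hausdorffDist (MsetG k p G) (MsetK k κ) < δ) {c : Fin n → Fin k}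
    (hc : IsBalanced c) : ∃ f, IsExactColouring k f ∧
      ∀ a b, |dDens p G (fiber c a) (fiber c b) - kernelMatrix κ f a b| ≤ δ := by
  have hmem : (fun a b => dDens p G (fiber c a) (fiber c b)) ∈ MsetG k p G :=
    ⟨c, hc.1, hc.2, rfl⟩
  obtain ⟨N, hN, hd⟩ := Metric.exists_dist_lt_of_hausdorffDist_lt hmem h
    (hausdorffEDist_MsetG_MsetK_ne_top hkn p G hB)
  rw [MsetK_eq_closure (Nat.pos_of_ne_zero (NeZero.ne k))] at hN
  obtain ⟨_, ⟨f, hf, rfl⟩, hd'⟩ := Metric.mem_closure_iff.1 hN _ (sub_pos.2 hd)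
  refine ⟨f, hf, fun a b => ?_⟩
  have h1 := abs_apply_sub_apply_le_dist (fun a b => dDens p G (fiber c a) (fiber c b))
    (kernelMatrix κ f) a b
  have h2 := dist_triangle (fun a b => dDens p G (fiber c a) (fiber c b)) N (kernelMatrix κ f)
  linarith

theorem exists_isBalanced_near {n k : ℕ} [NeZero k] (hkn : k ≤ n) (p : ℝ)
    (G : SimpleGraph (Fin n)) {κ : ℝ → ℝ → ℝ} {B : ℝ} (hB : ∀ x y, κ x y ∈ Icc 0 B) {δ : ℝ}
    (h : Metric.hausdorffDist (MsetG k p G) (MsetK k κ) < δ) {f : ℝ → Fin k}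
    (hf : IsExactColouring k f) : ∃ c : Fin n → Fin k, IsBalanced c ∧
      ∀ a b, |dDens p G (fiber c a) (fiber c b) - kernelMatrix κ f a b| ≤ δ := by
  obtain ⟨M, ⟨c, hc1, hc2, rfl⟩, hd⟩ := Metric.exists_dist_lt_of_hausdorffDist_lt'
    (y := kernelMatrix κ f) (by
      rw [MsetK_eq_closure (Nat.pos_of_ne_zero (NeZero.ne k))]
      exact subset_closure ⟨f, hf, rfl⟩) h (hausdorffEDist_MsetG_MsetK_ne_top hkn p G hB)
  exact ⟨c, ⟨hc1, hc2⟩, fun a b => (abs_apply_sub_apply_le_dist _ _ a b).trans hd.le⟩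

/-- The energy of a balanced colouring is close to the mean square of a nearby matrix. -/
theorem abs_energy_sub_le {n k : ℕ} [NeZero n] [NeZero k] {c : Fin n → Fin k} (hc : IsBalanced c)
    {X M : Fin k → Fin k → ℝ} {B δ : ℝ} (hX : ∀ a b, X a b ∈ Icc 0 B)
    (hM : ∀ a b, M a b ∈ Icc 0 B) (h : ∀ a b, |X a b - M a b| ≤ δ) :
    |(∑ u, ∑ v, X (c u) (c v) ^ 2) / (n:ℝ) ^ 2 - (∑ a, ∑ b, M a b ^ 2) / (k:ℝ) ^ 2| ≤
      2 * k ^ 2 * B ^ 2 / n + 2 * B * δ := by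
  have hn : (0:ℝ) < n := by exact_mod_cast Nat.pos_of_ne_zero (NeZero.ne n)
  have hk : (0:ℝ) < k := by exact_mod_cast Nat.pos_of_ne_zero (NeZero.ne k)
  have hk1 : (1:ℝ) ≤ k := by exact_mod_cast Nat.pos_of_ne_zero (NeZero.ne k)
  set w : Fin k → ℝ := fun a => (fiber c a).card / n with hw
  have hw01 : ∀ a, w a ∈ Icc (0:ℝ) 1 := fun a => by
    refine ⟨by positivity, ?_⟩
    rw [hw, div_le_one hn]
    exact_mod_cast (Finset.card_le_univ _).trans_eq (Fintype.card_fin n)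
  have e1 : (∑ u, ∑ v, X (c u) (c v) ^ 2) / (n:ℝ) ^ 2 = ∑ a, ∑ b, X a b ^ 2 * (w a * w b) := by
    have h1 : ∀ u, ∑ v, X (c u) (c v) ^ 2 = ∑ b, X (c u) b ^ 2 * (fiber c b).card := fun u => by
      rw [← Finset.sum_fiberwise Finset.univ c]
      refine Finset.sum_congr rfl fun b _ => ?_
      rw [Finset.sum_congr rfl fun v hv => by rw [(Finset.mem_filter.1 hv).2], Finset.sum_const,
        nsmul_eq_mul, mul_comm]
      rfl
    have h2 : ∑ u, ∑ v, X (c u) (c v) ^ 2 =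
        ∑ a, (∑ b, X a b ^ 2 * (fiber c b).card) * (fiber c a).card := by
      simp only [h1]
      rw [← Finset.sum_fiberwise Finset.univ c]
      refine Finset.sum_congr rfl fun a _ => ?_
      rw [Finset.sum_congr rfl fun v hv => by rw [(Finset.mem_filter.1 hv).2], Finset.sum_const,
        nsmul_eq_mul, mul_comm]
      rfl
    rw [h2, Finset.sum_div]
    refine Finset.sum_congr rfl fun a _ => ?_
    rw [Finset.sum_mul, Finset.sum_div]
    refine Finset.sum_congr rfl fun b _ => ?_
    simp only [hw]
    field_simp
  have e2 : (∑ a, ∑ b, M a b ^ 2) / (k:ℝ) ^ 2 = ∑ a, ∑ b, M a b ^ 2 * (1 / k * (1 / k)) := by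
    simp only [Finset.sum_div]
    refine Finset.sum_congr rfl fun a _ => Finset.sum_congr rfl fun b _ => ?_
    field_simp
  have hterm : ∀ a b, |X a b ^ 2 * (w a * w b) - M a b ^ 2 * (1 / k * (1 / k))| ≤
      2 * B ^ 2 / n + 2 * B * δ / k ^ 2 := by
    intro a b
    have hX' := hX a b
    have hM' := hM a b
    have hB0 : 0 ≤ B := hX'.1.trans hX'.2
    have i1 : |w a * w b - 1 / k * (1 / k)| ≤ 2 / n := by
      have j1 := hc.abs_card_div_sub_le a
      have j2 := hc.abs_card_div_sub_le b
      have : w a * w b - 1 / k * (1 / k) = (w a - 1 / k) * w b + 1 / k * (w b - 1 / k) := by ring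
      rw [this]
      refine (abs_add_le _ _).trans ?_
      rw [abs_mul, abs_mul, abs_of_nonneg (hw01 b).1, abs_of_pos (show (0:ℝ) < 1 / k by positivity)]
      have k1 : |w a - 1 / k| * w b ≤ 1 / n * 1 :=
        mul_le_mul j1 (hw01 b).2 (hw01 b).1 (by positivity)
      have k2 : 1 / (k:ℝ) * |w b - 1 / k| ≤ 1 * (1 / n) :=
        mul_le_mul ((div_le_one hk).2 hk1) j2 (abs_nonneg _) zero_le_one
      calc _ ≤ 1 / (n:ℝ) * 1 + 1 * (1 / n) := add_le_add k1 k2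
        _ = 2 / n := by ring
    have i2 : |X a b ^ 2 - M a b ^ 2| ≤ 2 * B * δ := by
      have : X a b ^ 2 - M a b ^ 2 = (X a b + M a b) * (X a b - M a b) := by ring
      rw [this, abs_mul, abs_of_nonneg (add_nonneg hX'.1 hM'.1)]
      exact mul_le_mul (by linarith [hX'.2, hM'.2]) (h a b) (abs_nonneg _) (by positivity)
    have : X a b ^ 2 * (w a * w b) - M a b ^ 2 * (1 / k * (1 / k)) =
        X a b ^ 2 * (w a * w b - 1 / k * (1 / k)) + (X a b ^ 2 - M a b ^ 2) / k ^ 2 := by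
      field_simp
      ring
    rw [this]
    refine (abs_add_le _ _).trans (add_le_add ?_ ?_)
    · rw [abs_mul, abs_of_nonneg (sq_nonneg _)]
      calc _ ≤ B ^ 2 * (2 / n) := mul_le_mul (pow_le_pow_left₀ hX'.1 hX'.2 2) i1
            (abs_nonneg _) (by positivity)
        _ = _ := by ring
    · rw [abs_div, abs_of_pos (show (0:ℝ) < (k:ℝ) ^ 2 by positivity)]
      gcongr
  rw [e1, e2, ← Finset.sum_sub_distrib]
  calc _ ≤ ∑ _a : Fin k, ∑ _b : Fin k, (2 * B ^ 2 / n + 2 * B * δ / k ^ 2) := by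
        refine (Finset.abs_sum_le_sum_abs _ _).trans (Finset.sum_le_sum fun a _ => ?_)
        rw [← Finset.sum_sub_distrib]
        exact (Finset.abs_sum_le_sum_abs _ _).trans (Finset.sum_le_sum fun b _ => hterm a b)
    _ = _ := by
        simp only [Finset.sum_const, Finset.card_univ, Fintype.card_fin, nsmul_eq_mul]
        field_simp

/-- If all balanced `K`-colourings have matrices close to those of `κ`, then a `k`-colouring
whose matrix is close to a good step approximation of `κ` is weakly regular. -/
theorem abs_sum_adjWeight_sub_le {n k K : ℕ} [NeZero n] [NeZero k] [NeZero K] (hKn : K ≤ n)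
    {p : ℝ} (hp : 0 < p) (G : SimpleGraph (Fin n)) {κ : ℝ → ℝ → ℝ}
    (hκ : Measurable (Function.uncurry κ)) {B : ℝ} (hB : ∀ x y, κ x y ∈ Icc 0 B) {η δ : ℝ}
    (hδ1 : δ ≤ 1) {c : Fin n → Fin k} (hc : IsBalanced c) {f : ℝ → Fin k}
    (hf : IsExactColouring k f)
    (hcf : ∀ a b, |dDens p G (fiber c a) (fiber c b) - kernelMatrix κ f a b| ≤ δ)
    (hη : ∫ q in Icc (0:ℝ) 1 ×ˢ Icc (0:ℝ) 1,
        (κ q.1 q.2 - kernelMatrix κ f (f q.1) (f q.2)) ^ 2 ≤ η)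
    (hK : ∀ c' : Fin n → Fin K, IsBalanced c' → ∃ f', IsExactColouring K f' ∧
      ∀ a b, |dDens p G (fiber c' a) (fiber c' b) - kernelMatrix κ f' a b| ≤ δ)
    (S T : Finset (Fin n)) :
    |∑ u ∈ S, ∑ v ∈ T, (adjWeight p G u v - dDens p G (fiber c (c u)) (fiber c (c v)))| / n ^ 2 ≤
      4 * (B + 1) * (4 * k / K + 4 * k / n) +
        √(η + 2 * k ^ 2 * (B + 1) ^ 2 / n + 2 * K ^ 2 * (B + 1) ^ 2 / n + 4 * (B + 1) * δ +
          8 * (B + 1) ^ 2 * (4 * k / K + 4 * k / n)) := by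
  have hn : (0:ℝ) < n := by exact_mod_cast Nat.pos_of_ne_zero (NeZero.ne n)
  have hk : 0 < k := Nat.pos_of_ne_zero (NeZero.ne k)
  have hK0 : 0 < K := Nat.pos_of_ne_zero (NeZero.ne K)
  have hK0' : (0:ℝ) < K := by exact_mod_cast hK0
  have hB' : ∀ x y, |κ x y| ≤ B := fun x y => by rw [abs_of_nonneg (hB x y).1]; exact (hB x y).2
  have hB0 : 0 ≤ B := (hB 0 0).1.trans (hB 0 0).2
  set ζ : ℝ := 4 * k / K + 4 * k / n with hζdef
  let e := Fintype.equivFin (Fin k × Bool × Bool)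
  let r : Fin n → Fin (Fintype.card (Fin k × Bool × Bool)) := fun v =>
    e (c v, decide (v ∈ S), decide (v ∈ T))
  obtain ⟨σ, s, bad, hbad, hs⟩ := exists_interval_refinement r K
  have hbad' : bad.card ≤ 4 * k := by
    refine hbad.trans_eq ?_
    simp only [Fintype.card_prod, Fintype.card_fin, Fintype.card_bool]
    ring
  set c' := intervalColouring n K ∘ σ with hc'def
  have hc' : IsBalanced c' := isBalanced_intervalColouring_comp hKn σ
  obtain ⟨f', hf', hcf'⟩ := hK c' hc'
  have hm1 : ∀ {m : ℕ} {g : ℝ → Fin m} {d : Fin n → Fin m}, 0 < m → IsExactColouring m g →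
      (∀ a b, |dDens p G (fiber d a) (fiber d b) - kernelMatrix κ g a b| ≤ δ) →
      ∀ a b, dDens p G (fiber d a) (fiber d b) ∈ Icc 0 (B + 1) ∧
        kernelMatrix κ g a b ∈ Icc 0 (B + 1) := by
    intro m g d hm hg hd a b
    have h1 := kernelMatrix_mem_Icc hB hm hg a b
    have h2 := abs_le.1 (hd a b)
    exact ⟨⟨dDens_nonneg hp.le _ _ _, by linarith [h1.2, h2.2]⟩, ⟨h1.1, by linarith [h1.2]⟩⟩
  have hX := hm1 hk hf hcf
  have hY := hm1 hK0 hf' hcf'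
  have hζ : ((Finset.univ.filter fun v => c' v ∈ bad).card : ℝ) ≤ ζ * Fintype.card (Fin n) := by
    have h1 : (Finset.univ.filter fun v => c' v ∈ bad) = bad.biUnion fun a => fiber c' a := by
      ext v; simp [fiber]
    have h2 : ∀ a ∈ bad, ((fiber c' a).card : ℝ) ≤ n / K + 1 := fun a _ => by
      have : (K : ℝ) * (fiber c' a).card ≤ n + K := by exact_mod_cast (hc'.card_fiber a).1
      rw [← sub_le_iff_le_add, le_div_iff₀ hK0']
      linarith
    calc ((Finset.univ.filter fun v => c' v ∈ bad).card : ℝ)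
        ≤ ∑ a ∈ bad, ((fiber c' a).card : ℝ) := by
          rw [h1]
          exact_mod_cast Finset.card_biUnion_le
      _ ≤ ∑ _a ∈ bad, ((n:ℝ) / K + 1) := Finset.sum_le_sum h2
      _ = bad.card * ((n:ℝ) / K + 1) := by rw [Finset.sum_const, nsmul_eq_mul]
      _ ≤ (4 * k) * ((n:ℝ) / K + 1) := by
          gcongr
          exact_mod_cast hbad'
      _ = ζ * Fintype.card (Fin n) := by
          rw [Fintype.card_fin, hζdef]
          field_simp
  have hζ0 : 0 ≤ ζ := by positivity
  set D := |∑ u ∈ S, ∑ v ∈ T, (adjWeight p G u v -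
    dDens p G (fiber c (c u)) (fiber c (c v)))| / (n:ℝ) ^ 2 with hDdef
  rcases le_total D (4 * (B + 1) * ζ) with hle | hge
  · exact hle.trans (le_add_of_nonneg_right (Real.sqrt_nonneg _))
  have hinc := energy_increment (A := adjWeight p G) (fun u v => by
      unfold adjWeight
      split_ifs <;> positivity)
    (isBlockAverage_adjWeight p G c) (B := B + 1) (fun a b => (hX a b).1.1)
    (fun a b => (hX a b).1.2) (isBlockAverage_adjWeight p G c') (fun a b => (hY a b).1.1)
    (fun a b => (hY a b).1.2) r (fun x => (e.symm x).1) (fun v => by simp [r]) s bad hs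
    (fun x => (e.symm x).2.1 = true) (fun x => (e.symm x).2.2 = true) (by convert hζ) (D := D) (by
      simp only [r, Equiv.symm_apply_apply, decide_eq_true_eq, hDdef, Fintype.card_fin,
        Finset.filter_mem_eq_inter, Finset.univ_inter]
      ) hge
  rw [Fintype.card_fin] at hinc
  have hE1 := abs_le.1 (abs_energy_sub_le hc (fun a b => (hX a b).1) (fun a b => (hX a b).2) hcf)
  have hE2 := abs_le.1 (abs_energy_sub_le hc' (fun a b => (hY a b).1) (fun a b => (hY a b).2) hcf')
  rw [setIntegral_sq_sub_kernelMatrix hκ hB' hk hf] at hη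
  have hE3 := (integral_nonneg (μ := volume.restrict (Icc (0:ℝ) 1 ×ˢ Icc (0:ℝ) 1)) fun q : ℝ × ℝ =>
    sq_nonneg (κ q.1 q.2 - kernelMatrix κ f' (f' q.1) (f' q.2))).trans_eq
    (setIntegral_sq_sub_kernelMatrix hκ hB' hK0 hf')
  have hfin := Real.le_sqrt_of_sq_le (hinc.trans (b := _) (c := η + 2 * k ^ 2 * (B + 1) ^ 2 / n +
    2 * K ^ 2 * (B + 1) ^ 2 / n + 4 * (B + 1) * δ + 8 * (B + 1) ^ 2 * ζ)
    (by linarith [hE1.1, hE1.2, hE2.1, hE2.2]))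
  linarith

theorem abs_volume_real_inter_preimage_sub_le {ι : Type*} {f g : ℝ → ι} {S : Set ℝ}
    (hS : S ⊆ Icc 0 1) (a : ι) :
    |volume.real (S ∩ f ⁻¹' {a}) - volume.real (S ∩ g ⁻¹' {a})| ≤
      volume.real (Icc 0 1 ∩ {x | f x ≠ g x}) := by
  have key : ∀ {f g : ℝ → ι}, volume.real (S ∩ f ⁻¹' {a}) ≤
      volume.real (S ∩ g ⁻¹' {a}) + volume.real (Icc 0 1 ∩ {x | f x ≠ g x}) := by
    intro f g
    refine le_trans (measureReal_mono ?_ ?_) (measureReal_union_le _ _)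
    · rintro x ⟨hx, hxa⟩
      by_cases h : f x = g x
      · exact Or.inl ⟨hx, h.symm.trans hxa⟩
      · exact Or.inr ⟨hS hx, h⟩
    · exact volume_ne_top_of_subset_Icc
        (union_subset (inter_subset_left.trans hS) inter_subset_left)
  have h1 := key (f := f) (g := g)
  have h2 := key (f := g) (g := f)
  simp only [ne_comm (a := g _)] at h2
  exact abs_le.2 ⟨by linarith, by linarith⟩

theorem measurable_step {ι : Type*} [Finite ι] [MeasurableSpace ι] [MeasurableSingletonClass ι]
    (M : ι → ι → ℝ) {f : ℝ → ι} (hf : Measurable f) :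
    Measurable (Function.uncurry fun x y => M (f x) (f y)) := by
  have h1 : Measurable (Function.uncurry M) := measurable_of_finite _
  have h2 : Measurable fun q : ℝ × ℝ => (f q.1, f q.2) := by fun_prop
  exact h1.comp h2

theorem volume_real_mem_Icc {S : Set ℝ} (hS : S ⊆ Icc 0 1) : volume.real S ∈ Icc (0:ℝ) 1 := by
  refine ⟨measureReal_nonneg, ?_⟩
  have := measureReal_mono (μ := volume) hS (by simp)
  simpa using this

/-- Step kernels with nearby matrices and nearby colourings have nearby integrals. -/
theorem abs_setIntegral_step_sub_le {k : ℕ} {f g : ℝ → Fin k} (hf : Measurable f)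
    (hg : Measurable g) {X M : Fin k → Fin k → ℝ} {B δ : ℝ} (hδ : 0 ≤ δ)
    (hM : ∀ a b, |M a b| ≤ B) (hXM : ∀ a b, |X a b - M a b| ≤ δ) {S T : Set ℝ}
    (hS : S ⊆ Icc 0 1) (hT : T ⊆ Icc 0 1) :
    |(∫ q in S ×ˢ T, X (f q.1) (f q.2)) - ∫ q in S ×ˢ T, M (g q.1) (g q.2)| ≤
      k ^ 2 * (δ + 2 * B * volume.real (Icc 0 1 ∩ {x | f x ≠ g x})) := by
  rw [setIntegral_comp_finite hf _ (volume_ne_top_of_subset_Icc hS) (volume_ne_top_of_subset_Icc hT),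
    setIntegral_comp_finite hg _ (volume_ne_top_of_subset_Icc hS) (volume_ne_top_of_subset_Icc hT)]
  set d := volume.real (Icc 0 1 ∩ {x | f x ≠ g x}) with hd
  have hterm : ∀ a b, |X a b * (volume.real (S ∩ f ⁻¹' {a}) * volume.real (T ∩ f ⁻¹' {b})) -
      M a b * (volume.real (S ∩ g ⁻¹' {a}) * volume.real (T ∩ g ⁻¹' {b}))| ≤ δ + 2 * B * d := by
    intro a b
    have hB0 : 0 ≤ B := (abs_nonneg _).trans (hM a b)
    have s1 := volume_real_mem_Icc (inter_subset_left.trans hS : S ∩ f ⁻¹' {a} ⊆ Icc 0 1)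
    have s2 := volume_real_mem_Icc (inter_subset_left.trans hS : S ∩ g ⁻¹' {a} ⊆ Icc 0 1)
    have t1 := volume_real_mem_Icc (inter_subset_left.trans hT : T ∩ f ⁻¹' {b} ⊆ Icc 0 1)
    have t2 := volume_real_mem_Icc (inter_subset_left.trans hT : T ∩ g ⁻¹' {b} ⊆ Icc 0 1)
    have ds := abs_volume_real_inter_preimage_sub_le (f := f) (g := g) hS a
    have dt := abs_volume_real_inter_preimage_sub_le (f := f) (g := g) hT b
    rw [← hd] at ds dt
    set s := volume.real (S ∩ f ⁻¹' {a})
    set s' := volume.real (S ∩ g ⁻¹' {a})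
    set t := volume.real (T ∩ f ⁻¹' {b})
    set t' := volume.real (T ∩ g ⁻¹' {b})
    have hst : |s * t - s' * t'| ≤ 2 * d := by
      have : s * t - s' * t' = (s - s') * t + s' * (t - t') := by ring
      rw [this]
      refine (abs_add_le _ _).trans ?_
      rw [abs_mul, abs_mul, abs_of_nonneg t1.1, abs_of_nonneg s2.1]
      have h1 : |s - s'| * t ≤ d * 1 := mul_le_mul ds t1.2 t1.1 ((abs_nonneg _).trans ds)
      have h2 : s' * |t - t'| ≤ 1 * d := mul_le_mul s2.2 dt (abs_nonneg _) zero_le_one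
      linarith
    have : X a b * (s * t) - M a b * (s' * t') =
        (X a b - M a b) * (s * t) + M a b * (s * t - s' * t') := by ring
    rw [this]
    refine (abs_add_le _ _).trans ?_
    rw [abs_mul (X a b - M a b), abs_mul (M a b), abs_of_nonneg (mul_nonneg s1.1 t1.1)]
    have h1 : |X a b - M a b| * (s * t) ≤ δ * 1 :=
      mul_le_mul (hXM a b) (mul_le_one₀ s1.2 t1.1 t1.2) (mul_nonneg s1.1 t1.1) hδ
    have h2 : |M a b| * |s * t - s' * t'| ≤ B * (2 * d) :=
      mul_le_mul (hM a b) hst (abs_nonneg _) hB0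
    linarith
  rw [← Finset.sum_sub_distrib]
  calc _ ≤ ∑ _a : Fin k, ∑ _b : Fin k, (δ + 2 * B * d) := by
        refine (Finset.abs_sum_le_sum_abs _ _).trans (Finset.sum_le_sum fun a _ => ?_)
        rw [← Finset.sum_sub_distrib]
        exact (Finset.abs_sum_le_sum_abs _ _).trans (Finset.sum_le_sum fun b _ => hterm a b)
    _ = _ := by
        simp only [Finset.sum_const, Finset.card_univ, Fintype.card_fin, nsmul_eq_mul]
        ring

/-- Integrals over rectangles are controlled by the `L²` norm on the unit square. -/
theorem abs_setIntegral_le_of_integral_sq_le {h : ℝ → ℝ → ℝ}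
    (hm : Measurable (Function.uncurry h)) {C : ℝ} (hC : ∀ x y, |h x y| ≤ C) {t : ℝ} (ht : 0 < t)
    (hsq : ∫ q in Icc (0:ℝ) 1 ×ˢ Icc (0:ℝ) 1, h q.1 q.2 ^ 2 ≤ t ^ 2) {S T : Set ℝ}
    (hS : S ⊆ Icc 0 1) (hT : T ⊆ Icc 0 1) : |∫ q in S ×ˢ T, h q.1 q.2| ≤ t := by
  have hi := integrableOn_of_abs_le hm hC
  have hi2 : IntegrableOn (fun q : ℝ × ℝ => h q.1 q.2 ^ 2) (Icc (0:ℝ) 1 ×ˢ Icc (0:ℝ) 1) := by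
    refine integrableOn_of_abs_le (W := fun x y => h x y ^ 2) (hm.pow_const 2) (B := C ^ 2) ?_
    intro x y
    rw [abs_pow]
    exact pow_le_pow_left₀ (abs_nonneg _) (hC x y) 2
  have hv : volume (Icc (0:ℝ) 1 ×ˢ Icc (0:ℝ) 1 : Set (ℝ × ℝ)) = 1 := by
    rw [Measure.volume_eq_prod, Measure.prod_prod]; simp
  have hic : IntegrableOn (fun _ : ℝ × ℝ => t / 2) (Icc (0:ℝ) 1 ×ˢ Icc (0:ℝ) 1) :=
    integrableOn_const (by rw [hv]; simp)
  calc |∫ q in S ×ˢ T, h q.1 q.2| ≤ ∫ q in S ×ˢ T, |h q.1 q.2| := abs_integral_le_integral_abs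
    _ ≤ ∫ q in Icc (0:ℝ) 1 ×ˢ Icc (0:ℝ) 1, |h q.1 q.2| :=
        setIntegral_mono_set hi.abs (ae_of_all _ fun q => abs_nonneg _)
          (prod_mono hS hT).eventuallyLE
    _ ≤ ∫ q in Icc (0:ℝ) 1 ×ˢ Icc (0:ℝ) 1, (1 / (2 * t) * h q.1 q.2 ^ 2 + t / 2) := by
        refine integral_mono hi.abs ((hi2.const_mul _).add hic) fun q => ?_
        have h1 : 0 ≤ (|h q.1 q.2| - t) ^ 2 / (2 * t) := by positivity
        have h2 : (|h q.1 q.2| - t) ^ 2 / (2 * t) =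
            1 / (2 * t) * |h q.1 q.2| ^ 2 + t / 2 - |h q.1 q.2| := by
          field_simp
          ring
        rw [h2, sq_abs] at h1
        linarith
    _ = 1 / (2 * t) * (∫ q in Icc (0:ℝ) 1 ×ˢ Icc (0:ℝ) 1, h q.1 q.2 ^ 2) + t / 2 := by
        rw [integral_add (hi2.const_mul _) hic, integral_const_mul, setIntegral_const,
          measureReal_def, hv]
        simp
    _ ≤ 1 / (2 * t) * t ^ 2 + t / 2 := by gcongr
    _ = t := by field_simp; norm_num

/-- The difference between the graph kernel and a step kernel on the vertex blocks, bounded by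
its values on sets of vertices. -/
theorem abs_setIntegral_graphKernel_sub_le {n : ℕ} [NeZero n] (p : ℝ) (G : SimpleGraph (Fin n))
    (Z : Fin n → Fin n → ℝ) {E : ℝ}
    (hE : ∀ S T : Finset (Fin n), |∑ u ∈ S, ∑ v ∈ T, (adjWeight p G u v - Z u v)| / n ^ 2 ≤ E)
    {S T : Set ℝ} (hS : S ⊆ Icc 0 1) (hT : T ⊆ Icc 0 1) :
    |(∫ q in S ×ˢ T, graphKernel p G q.1 q.2) - ∫ q in S ×ˢ T, Z (block n q.1) (block n q.2)| ≤
      E := by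
  have hn : (0:ℝ) < n := by exact_mod_cast Nat.pos_of_ne_zero (NeZero.ne n)
  rw [setIntegral_graphKernel p G hS hT, setIntegral_comp_finite (measurable_block n) _
    (volume_ne_top_of_subset_Icc hS) (volume_ne_top_of_subset_Icc hT), ← Finset.sum_sub_distrib]
  have hs : ∀ {R : Set ℝ}, R ⊆ Icc 0 1 → ∀ u,
      n * volume.real (R ∩ block n ⁻¹' {u}) ∈ Icc (0:ℝ) 1 := by
    intro R hR u
    refine ⟨by positivity, ?_⟩
    have h1 : volume.real (R ∩ block n ⁻¹' {u}) ≤ 1 / n := by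
      rw [← volume_real_block n u]
      exact measureReal_mono (inter_subset_inter_left _ hR)
        (volume_ne_top_of_subset_Icc inter_subset_left)
    rw [le_div_iff₀ hn] at h1
    linarith
  have hb := abs_bilin_le_of_finset (fun u v => (adjWeight p G u v - Z u v) / (n:ℝ) ^ 2) E
    (fun A A' => by
      simp only [← Finset.sum_div]
      rw [abs_div, abs_of_pos (show (0:ℝ) < (n:ℝ) ^ 2 by positivity)]
      exact hE A A') _ _ (hs hS) (hs hT)
  refine le_trans (le_of_eq ?_) hb
  congr 1
  refine Finset.sum_congr rfl fun u _ => ?_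
  rw [← Finset.sum_sub_distrib]
  refine Finset.sum_congr rfl fun v _ => ?_
  field_simp

theorem IsBalanced.exists_perm_mismatch_le {n k : ℕ} [NeZero n] [NeZero k] {c : Fin n → Fin k}
    (hc : IsBalanced c) : ∃ σ : Equiv.Perm (Fin n),
      volume.real (Icc 0 1 ∩ {x | (c ∘ block n) x ≠ (block k ∘ blockExchange σ) x}) ≤
        2 * k / n := by
  have hn : (0:ℝ) < n := by exact_mod_cast Nat.pos_of_ne_zero (NeZero.ne n)
  have hk : 0 < k := Nat.pos_of_ne_zero (NeZero.ne k)
  obtain ⟨σ, hσ⟩ := exists_perm_card_mismatch_le c (intervalColouring n k)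
  have hle : ∑ a, ((fiber c a).card - (fiber (intervalColouring n k) a).card) ≤ ∑ _a : Fin k, 1 := by
    refine Finset.sum_le_sum fun a _ => ?_
    have h1 := (hc.card_fiber a).1
    have h2 := (card_fiber_intervalColouring n k a).2
    have h3 : (fiber c a).card < (fiber (intervalColouring n k) a).card + 2 := by
      by_contra hcon
      have := Nat.mul_le_mul_left k (not_lt.1 hcon)
      rw [mul_add] at this
      omega
    omega
  simp only [Finset.sum_const, Finset.card_univ, Fintype.card_fin, smul_eq_mul, mul_one] at hle
  refine ⟨σ, ?_⟩
  have h := volume_real_mismatch_le c σ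
  have hset : {x | (c ∘ block n) x ≠ (block k ∘ blockExchange σ) x} =
      {x | block k (blockExchange σ x) ≠ c (block n x)} := by
    ext x
    exact ne_comm
  rw [hset]
  refine h.trans ?_
  have : ((Finset.univ.filter fun v => intervalColouring n k (σ v) ≠ c v).card : ℝ) ≤ k := by
    exact_mod_cast hσ.trans hle
  gcongr
  linarith

/-- A colouring which is weakly regular and whose matrix is close to that of a step approximation
of `κ` witnesses closeness in the cut distance. -/
theorem cutDist_graphKernel_le {n k : ℕ} [NeZero n] [NeZero k] {p : ℝ} (G : SimpleGraph (Fin n))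
    {κ : ℝ → ℝ → ℝ} (hκ : Measurable (Function.uncurry κ)) {B : ℝ}
    (hB : ∀ x y, κ x y ∈ Icc 0 B) {t δ E : ℝ} (ht : 0 < t) (hδ : 0 ≤ δ) (hE0 : 0 ≤ E)
    {c : Fin n → Fin k} (hc : IsBalanced c)
    (hcf : ∀ a b, |dDens p G (fiber c a) (fiber c b) - kernelMatrix κ (block k) a b| ≤ δ)
    (hη : ∫ q in Icc (0:ℝ) 1 ×ˢ Icc (0:ℝ) 1,
        (κ q.1 q.2 - kernelMatrix κ (block k) (block k q.1) (block k q.2)) ^ 2 ≤ t ^ 2)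
    (hE : ∀ S T : Finset (Fin n), |∑ u ∈ S, ∑ v ∈ T,
      (adjWeight p G u v - dDens p G (fiber c (c u)) (fiber c (c v)))| / n ^ 2 ≤ E) :
    cutDist (graphKernel p G) κ ≤ E + k ^ 2 * (δ + 2 * B * (2 * k / n)) + t := by
  have hk : 0 < k := Nat.pos_of_ne_zero (NeZero.ne k)
  have hB0 : 0 ≤ B := (hB 0 0).1.trans (hB 0 0).2
  obtain ⟨σ, hσ⟩ := hc.exists_perm_mismatch_le
  set τ := blockExchange σ with hτdef
  have hτ : MPBij τ := mpBij_blockExchange σ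
  refine (cutDist_le _ _ hτ).trans (cutNorm_le (by positivity) fun S T _ _ hS hT => ?_)
  set M := kernelMatrix κ (block k) with hMdef
  have hM : ∀ a b, M a b ∈ Icc 0 B := kernelMatrix_mem_Icc hB hk (isExactColouring_block k)
  have hM' : ∀ a b, |M a b| ≤ B := fun a b => by rw [abs_of_nonneg (hM a b).1]; exact (hM a b).2
  have hκτm := measurable_comp_mpBij hκ hτ
  have hsub : S ×ˢ T ⊆ Icc (0:ℝ) 1 ×ˢ Icc (0:ℝ) 1 := prod_mono hS hT
  have hiκ : IntegrableOn (fun q : ℝ × ℝ => κ (τ q.1) (τ q.2)) (S ×ˢ T) :=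
    (integrableOn_of_abs_le hκτm (B := B) fun x y => by
      rw [abs_of_nonneg (hB _ _).1]; exact (hB _ _).2).mono_set hsub
  let h : ℝ → ℝ → ℝ := fun x y => κ x y - M (block k x) (block k y)
  have hMm : Measurable (Function.uncurry fun x y => M (block k x) (block k y)) :=
    measurable_step M (measurable_block k)
  have hhm : Measurable (Function.uncurry h) := Measurable.sub hκ hMm
  have hhB : ∀ x y, |h x y| ≤ B := fun x y => by
    have h1 := hB x y
    have h2 := hM (block k x) (block k y)
    exact abs_le.2 ⟨by simp only [h]; linarith [h1.1, h2.2], by simp only [h]; linarith [h1.2, h2.1]⟩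
  have hpre : Icc 0 1 ∩ τ ⁻¹' Icc 0 1 = Icc 0 1 :=
    inter_eq_self_of_subset_left fun x hx => hτ.2.mapsTo hx
  have hsq : ∫ q in Icc (0:ℝ) 1 ×ˢ Icc (0:ℝ) 1, h (τ q.1) (τ q.2) ^ 2 ≤ t ^ 2 := by
    have := setIntegral_comp_mpBij (κ := fun x y => h x y ^ 2) (hhm.pow_const 2) hτ
      measurableSet_Icc measurableSet_Icc subset_rfl subset_rfl
    rw [hpre] at this
    rw [this]
    exact hη
  have b4 := abs_setIntegral_le_of_integral_sq_le (h := fun x y => h (τ x) (τ y))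
    (measurable_comp_mpBij hhm hτ) (fun x y => hhB _ _) ht hsq hS hT
  have e4 : ∫ q in S ×ˢ T, h (τ q.1) (τ q.2) = (∫ q in S ×ˢ T, κ (τ q.1) (τ q.2)) -
      ∫ q in S ×ˢ T, M ((block k ∘ τ) q.1) ((block k ∘ τ) q.2) :=
    integral_sub hiκ ((integrableOn_of_abs_le (measurable_comp_mpBij hMm hτ)
      fun x y => hM' _ _).mono_set hsub)
  rw [e4] at b4
  have b1 := abs_setIntegral_graphKernel_sub_le p G
    (fun u v => dDens p G (fiber c (c u)) (fiber c (c v))) hE hS hT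
  have b2 := abs_setIntegral_step_sub_le
    (X := fun a b => dDens p G (fiber c a) (fiber c b)) (M := M) (f := c ∘ block n)
    (g := block k ∘ τ) ((measurable_of_finite c).comp (measurable_block n))
    ((measurable_block k).comp hτ.1.measurable) hδ hM' hcf hS hT
  have b3 : (k:ℝ) ^ 2 * (δ + 2 * B * volume.real (Icc 0 1 ∩
      {x | (c ∘ block n) x ≠ (block k ∘ τ) x})) ≤ k ^ 2 * (δ + 2 * B * (2 * k / n)) := by
    gcongr
  rw [integral_sub ((integrableOn_graphKernel p G).mono_set hsub) hiκ]
  simp only [Function.comp] at b2 b3 b4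
  have c1 := abs_le.1 b1
  have c2 := abs_le.1 (b2.trans b3)
  have c4 := abs_le.1 b4
  exact abs_le.2 ⟨by linarith [c1.1, c2.1, c4.2], by linarith [c1.2, c2.2, c4.1]⟩

theorem eventually_div_natCast_le (a : ℝ) {ε : ℝ} (hε : 0 < ε) : ∀ᶠ n : ℕ in atTop, a / n ≤ ε :=
  ((tendsto_const_div_atTop_nhds_zero_nat a).eventually (gt_mem_nhds hε)).mono fun _ h => h.le

/-- Convergence of the sets of density matrices implies convergence in the cut metric. -/
theorem tendsto_cutDist_of_tendsto_hausdorffDist {p : ℕ → ℝ} (hp : ∀ n, p n ∈ Ioc (0:ℝ) 1)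
    (G : ∀ n, SimpleGraph (Fin n)) {κ : ℝ → ℝ → ℝ} (hκ : Measurable (Function.uncurry κ)) {B : ℝ}
    (hB : ∀ x y, κ x y ∈ Icc 0 B)
    (h : ∀ k : ℕ, 2 ≤ k →
      Tendsto (fun n => Metric.hausdorffDist (MsetG k (p n) (G n)) (MsetK k κ)) atTop (nhds 0)) :
    Tendsto (fun n => cutDist (graphKernel (p n) (G n)) κ) atTop (nhds 0) := by
  have hB0 : 0 ≤ B := (hB 0 0).1.trans (hB 0 0).2
  have hB' : ∀ x y, |κ x y| ≤ B := fun x y => by rw [abs_of_nonneg (hB x y).1]; exact (hB x y).2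
  have key : ∀ t : ℝ, 0 < t → t ≤ 1 →
      ∀ᶠ n in atTop, cutDist (graphKernel (p n) (G n)) κ ≤ 16 * (B + 1) * t := by
    intro t ht ht1
    have ht2 : 0 < t ^ 2 := by positivity
    have htt : t ^ 2 ≤ t := by nlinarith
    obtain ⟨k, hk2, hη⟩ := exists_step_approx hκ hB' ht2
    have : NeZero k := ⟨by omega⟩
    have hk0 : (0:ℝ) < k := by exact_mod_cast (show 0 < k by omega)
    have hk1 : (1:ℝ) ≤ k := by exact_mod_cast (show 1 ≤ k by omega)
    obtain ⟨K, hK, hK2⟩ := ((eventually_div_natCast_le (4 * k) ht2).and (eventually_ge_atTop 2)).exists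
    have : NeZero K := ⟨by omega⟩
    set δ := t ^ 2 / (k:ℝ) ^ 2 with hδdef
    have hδ0 : 0 < δ := by positivity
    have hδt : δ ≤ t ^ 2 := div_le_self ht2.le (one_le_pow₀ hk1)
    have hkδ : (k:ℝ) ^ 2 * δ = t ^ 2 := by rw [hδdef]; field_simp
    filter_upwards [(h k hk2).eventually (gt_mem_nhds hδ0), (h K hK2).eventually (gt_mem_nhds hδ0),
      eventually_ge_atTop k, eventually_ge_atTop K, eventually_div_natCast_le (4 * k) ht2,
      eventually_div_natCast_le (2 * k ^ 2) ht2, eventually_div_natCast_le (2 * K ^ 2) ht2,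
      eventually_div_natCast_le (4 * k ^ 3) ht2] with n hn1 hn2 hkn hKn e1 e2 e3 e4
    have : NeZero n := ⟨by omega⟩
    obtain ⟨c, hc, hcf⟩ := exists_isBalanced_near hkn (p n) (G n) hB hn1 (isExactColouring_block k)
    have hE := abs_sum_adjWeight_sub_le hKn (hp n).1 (G n) hκ hB (hδt.trans (htt.trans ht1)) hc
      (isExactColouring_block k) hcf hη
      (fun c' hc' => exists_colouring_near hKn (p n) (G n) hB hn2 hc')
    have hsqrt : √(t ^ 2 + 2 * k ^ 2 * (B + 1) ^ 2 / n + 2 * K ^ 2 * (B + 1) ^ 2 / n +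
        4 * (B + 1) * δ + 8 * (B + 1) ^ 2 * (4 * k / K + 4 * k / n)) ≤ 5 * (B + 1) * t := by
      apply Real.sqrt_le_iff.2 ⟨by positivity, ?_⟩
      have hD1 : 1 ≤ (B + 1) ^ 2 := one_le_pow₀ (by linarith)
      have hD2 : B + 1 ≤ (B + 1) ^ 2 := by nlinarith
      have s0 : t ^ 2 ≤ (B + 1) ^ 2 * t ^ 2 := le_mul_of_one_le_left ht2.le hD1
      have s1 : 2 * (k:ℝ) ^ 2 * (B + 1) ^ 2 / n ≤ (B + 1) ^ 2 * t ^ 2 := by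
        calc 2 * (k:ℝ) ^ 2 * (B + 1) ^ 2 / n = (B + 1) ^ 2 * (2 * k ^ 2 / n) := by ring
          _ ≤ _ := by gcongr
      have s2 : 2 * (K:ℝ) ^ 2 * (B + 1) ^ 2 / n ≤ (B + 1) ^ 2 * t ^ 2 := by
        calc 2 * (K:ℝ) ^ 2 * (B + 1) ^ 2 / n = (B + 1) ^ 2 * (2 * K ^ 2 / n) := by ring
          _ ≤ _ := by gcongr
      have s3 : 4 * (B + 1) * δ ≤ 4 * (B + 1) ^ 2 * t ^ 2 := by gcongr
      have s4 : 8 * (B + 1) ^ 2 * (4 * k / K + 4 * k / n) ≤ 8 * (B + 1) ^ 2 * (t ^ 2 + t ^ 2) := by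
        gcongr
      nlinarith
    have hζ : 4 * (B + 1) * (4 * (k:ℝ) / K + 4 * k / n) ≤ 4 * (B + 1) * (t ^ 2 + t ^ 2) := by gcongr
    have hcut := cutDist_graphKernel_le (G n) hκ hB ht hδ0.le
      (E := 4 * (B + 1) * (t ^ 2 + t ^ 2) + 5 * (B + 1) * t) (by positivity) hc hcf hη
      (fun S T => (hE S T).trans (add_le_add hζ hsqrt))
    refine hcut.trans ?_
    have : (k:ℝ) ^ 2 * (δ + 2 * B * (2 * k / n)) = t ^ 2 + B * (4 * k ^ 3 / n) := by
      rw [← hkδ]; ring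
    rw [this]
    have s5 : B * (4 * (k:ℝ) ^ 3 / n) ≤ B * t ^ 2 := by gcongr
    nlinarith
  refine tendsto_order.2 ⟨fun a ha => Eventually.of_forall fun n => ha.trans_le (cutDist_nonneg _ _),
    fun ε hε => ?_⟩
  have hD : 0 < 17 * (B + 1) := by positivity
  filter_upwards [key (min 1 (ε / (17 * (B + 1)))) (by positivity) (min_le_left _ _)] with n hn
  refine hn.trans_lt ?_
  calc 16 * (B + 1) * min 1 (ε / (17 * (B + 1))) ≤ 16 * (B + 1) * (ε / (17 * (B + 1))) := by
        gcongr
        exact min_le_right _ _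
    _ = 16 / 17 * ε := by field_simp
    _ < ε := by linarith

theorem adjWeight_comm {n : ℕ} (p : ℝ) (G : SimpleGraph (Fin n)) (u v : Fin n) :
    adjWeight p G u v = adjWeight p G v u := by
  simp only [adjWeight, G.adj_comm]

theorem adjWeight_sq {n : ℕ} (p : ℝ) (G : SimpleGraph (Fin n)) (u v : Fin n) :
    adjWeight p G u v ^ 2 = 1 / p * adjWeight p G u v := by
  unfold adjWeight
  split_ifs <;> ring

theorem sum_volume_real_inter_preimage {ι : Type*} [Fintype ι] [MeasurableSpace ι]
    [MeasurableSingletonClass ι] {f : ℝ → ι} (hf : Measurable f) {S : Set ℝ} (hS : S ⊆ Icc 0 1) :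
    ∑ a, volume.real (S ∩ f ⁻¹' {a}) = volume.real S := by
  have h := sum_measureReal_preimage_singleton (μ := volume.restrict S) (Finset.univ : Finset ι)
    (f := f) (fun a _ => hf (measurableSet_singleton a))
    (fun a _ => ne_top_of_le_ne_top (volume_ne_top_of_subset_Icc hS)
      (by rw [Measure.restrict_apply (hf (measurableSet_singleton a))]
          exact measure_mono inter_subset_right))
  simp only [Finset.coe_univ, preimage_univ, measureReal_restrict_apply MeasurableSet.univ,
    univ_inter] at h
  rw [← h]
  refine Finset.sum_congr rfl fun a _ => ?_
  rw [measureReal_restrict_apply (hf (measurableSet_singleton a)), inter_comm]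

/-- Every measurable colouring of the unit interval can be rounded to a colouring of the vertices
of a graph with approximately the same class sizes and the same edge densities. -/
theorem exists_vertex_colouring_near {n k : ℕ} [NeZero n] {p : ℝ} (hp : p ∈ Ioc (0:ℝ) 1)
    (G : SimpleGraph (Fin n)) {D : ℝ} (hD0 : 0 ≤ D)
    (hD : ∑ u, ∑ v, adjWeight p G u v ≤ D * n ^ 2) {f : ℝ → Fin k} (hf : Measurable f) :
    ∃ c : Fin n → Fin k,
      (∀ a, |volume.real (cell (c ∘ block n) a) - volume.real (cell f a)| ≤
        √(k * (1 + D) / (n * p))) ∧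
      ∀ a b, |(∫ q in cell (c ∘ block n) a ×ˢ cell (c ∘ block n) b, graphKernel p G q.1 q.2) -
        ∫ q in cell f a ×ˢ cell f b, graphKernel p G q.1 q.2| ≤ 2 * √(k * (1 + D) / (n * p)) := by
  have hn : (0:ℝ) < n := by exact_mod_cast Nat.pos_of_ne_zero (NeZero.ne n)
  have hp0 := hp.1
  set θ := √(k * (1 + D) / (n * p)) with hθ
  have hθ0 : 0 ≤ θ := Real.sqrt_nonneg _
  have hθ2 : θ ^ 2 = k * (1 + D) / (n * p) := Real.sq_sqrt (by positivity)
  let y : Fin n → Fin k → ℝ := fun v a => volume.real (cell f a ∩ block n ⁻¹' {v})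
  have hy0 : ∀ v a, 0 ≤ n * y v a := fun v a => by positivity
  have hy1 : ∀ v, ∑ a, n * y v a = 1 := by
    intro v
    rw [← Finset.mul_sum]
    have h1 : ∀ a, y v a = volume.real ((Icc 0 1 ∩ block n ⁻¹' {v}) ∩ f ⁻¹' {a}) := fun a => by
      simp only [y, cell, inter_right_comm]
    simp only [h1]
    rw [sum_volume_real_inter_preimage hf inter_subset_left, volume_real_block]
    field_simp
  obtain ⟨c, hc⟩ := exists_rounding (adjWeight p G) (fun v a => n * y v a) hy0 hy1 (√n)
  let z : Fin n → Fin k → ℝ := fun v a => volume.real (cell (c ∘ block n) a ∩ block n ⁻¹' {v})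
  have hz : ∀ v a, n * z v a = if c v = a then 1 else 0 := by
    intro v a
    simp only [z, volume_real_cell_inter_block]
    split_ifs
    · field_simp
    · simp
  have hR : (Fintype.card (Fin k) : ℝ) * ∑ v, (√(n:ℝ) ^ 2 + ∑ w, adjWeight p G v w ^ 2) ≤
      n ^ 3 * θ ^ 2 := by
    simp only [adjWeight_sq, ← Finset.mul_sum, Finset.sum_add_distrib, Real.sq_sqrt hn.le,
      Finset.sum_const, Finset.card_univ, Fintype.card_fin, nsmul_eq_mul]
    have h1 : (n:ℝ) * n ≤ 1 / p * n ^ 2 := by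
      have : 1 ≤ 1 / p := (one_le_div hp0).2 hp.2
      nlinarith [sq_nonneg (n:ℝ)]
    calc (k:ℝ) * (n * n + 1 / p * ∑ u, ∑ v, adjWeight p G u v)
        ≤ k * (1 / p * n ^ 2 + 1 / p * (D * n ^ 2)) := by gcongr
      _ = n ^ 3 * θ ^ 2 := by rw [hθ2]; field_simp
  have hsum : ∀ a, |∑ v, (z v a - y v a)| ≤ θ := by
    intro a
    refine abs_le_of_sq_le_sq ?_ hθ0
    have h1 := (hc a).1.trans hR
    have h2 : ∑ v, ((if c v = a then (1:ℝ) else 0) - n * y v a) = n * ∑ v, (z v a - y v a) := by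
      rw [Finset.mul_sum]
      refine Finset.sum_congr rfl fun v _ => ?_
      rw [← hz]
      ring
    rw [mul_pow, Real.sq_sqrt hn.le] at h1
    have h3 : (n:ℝ) ^ 3 * (∑ v, (z v a - y v a)) ^ 2 ≤ n ^ 3 * θ ^ 2 := by
      refine le_trans (le_of_eq ?_) h1
      have h4 : ((n:ℝ) * ∑ v, (z v a - y v a)) ^ 2 = n ^ 2 * (∑ v, (z v a - y v a)) ^ 2 := by ring
      convert congrArg (fun s : ℝ => n * s ^ 2) h2.symm using 1
      · simp only [h4]; ring
      · congr!
    exact le_of_mul_le_mul_left h3 (by positivity)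
  have hbil : ∀ a (t : Fin n → ℝ), (∀ w, n * t w ∈ Icc (0:ℝ) 1) →
      |∑ v, ∑ w, adjWeight p G v w * ((z v a - y v a) * t w)| ≤ θ := by
    intro a t ht
    refine abs_le_of_sq_le_sq ?_ hθ0
    have h1 := ((hc a).2 _ ht).trans (mul_le_mul_of_nonneg_left hR (Nat.cast_nonneg _))
    rw [Fintype.card_fin] at h1
    have h2 : ∑ v, ∑ w, adjWeight p G v w * (((if c v = a then (1:ℝ) else 0) - n * y v a) *
        (n * t w)) = n ^ 2 * ∑ v, ∑ w, adjWeight p G v w * ((z v a - y v a) * t w) := by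
      simp only [Finset.mul_sum]
      refine Finset.sum_congr rfl fun v _ => Finset.sum_congr rfl fun w _ => ?_
      rw [← hz]
      ring
    have h3 : (n:ℝ) ^ 4 * (∑ v, ∑ w, adjWeight p G v w * ((z v a - y v a) * t w)) ^ 2 ≤
        n ^ 4 * θ ^ 2 := by
      refine le_trans (le_of_eq ?_) (h1.trans_eq (by ring))
      convert congrArg (fun s : ℝ => s ^ 2) h2.symm using 1
      · ring
      · congr!
    exact le_of_mul_le_mul_left h3 (by positivity)
  have hz01 : ∀ b w, n * z w b ∈ Icc (0:ℝ) 1 := fun b w => by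
    rw [hz]; split_ifs <;> simp
  have hy01 : ∀ b w, n * y w b ∈ Icc (0:ℝ) 1 := fun b w =>
    ⟨hy0 w b, (hy1 w) ▸ Finset.single_le_sum (fun a _ => hy0 w a) (Finset.mem_univ b)⟩
  refine ⟨c, fun a => ?_, fun a b => ?_⟩
  · rw [← sum_volume_real_inter_preimage (measurable_block n) (cell_subset (c ∘ block n) a),
      ← sum_volume_real_inter_preimage (measurable_block n) (cell_subset f a),
      ← Finset.sum_sub_distrib]
    exact hsum a
  · rw [setIntegral_graphKernel p G (cell_subset _ _) (cell_subset _ _),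
      setIntegral_graphKernel p G (cell_subset _ _) (cell_subset _ _)]
    have e : (∑ u, ∑ v, adjWeight p G u v * (z u a * z v b)) -
        ∑ u, ∑ v, adjWeight p G u v * (y u a * y v b) =
        (∑ u, ∑ v, adjWeight p G u v * ((z u a - y u a) * z v b)) +
          ∑ v, ∑ u, adjWeight p G v u * ((z v b - y v b) * y u a) := by
      rw [Finset.sum_comm (f := fun v u => adjWeight p G v u * ((z v b - y v b) * y u a))]
      simp only [← Finset.sum_sub_distrib, ← Finset.sum_add_distrib]
      refine Finset.sum_congr rfl fun u _ => Finset.sum_congr rfl fun v _ => ?_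
      rw [adjWeight_comm p G v u]
      ring
    refine (congrArg abs e).le.trans ((abs_add_le _ _).trans ?_)
    linarith [hbil a _ (hz01 b), hbil b _ (hy01 a)]

/-- Normalizing by the class sizes instead of `1/k` changes the densities only slightly. -/
theorem IsBalanced.abs_sub_le {n k : ℕ} [NeZero n] [NeZero k] (hkn : 6 * k ≤ n)
    {c : Fin n → Fin k} (hc : IsBalanced c) {X Y B e : ℝ} (hX : 0 ≤ X) (hY : Y ≤ B) {a b : Fin k}
    (h : |X * ((fiber c a).card / (n:ℝ) * ((fiber c b).card / (n:ℝ))) - Y / k ^ 2| ≤ e) :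
    |X - Y| ≤ k ^ 2 * e + 6 * k * (B + k ^ 2 * e) / n := by
  have hn : (0:ℝ) < n := by exact_mod_cast Nat.pos_of_ne_zero (NeZero.ne n)
  have hk : (0:ℝ) < k := by exact_mod_cast Nat.pos_of_ne_zero (NeZero.ne k)
  have hkn' : 6 * (k:ℝ) ≤ n := by exact_mod_cast hkn
  have ha := hc.abs_card_div_sub_le a
  have hb := hc.abs_card_div_sub_le b
  set u : ℝ := (fiber c a).card / n
  set v : ℝ := (fiber c b).card / n
  set r : ℝ := k / n with hr
  have hr0 : 0 ≤ r := by positivity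
  have hr6 : 6 * r ≤ 1 := by
    rw [hr, ← mul_div_assoc, div_le_one hn]; exact hkn'
  have scale : ∀ w : ℝ, |w - 1 / k| ≤ 1 / n → |k * w - 1| ≤ r := by
    intro w hw
    have h1 : k * w - 1 = k * (w - 1 / k) := by field_simp
    rw [h1, abs_mul, abs_of_pos hk, hr]
    calc k * |w - 1 / k| ≤ k * (1 / n) := by gcongr
      _ = k / n := by ring
  have hu := abs_le.1 (scale u ha)
  have hv := abs_le.1 (scale v hb)
  set ρ : ℝ := (k * u) * (k * v) with hρ
  have hρ1 : |1 - ρ| ≤ 3 * r := by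
    have h1 : 1 - ρ = -((k * u - 1) * (k * v)) - (k * v - 1) := by rw [hρ]; ring
    have h2 : |(k * u - 1) * (k * v)| ≤ r * 2 := by
      rw [abs_mul]
      exact mul_le_mul (scale u ha) (abs_le.2 ⟨by linarith, by linarith⟩) (abs_nonneg _) hr0
    have h3 := abs_le.1 h2
    rw [h1]
    exact abs_le.2 ⟨by linarith, by linarith⟩
  have hs : |X * ρ - Y| ≤ k ^ 2 * e := by
    have h1 : X * ρ - Y = k ^ 2 * (X * (u * v) - Y / k ^ 2) := by
      rw [hρ]; field_simp
    rw [h1, abs_mul, abs_of_pos (show (0:ℝ) < (k:ℝ) ^ 2 by positivity)]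
    gcongr
  set s : ℝ := k ^ 2 * e
  have hρ2 := abs_le.1 hρ1
  have hs2 := abs_le.1 hs
  have hXle : X ≤ 2 * (B + s) := by nlinarith
  have hfin : |X * (1 - ρ)| ≤ 2 * (B + s) * (3 * r) := by
    rw [abs_mul, abs_of_nonneg hX]
    exact mul_le_mul hXle hρ1 (abs_nonneg _) (hX.trans hXle)
  have h4 := abs_le.1 hfin
  have h5 : 6 * k * (B + s) / n = 2 * (B + s) * (3 * r) := by rw [hr]; ring
  rw [h5]
  exact abs_le.2 ⟨by linarith, by linarith⟩

theorem abs_setIntegral_cell_sub_le_of_cutNorm_le {n : ℕ} [NeZero n] (p : ℝ)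
    (G : SimpleGraph (Fin n)) {W : ℝ → ℝ → ℝ} (hW : Measurable (Function.uncurry W)) {B : ℝ}
    (hB : ∀ x y, W x y ∈ Icc 0 B) {δ : ℝ}
    (hδ : cutNorm (fun x y => graphKernel p G x y - W x y) ≤ δ) {S T : Set ℝ}
    (hSm : MeasurableSet S) (hTm : MeasurableSet T) (hS : S ⊆ Icc 0 1) (hT : T ⊆ Icc 0 1) :
    |(∫ q in S ×ˢ T, graphKernel p G q.1 q.2) - ∫ q in S ×ˢ T, W q.1 q.2| ≤ δ := by
  have hi := integrableOn_graphKernel p G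
  have hiW : IntegrableOn (fun q : ℝ × ℝ => W q.1 q.2) (Icc (0:ℝ) 1 ×ˢ Icc (0:ℝ) 1) :=
    integrableOn_of_abs_le hW (B := B) fun x y => by
      rw [abs_of_nonneg (hB x y).1]; exact (hB x y).2
  have h := abs_setIntegral_le_cutNorm (W := fun x y => graphKernel p G x y - W x y)
    (hi.sub hiW) hSm hTm hS hT
  rw [integral_sub (hi.mono_set (prod_mono hS hT)) (hiW.mono_set (prod_mono hS hT))] at h
  exact h.trans hδ

theorem kernelMatrix_div_sq {k : ℕ} [NeZero k] (W : ℝ → ℝ → ℝ) (f : ℝ → Fin k) (a b : Fin k) :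
    kernelMatrix W f a b / k ^ 2 = ∫ q in cell f a ×ˢ cell f b, W q.1 q.2 := by
  have hk : (0:ℝ) < k := by exact_mod_cast Nat.pos_of_ne_zero (NeZero.ne k)
  rw [kernelMatrix]
  field_simp

/-- If a graph is close to `W` in cut norm, then every balanced colouring of the graph is close to
an exact colouring of `W`. -/
theorem exists_exactColouring_near_of_cutNorm_le {n k : ℕ} [NeZero n] [NeZero k]
    (hkn : 6 * k ≤ n) {p : ℝ} (hp : 0 ≤ p) (G : SimpleGraph (Fin n)) {W : ℝ → ℝ → ℝ}
    (hW : Measurable (Function.uncurry W)) {B : ℝ} (hB : ∀ x y, W x y ∈ Icc 0 B) {δ e : ℝ}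
    (hδ : cutNorm (fun x y => graphKernel p G x y - W x y) ≤ δ)
    (he : δ + 2 * B * (2 * k / n) ≤ e) {c : Fin n → Fin k} (hc : IsBalanced c) :
    ∃ f, IsExactColouring k f ∧ ∀ a b, |dDens p G (fiber c a) (fiber c b) - kernelMatrix W f a b| ≤
      k ^ 2 * e + 6 * k * (B + k ^ 2 * e) / n := by
  have hB0 : 0 ≤ B := (hB 0 0).1.trans (hB 0 0).2
  have hB' : ∀ x y, |W x y| ≤ B := fun x y => by rw [abs_of_nonneg (hB x y).1]; exact (hB x y).2
  have hcm : Measurable (c ∘ block n) := (measurable_of_finite c).comp (measurable_block n)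
  obtain ⟨σ, hσ⟩ := hc.exists_perm_mismatch_le
  have hf := (isExactColouring_block k).comp (mpBij_blockExchange σ)
  refine ⟨_, hf, fun a b => hc.abs_sub_le (a := a) (b := b) hkn (dDens_nonneg hp _ _ _)
    (kernelMatrix_mem_Icc hB (Nat.pos_of_ne_zero (NeZero.ne k)) hf a b).2 ?_⟩
  rw [kernelMatrix_div_sq, ← setIntegral_cell_graphKernel]
  have h1 := abs_setIntegral_cell_sub_le_of_cutNorm_le p G hW hB hδ (measurableSet_cell hcm a)
    (measurableSet_cell hcm b) (cell_subset _ _) (cell_subset _ _)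
  have h2 := abs_setIntegral_cell_sub_le hW hB' hcm hf.1 a b
  have h3 : 2 * B * volume.real
      (Icc 0 1 ∩ {x | (c ∘ block n) x ≠ (block k ∘ blockExchange σ) x}) ≤
      2 * B * (2 * k / n) := by gcongr
  refine (abs_sub_le _ _ _).trans ((add_le_add h1 (h2.trans h3)).trans he)

/-- If a graph of average degree tending to infinity is close to `W` in cut norm, then every exact
colouring of `W` is close to a balanced colouring of the graph. -/
theorem exists_isBalanced_near_of_cutNorm_le {n k : ℕ} [NeZero n] [NeZero k]
    (hkn : 6 * k ≤ n) {p : ℝ} (hp : p ∈ Ioc (0:ℝ) 1) (G : SimpleGraph (Fin n)) {W : ℝ → ℝ → ℝ}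
    (hW : Measurable (Function.uncurry W)) {B : ℝ} (hB : ∀ x y, W x y ∈ Icc 0 B) {δ e : ℝ}
    (hδ : cutNorm (fun x y => graphKernel p G x y - W x y) ≤ δ)
    (he : 3 * δ + 2 * √(k * (1 + (B + δ)) / (n * p)) +
      2 * B * (k * (√(k * (1 + (B + δ)) / (n * p)) + 1 / n)) ≤ e)
    {f : ℝ → Fin k} (hf : IsExactColouring k f) :
    ∃ c : Fin n → Fin k, IsBalanced c ∧
      ∀ a b, |dDens p G (fiber c a) (fiber c b) - kernelMatrix W f a b| ≤
        k ^ 2 * e + 6 * k * (B + k ^ 2 * e) / n := by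
  have hn : (0:ℝ) < n := by exact_mod_cast Nat.pos_of_ne_zero (NeZero.ne n)
  have hk0 : 0 < k := Nat.pos_of_ne_zero (NeZero.ne k)
  have hk : (0:ℝ) < k := by exact_mod_cast hk0
  have hB0 : 0 ≤ B := (hB 0 0).1.trans (hB 0 0).2
  have hB' : ∀ x y, |W x y| ≤ B := fun x y => by rw [abs_of_nonneg (hB x y).1]; exact (hB x y).2
  have hδ0 : 0 ≤ δ := (cutNorm_nonneg _).trans hδ
  have hIv : volume.real (Icc (0:ℝ) 1 ×ˢ Icc (0:ℝ) 1 : Set (ℝ × ℝ)) = 1 := by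
    rw [measureReal_def, Measure.volume_eq_prod, Measure.prod_prod]; simp
  have hdens : ∑ u, ∑ v, adjWeight p G u v ≤ (B + δ) * n ^ 2 := by
    have h1 := abs_setIntegral_cell_sub_le_of_cutNorm_le p G hW hB hδ measurableSet_Icc
      measurableSet_Icc subset_rfl subset_rfl
    have h2 : ∫ q in Icc (0:ℝ) 1 ×ˢ Icc (0:ℝ) 1, W q.1 q.2 ≤ B := by
      have h3 := norm_setIntegral_le_of_norm_le_const (μ := volume)
        (s := Icc (0:ℝ) 1 ×ˢ Icc (0:ℝ) 1) (f := fun q : ℝ × ℝ => W q.1 q.2) (C := B)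
        (by rw [Measure.volume_eq_prod, Measure.prod_prod]; simp) (fun q _ => hB' _ _)
      rw [hIv, mul_one] at h3
      exact (le_abs_self _).trans h3
    rw [setIntegral_graphKernel p G subset_rfl subset_rfl] at h1
    simp only [volume_real_block, ← Finset.sum_mul] at h1
    have h4 := (abs_le.1 h1).2
    have h5 : (∑ u, ∑ v, adjWeight p G u v) * (1 / (n:ℝ) * (1 / n)) ≤ B + δ := by linarith
    calc ∑ u, ∑ v, adjWeight p G u v
        = (∑ u, ∑ v, adjWeight p G u v) * (1 / (n:ℝ) * (1 / n)) * n ^ 2 := by field_simp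
      _ ≤ _ := by gcongr
  obtain ⟨c, hcv, hcG⟩ := exists_vertex_colouring_near hp G (add_nonneg hB0 hδ0) hdens hf.1
  set θ := √(k * (1 + (B + δ)) / (n * p)) with hθ
  have hθ0 : 0 ≤ θ := Real.sqrt_nonneg _
  obtain ⟨σ, hσ⟩ := exists_perm_card_mismatch_le c (intervalColouring n k)
  set c' : Fin n → Fin k := intervalColouring n k ∘ σ with hc'
  have hbal : IsBalanced c' := isBalanced_intervalColouring_comp (by omega) σ
  have hcm : Measurable (c ∘ block n) := (measurable_of_finite c).comp (measurable_block n)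
  have hcm' : Measurable (c' ∘ block n) := (measurable_of_finite c').comp (measurable_block n)
  have hcell : ∀ a, volume.real (cell (c ∘ block n) a) = (fiber c a).card / n := by
    intro a
    rw [← volume_real_block_preimage, cell, preimage_comp]
    congr 3
    ext v
    simp [fiber]
  have hmis : ((Finset.univ.filter fun v => intervalColouring n k (σ v) ≠ c v).card : ℝ) ≤
      k * (θ * n + 1) := by
    refine (Nat.cast_le.2 hσ).trans ?_
    rw [Nat.cast_sum]
    calc ∑ a, (((fiber c a).card - (fiber (intervalColouring n k) a).card : ℕ) : ℝ)
        ≤ ∑ _a : Fin k, (θ * n + 1) := by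
          refine Finset.sum_le_sum fun a _ => ?_
          rcases le_total (fiber c a).card (fiber (intervalColouring n k) a).card with hle | hle
          · rw [Nat.sub_eq_zero_of_le hle]
            push_cast
            positivity
          · rw [Nat.cast_sub hle]
            have h1 := (abs_le.1 (hcv a)).2
            rw [hcell, hf.volume_real] at h1
            have h2 := (card_fiber_intervalColouring n k a).2
            have h3 : (n:ℝ) < k * (fiber (intervalColouring n k) a).card + k := by exact_mod_cast h2
            have h4 : (n:ℝ) / k ≤ (fiber (intervalColouring n k) a).card + 1 := by
              rw [div_le_iff₀ hk]; linarith
            have h5 : ((fiber c a).card : ℝ) ≤ θ * n + n / k := by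
              calc ((fiber c a).card : ℝ) = ((fiber c a).card / n - 1 / k) * n + n / k := by
                    field_simp; ring
                _ ≤ _ := by gcongr
            linarith
      _ = k * (θ * n + 1) := by simp; ring
  have hmisv : volume.real (Icc 0 1 ∩ {x | (c ∘ block n) x ≠ (c' ∘ block n) x}) ≤
      k * (θ + 1 / n) := by
    have h1 : {x | (c ∘ block n) x ≠ (c' ∘ block n) x} = block n ⁻¹'
        ↑(Finset.univ.filter fun v => intervalColouring n k (σ v) ≠ c v) := by
      ext x
      simp [hc', eq_comm]
    rw [h1, volume_real_block_preimage, div_le_iff₀ hn]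
    refine hmis.trans_eq ?_
    field_simp
  refine ⟨c', hbal, fun a b => hbal.abs_sub_le (a := a) (b := b) hkn (dDens_nonneg hp.1.le _ _ _)
    (kernelMatrix_mem_Icc hB hk0 hf a b).2 ?_⟩
  rw [kernelMatrix_div_sq, ← setIntegral_cell_graphKernel]
  have d1 := abs_le.1 <| abs_setIntegral_cell_sub_le_of_cutNorm_le p G hW hB hδ
    (measurableSet_cell hf.1 a) (measurableSet_cell hf.1 b) (cell_subset _ _) (cell_subset _ _)
  have d2 := abs_le.1 (hcG a b)
  have d3 := abs_le.1 <| abs_setIntegral_cell_sub_le_of_cutNorm_le p G hW hB hδ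
    (measurableSet_cell hcm a) (measurableSet_cell hcm b) (cell_subset _ _) (cell_subset _ _)
  have h4 : 2 * B * volume.real (Icc 0 1 ∩ {x | (c ∘ block n) x ≠ (c' ∘ block n) x}) ≤
      2 * B * (k * (θ + 1 / n)) := by gcongr
  have d4 := abs_le.1 ((abs_setIntegral_cell_sub_le hW hB' hcm hcm' a b).trans h4)
  have d5 := abs_le.1 <| abs_setIntegral_cell_sub_le_of_cutNorm_le p G hW hB hδ
    (measurableSet_cell hcm' a) (measurableSet_cell hcm' b) (cell_subset _ _) (cell_subset _ _)
  exact abs_le.2 ⟨by linarith [d1.1, d1.2, d2.1, d2.2, d3.1, d3.2, d4.1, d4.2, d5.1, d5.2],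
    by linarith [d1.1, d1.2, d2.1, d2.2, d3.1, d3.2, d4.1, d4.2, d5.1, d5.2]⟩

/-- Convergence in the cut metric implies convergence of the sets of density matrices. -/
theorem tendsto_hausdorffDist_of_tendsto_cutDist {p : ℕ → ℝ} (hp : ∀ n, p n ∈ Ioc (0:ℝ) 1)
    (hpn : Tendsto (fun n : ℕ => (n:ℝ) * p n) atTop atTop)
    (G : ∀ n, SimpleGraph (Fin n)) {κ : ℝ → ℝ → ℝ} (hκ : Measurable (Function.uncurry κ)) {B : ℝ}
    (hB : ∀ x y, κ x y ∈ Icc 0 B) {k : ℕ} (hk : 0 < k)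
    (h : Tendsto (fun n => cutDist (graphKernel (p n) (G n)) κ) atTop (nhds 0)) :
    Tendsto (fun n => Metric.hausdorffDist (MsetG k (p n) (G n)) (MsetK k κ)) atTop (nhds 0) := by
  have : NeZero k := ⟨hk.ne'⟩
  have hB0 : 0 ≤ B := (hB 0 0).1.trans (hB 0 0).2
  let δ : ℕ → ℝ := fun n => cutDist (graphKernel (p n) (G n)) κ + 1 / n
  let θ : ℕ → ℝ := fun n => √(k * (1 + (B + δ n)) / (n * p n))
  let e : ℕ → ℝ := fun n => 3 * δ n + 2 * θ n + 2 * B * (k * (θ n + 2 / n))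
  let r : ℕ → ℝ := fun n => k ^ 2 * e n + 6 * k * (B + k ^ 2 * e n) / n
  have hinv : ∀ a : ℝ, Tendsto (fun n : ℕ => a / n) atTop (nhds 0) :=
    tendsto_const_div_atTop_nhds_zero_nat
  have hδ : Tendsto δ atTop (nhds 0) := by simpa [δ] using h.add (hinv 1)
  have hθ : Tendsto θ atTop (nhds 0) := by
    have h1 : Tendsto (fun n => k * (1 + (B + δ n)) / (n * p n)) atTop (nhds 0) :=
      (((hδ.const_add B).const_add 1).const_mul (k:ℝ)).div_atTop hpn
    simpa [θ, Function.comp_def] using (Real.continuous_sqrt.tendsto 0).comp h1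
  have he : Tendsto e atTop (nhds 0) := by
    simpa using ((hδ.const_mul 3).add (hθ.const_mul 2)).add
      (((hθ.add (hinv 2)).const_mul (k:ℝ)).const_mul (2 * B))
  have hr : Tendsto r atTop (nhds 0) := by
    have h1 : Tendsto (fun n => 6 * k * (B + k ^ 2 * e n) / n) atTop (nhds 0) :=
      (((he.const_mul ((k:ℝ) ^ 2)).const_add B).const_mul (6 * k : ℝ)).div_atTop
        tendsto_natCast_atTop_atTop
    simpa using (he.const_mul ((k:ℝ) ^ 2)).add h1
  have hr1 : Tendsto (fun n : ℕ => r n + 1 / n) atTop (nhds 0) := by simpa using hr.add (hinv 1)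
  refine squeeze_zero' (Eventually.of_forall fun n => Metric.hausdorffDist_nonneg) ?_ hr1
  filter_upwards [eventually_ge_atTop (6 * k)] with n hkn
  have : NeZero n := ⟨by omega⟩
  have hn : (0:ℝ) < n := by exact_mod_cast Nat.pos_of_ne_zero (NeZero.ne n)
  have hδ0 : 0 ≤ δ n := add_nonneg (cutDist_nonneg _ _) (by positivity)
  have hθ0 : 0 ≤ θ n := Real.sqrt_nonneg _
  have he0 : 0 ≤ e n := by positivity
  have hr0 : 0 ≤ r n := by positivity
  obtain ⟨τ, hτ, hcut⟩ := exists_cutNorm_lt_of_cutDist_lt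
    (κ₁ := graphKernel (p n) (G n)) (κ₂ := κ) (δ := δ n) (lt_add_of_pos_right _ (by positivity))
  have hWm := measurable_comp_mpBij hκ hτ
  have hWB : ∀ x y, κ (τ x) (τ y) ∈ Icc 0 B := fun x y => hB _ _
  have hmat : ∀ {g : ℝ → Fin k}, IsExactColouring k g → ∀ a b,
      kernelMatrix (fun x y => κ (τ x) (τ y)) (g ∘ τ) a b = kernelMatrix κ g a b := by
    intro g hg a b
    rw [kernelMatrix, kernelMatrix, setIntegral_cell_comp hκ hg.1 hτ]
  refine Metric.hausdorffDist_le_of_mem_dist (by positivity) ?_ ?_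
  · rintro _ ⟨c, hc1, hc2, rfl⟩
    have he1 : δ n + 2 * B * (2 * k / n) ≤ e n := by
      have h1 : 2 * B * (k * (θ n + 2 / n)) = 2 * B * (k * θ n) + 2 * B * (2 * k / n) := by ring
      have h2 : 0 ≤ 2 * B * (k * θ n) := by positivity
      simp only [e]
      linarith
    obtain ⟨f, hf, hcf⟩ := exists_exactColouring_near_of_cutNorm_le hkn (hp n).1.le (G n) hWm hWB
      hcut.le he1 (c := c) ⟨hc1, hc2⟩
    obtain ⟨g, hg, hgf⟩ := hf.exists_comp_eqOn hk hτ
    refine ⟨kernelMatrix κ g, ?_, ?_⟩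
    · rw [MsetK_eq_closure hk]
      exact subset_closure ⟨g, hg, rfl⟩
    · refine (dist_pi_le_iff (by positivity)).2 fun a => (dist_pi_le_iff (by positivity)).2 fun b => ?_
      rw [Real.dist_eq, ← hmat hg, kernelMatrix, hgf, hgf]
      have h1 : (0:ℝ) ≤ 1 / n := by positivity
      exact (hcf a b).trans (le_add_of_nonneg_right h1)
  · intro M hM
    rw [MsetK_eq_closure hk] at hM
    obtain ⟨_, ⟨g, hg, rfl⟩, hMg⟩ := Metric.mem_closure_iff.1 hM (1 / n) (by positivity)
    have he2 : 3 * δ n + 2 * √(k * (1 + (B + δ n)) / (n * p n)) +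
        2 * B * (k * (√(k * (1 + (B + δ n)) / (n * p n)) + 1 / n)) ≤ e n := by
      simp only [e, θ]
      gcongr
      norm_num
    obtain ⟨c, hc, hcf⟩ := exists_isBalanced_near_of_cutNorm_le hkn (hp n) (G n) hWm hWB hcut.le he2
      (hg.comp hτ)
    refine ⟨_, ⟨c, hc.1, hc.2, rfl⟩, (dist_triangle _ (kernelMatrix κ g) _).trans ?_⟩
    rw [add_comm (r n)]
    refine add_le_add hMg.le ?_
    refine (dist_pi_le_iff hr0).2 fun a => (dist_pi_le_iff hr0).2 fun b => ?_
    rw [dist_comm, Real.dist_eq, ← hmat hg]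
    exact hcf a b

/-- For sequences of bounded density with `np → ∞`, convergence in the
partition metric to a bounded kernel is equivalent to convergence in the cut metric. -/
theorem partition_metric_iff_cut_metric (p : ℕ → ℝ) (hp : ∀ n, p n ∈ Ioc (0:ℝ) 1)
    (hpn : Tendsto (fun n : ℕ => (n:ℝ) * p n) atTop atTop)
    (G : ∀ n, SimpleGraph (Fin n)) (C : ℝ) (hden : DensityBoundedBy p G C)
    (κ : ℝ → ℝ → ℝ) (hκmeas : Measurable (Function.uncurry κ))
    (hκsymm : ∀ x y, κ x y = κ y x) (hκpos : ∀ x y, 0 ≤ κ x y)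
    (C' : ℝ)
    (hκbdd : ∀ᵐ q ∂(volume.restrict (Icc (0:ℝ) 1 ×ˢ Icc (0:ℝ) 1)), κ q.1 q.2 ≤ C') :
    (∀ k : ℕ, 2 ≤ k →
      Tendsto (fun n => Metric.hausdorffDist (MsetG k (p n) (G n)) (MsetK k κ))
        atTop (nhds 0)) ↔
    Tendsto (fun n => cutDist (graphKernel (p n) (G n)) κ) atTop (nhds 0) := by
  set B := max C' 0
  let κ' : ℝ → ℝ → ℝ := fun x y => min (κ x y) B
  have hκ' : Measurable (Function.uncurry κ') := hκmeas.min measurable_const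
  have hB : ∀ x y, κ' x y ∈ Icc 0 B := fun x y =>
    ⟨le_min (hκpos x y) (le_max_right _ _), min_le_right _ _⟩
  have hae : ∀ᵐ q ∂(volume.restrict (Icc (0:ℝ) 1 ×ˢ Icc (0:ℝ) 1)), κ q.1 q.2 = κ' q.1 q.2 := by
    filter_upwards [hκbdd] with q hq
    exact (min_eq_left (hq.trans (le_max_left _ _))).symm
  have hM : ∀ k, MsetK k κ = MsetK k κ' := fun k => MsetK_congr k hae
  have hcut : ∀ W, cutDist W κ = cutDist W κ' := fun W => cutDist_congr_right W hae
  simp only [hM, hcut]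
  exact ⟨fun h => tendsto_cutDist_of_tendsto_hausdorffDist hp G hκ' hB h,
    fun h k hk => tendsto_hausdorffDist_of_tendsto_cutDist hp hpn G hκ' hB (by omega) h⟩
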